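/- A(24,10) ≤ 268. That is, every binary code of length 24 in which any two distinct codewords have Hamming distance at least 10 has at most 268 codewords. -/

import Mathlib

open Finset

set_option exponentiation.threshold 600

namespace CodeBound

/-! ### Johnson-scheme polynomials and positive semidefinite kernels -/

/-- `m! * C(a, m) * C(b, m)`. -/
def pairCount (m a b : ℕ) : ℤ := (m.factorial * a.choose m * b.choose m : ℕ)

/-- The number `k!` times the zonal-type polynomial attached to a pair of binary vectors
with cell sizes `a = n₁₁`, `c = n₁₀`, `d = n₀₁`, `b = n₀₀`. -/
def zonal (k a c d b : ℕ) : ℤ :=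
  ∑ x ∈ antidiagonal k, (-1) ^ x.2 * pairCount x.1 a b * pairCount x.2 c d

lemma succ_mul_pairCount_succ (m a b : ℕ) :
    ((m : ℤ) + 1) * pairCount (m + 1) a b = a * b * pairCount m (a - 1) (b - 1) := by
  rcases a with _ | a
  · simp [pairCount]
  rcases b with _ | b
  · simp [pairCount]
  have h1 := Nat.add_one_mul_choose_eq a m
  have h2 := Nat.add_one_mul_choose_eq b m
  have h1' : ((a : ℤ) + 1) * a.choose m = (a + 1).choose (m + 1) * (m + 1) := by exact_mod_cast h1
  have h2' : ((b : ℤ) + 1) * b.choose m = (b + 1).choose (m + 1) * (m + 1) := by exact_mod_cast h2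
  simp only [pairCount, Nat.factorial_succ, Nat.add_sub_cancel]
  push_cast
  linear_combination (-(m.factorial : ℤ) * (b + 1) * b.choose m) * h1' -
    ((m.factorial : ℤ) * (a + 1).choose (m + 1) * (m + 1)) * h2'

lemma succ_mul_zonal_succ (k a c d b : ℕ) :
    ((k : ℤ) + 1) * zonal (k + 1) a c d b =
      a * b * zonal k (a - 1) c d (b - 1) - c * d * zonal k a (c - 1) (d - 1) b := by
  have key : ∀ x ∈ antidiagonal (k + 1), ((k : ℤ) + 1) *
      ((-1) ^ x.2 * pairCount x.1 a b * pairCount x.2 c d) =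
      (x.1 * ((-1) ^ x.2 * pairCount x.1 a b * pairCount x.2 c d)) +
      (x.2 * ((-1) ^ x.2 * pairCount x.1 a b * pairCount x.2 c d)) := by
    intro x hx
    have : ((x.1 : ℤ) + x.2) = k + 1 := by exact_mod_cast (mem_antidiagonal.1 hx)
    rw [← this]; ring
  simp only [zonal]
  rw [mul_sum, sum_congr rfl key, sum_add_distrib,
    Nat.sum_antidiagonal_succ (f := fun x : ℕ × ℕ =>
      ((x.1 : ℤ) * ((-1) ^ x.2 * pairCount x.1 a b * pairCount x.2 c d))),
    Nat.sum_antidiagonal_succ' (f := fun x : ℕ × ℕ =>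
      ((x.2 : ℤ) * ((-1) ^ x.2 * pairCount x.1 a b * pairCount x.2 c d))),
    mul_sum, mul_sum]
  simp only [Nat.cast_zero, zero_mul, zero_add, sub_eq_add_neg, ← sum_neg_distrib]
  congr 1
  · refine sum_congr rfl fun x _ => ?_
    have := succ_mul_pairCount_succ x.1 a b
    push_cast
    linear_combination ((-1) ^ x.2 * pairCount x.2 c d) * this
  · refine sum_congr rfl fun x _ => ?_
    have := succ_mul_pairCount_succ x.2 c d
    push_cast
    rw [pow_succ]
    linear_combination (-(-1) ^ x.2 * pairCount x.1 a b) * this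

@[simp] lemma zonal_zero (a c d b : ℕ) : zonal 0 a c d b = 1 := by simp [zonal, pairCount]

lemma zonal_one (a c d b : ℕ) : zonal 1 a c d b = a * b - c * d := by
  simpa using succ_mul_zonal_succ 0 a c d b

section Cells

variable {ι : Type*} [DecidableEq ι]

/-- The number of `i ∈ S` at which `(u i, v i) = (p, q)`. -/
def cell (S : Finset ι) (u v : ι → Bool) (p q : Bool) : ℕ := #{i ∈ S | u i = p ∧ v i = q}

/-- `zonal` evaluated at the cell sizes of `u` and `v` on `S`. -/
def zonalOn (k : ℕ) (S : Finset ι) (u v : ι → Bool) : ℤ :=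
  zonal k (cell S u v true true) (cell S u v true false) (cell S u v false true)
    (cell S u v false false)

lemma cell_erase {S : Finset ι} {a : ι} (ha : a ∈ S) (u v : ι → Bool) (p q : Bool) :
    cell (S.erase a) u v p q = cell S u v p q - if u a = p ∧ v a = q then 1 else 0 := by
  unfold cell
  rw [filter_erase]
  split_ifs with h
  · rw [card_erase_of_mem (by simp [ha, h])]
  · rw [erase_eq_of_notMem (by simp [h])]; rfl

lemma two_mul_succ_mul_zonalOn_succ (k : ℕ) (S : Finset ι) (u v : ι → Bool) :
    2 * ((k : ℤ) + 1) * zonalOn (k + 1) S u v =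
      ∑ a ∈ S, ∑ b ∈ S, (((u a).toNat : ℤ) - (u b).toNat) * (((v a).toNat : ℤ) - (v b).toNat) *
        zonalOn k ((S.erase a).erase b) u v := by
  set n11 := cell S u v true true with h11
  set n10 := cell S u v true false with h10
  set n01 := cell S u v false true with h01
  set n00 := cell S u v false false with h00
  have key : ∀ a ∈ S, ∀ b ∈ S,
      (((u a).toNat : ℤ) - (u b).toNat) * (((v a).toNat : ℤ) - (v b).toNat) *
        zonalOn k ((S.erase a).erase b) u v =
      (((if u a = true ∧ v a = true then 1 else 0) * (if u b = false ∧ v b = false then 1 else 0) +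
       (if u a = false ∧ v a = false then 1 else 0) * (if u b = true ∧ v b = true then 1 else 0)) *
        zonal k (n11 - 1) n10 n01 (n00 - 1) -
      ((if u a = true ∧ v a = false then 1 else 0) * (if u b = false ∧ v b = true then 1 else 0) +
       (if u a = false ∧ v a = true then 1 else 0) * (if u b = true ∧ v b = false then 1 else 0)) *
        zonal k n11 (n10 - 1) (n01 - 1) n00 : ℤ) := by
    intro a ha b hb
    by_cases hab : b = a
    · subst hab; cases u b <;> cases v b <;> simp
    have hb' : b ∈ S.erase a := mem_erase.2 ⟨hab, hb⟩
    simp only [zonalOn, cell_erase hb', cell_erase ha, ← h11, ← h10, ← h01, ← h00]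
    cases u a <;> cases v a <;> cases u b <;> cases v b <;> simp
  have hc : ∀ p q, (∑ a ∈ S, if u a = p ∧ v a = q then (1 : ℤ) else 0) = cell S u v p q := by
    intro p q; simp [cell]
  rw [sum_congr rfl fun a ha => sum_congr rfl fun b hb => key a ha b hb]
  simp only [sum_sub_distrib, ← sum_mul, sum_add_distrib, ← mul_sum, hc]
  have := succ_mul_zonal_succ k n11 n10 n01 n00
  simp only [zonalOn, ← h11, ← h10, ← h01, ← h00]
  linear_combination 2 * this

/-- Positive semidefiniteness of an integer kernel on a finite set. -/
def PSDOn {α : Type*} (P : Finset α) (F : α → α → ℤ) : Prop :=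
  ∀ g : α → ℤ, 0 ≤ ∑ p ∈ P, ∑ q ∈ P, g p * g q * F p q

lemma PSDOn.zonalOn_mul {α : Type*} {P : Finset α} (u : α → ι → Bool) (k : ℕ) :
    ∀ (S : Finset ι) {F : α → α → ℤ}, PSDOn P F →
      PSDOn P fun p q => zonalOn k S (u p) (u q) * F p q := by
  induction k with
  | zero => intro S F hF; simpa [zonalOn] using hF
  | succ k ih =>
    intro S F hF g
    have hpos : (0 : ℤ) < 2 * ((k : ℤ) + 1) := by positivity
    refine nonneg_of_mul_nonneg_right ?_ hpos
    have : 2 * ((k : ℤ) + 1) * ∑ p ∈ P, ∑ q ∈ P, g p * g q * (zonalOn (k + 1) S (u p) (u q) * F p q)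
        = ∑ a ∈ S, ∑ b ∈ S, ∑ p ∈ P, ∑ q ∈ P,
          (g p * (((u p a).toNat : ℤ) - (u p b).toNat)) *
          (g q * (((u q a).toNat : ℤ) - (u q b).toNat)) *
          (zonalOn k ((S.erase a).erase b) (u p) (u q) * F p q) := by
      have hsw : ∀ f : ι → ι → α → α → ℤ, ∑ a ∈ S, ∑ b ∈ S, ∑ p ∈ P, ∑ q ∈ P, f a b p q =
          ∑ p ∈ P, ∑ q ∈ P, ∑ a ∈ S, ∑ b ∈ S, f a b p q := by
        intro f
        have h1 : ∀ a ∈ S, ∑ b ∈ S, ∑ p ∈ P, ∑ q ∈ P, f a b p q =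
            ∑ p ∈ P, ∑ q ∈ P, ∑ b ∈ S, f a b p q := fun a _ => by
          rw [sum_comm]; exact sum_congr rfl fun p _ => sum_comm
        rw [sum_congr rfl h1, sum_comm]
        exact sum_congr rfl fun p _ => sum_comm
      rw [hsw, mul_sum]
      refine sum_congr rfl fun p _ => ?_
      rw [mul_sum]
      refine sum_congr rfl fun q _ => ?_
      have := two_mul_succ_mul_zonalOn_succ k S (u p) (u q)
      calc _ = g p * g q * F p q * (2 * ((k : ℤ) + 1) * zonalOn (k + 1) S (u p) (u q)) := by ring
        _ = _ := by
          rw [this, mul_sum]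
          refine sum_congr rfl fun a _ => ?_
          rw [mul_sum]
          refine sum_congr rfl fun b _ => ?_
          ring
    rw [this]
    exact sum_nonneg fun a _ => sum_nonneg fun b _ => ih _ hF _

lemma PSDOn.sum {α β : Type*} {P : Finset α} {B : Finset β} {F : β → α → α → ℤ}
    (h : ∀ b ∈ B, PSDOn P (F b)) : PSDOn P fun p q => ∑ b ∈ B, F b p q := by
  intro g
  simp only [mul_sum]
  have h1 : ∀ p ∈ P, ∑ q ∈ P, ∑ b ∈ B, g p * g q * F b p q =
      ∑ b ∈ B, ∑ q ∈ P, g p * g q * F b p q := fun p _ => sum_comm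
  rw [sum_congr rfl h1, sum_comm]
  exact sum_nonneg fun b hb => h b hb g

lemma PSDOn.mul_self {α : Type*} (P : Finset α) (f : α → ℤ) : PSDOn P fun p q => f p * f q := by
  intro g
  have : ∑ p ∈ P, ∑ q ∈ P, g p * g q * (f p * f q) = (∑ p ∈ P, g p * f p) ^ 2 := by
    rw [sq, sum_mul_sum]
    exact sum_congr rfl fun p _ => sum_congr rfl fun q _ => by ring
  rw [this]; positivity

end Cells

set_option maxRecDepth 100000

@[irreducible] def dataE : List (List (List (List ℕ))) :=
  [[[[0x1b3ea56a189], [0x110a1594089], [0xda89430309], [0x6c50026709], [0x29d3539209], [0x39d50d58009d91bb49], [0x3a4d9b900056a7ac49], [0x246b0ed89], [0x6cc3ac80001426349], [0x6fe6e880008760000002f28dc9], [0x39c57600000ab75c0000cf634002828f6c0006ed254001d3cf309], [0x59382d000554af9c9], [0x31d5ca800093787c9]]], [[[0x743300025dbdec001a2385801136743c0100342b401fb74a8c9, 0, 0, 0x215ae000045d785800030aadc0015e1c3c8, 0x43ad28000202a600003ce1d88, 0x5c8100000477b800033f4200000e80b06, 0x26b7800000d0380000024280000140680000047644, 0x29918000002614000001e440000533c80000bb55c2,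 0x23dd8000003bd000000345c00000938c00000065c1, 0x1cb48000002cc00000001c000000f44c0, 0x123100000008d0000005454000003a1c0, 0x1b2a00000001400009dfac40, 0xad40000000abc00000246c1], [0x15026b8000dddad40001e9f5000b7a94340001c3ff4013940c6c9, 0, 0, 0x3b20c68003a1308000046a4008, 0x14a7f000011df140013aa3b8000daa1888, 0x7c9a00005a5940000c8bdb000084a3e06, 0x249700000003b00000041e800019c7600000dd6844, 0x2abef0000088d4c2, 0x2cff8000000af80000425080000138801, 0x1bcc80000027f0000000b18000010f740, 0x12cc80000016680000188cc0, 0x3e3680015936b40, 0xc6c0000000d5c1], [0x78c3800003f194c0018c68a400048a8800002dfd40002e9b674003ee25c40068d33940014df24800080bac8005b3c10c9, 0, 0, 0x52e57a000012c9500002d1bd8000222940000f5350c8, 0xb45ec0000182aa400028463c8, 0x21960000002eb800004b288000007724000030700000113e500003d2e980000d35d00004285280000bea986, 0x10f3800000b158000003a58000004c6800000ae8800000234000000fe4c000046844000050fa400007d2fc4, 0x18560000002718000006158000000f0400000619c00000209c00000377400001d5a8000001bcc2, 0x1a0c0000009354000006ed8000000ae400003006c00000f91800002fd88000413a640000914681,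 0x1f73800000680c00001ffb4000005f9000001c26800000dc800002508100, 0x12818000000b580000024c4000005df80000020d0000000a800006142000, 0x17c3000000c9d0000000b5c00000468c0, 0x15f6000000c1c8000003ecc000017c901], [0xa5f635800430256000623d484000eb2de8000584f64009c0e35c9, 0, 0, 0x75e8780000e8394000984e10000a748c80022b9bc8000d788b40020f4ff000113d3b4000dfa3008, 0x1059e0000201f440000f4788000908d6000038e7fc0001fa8708, 0x16bf800000ca70000001c500000312b800000d5c80003077380000b01100002654a00001848e46, 0xfef00000085600000019c8000008d800000036cc0000499e0000008aa84, 0xffc8000000d6c000004c4c00000048c000003a80000002f7c0000003202, 0x11ad8000005df4000002dcc0000005f8000000a3c0000019341, 0x15cf80000007040000007c0000000998000006e400000023ec0, 0xda48000001eb00000056e0000000ec0000001ec00, 0x105000000036600000003ac000001df80, 0x1a7000000005541], [0x57726d0001a4aa380011048780028d8bc00008f7888000119f849, 0, 0, 0x20e5b00001fa13780007424788, 0, 0, 0, 0, 0, 0, 0, 0, 0x2b5300000050a40000010c41], [0x5085050000485e3c00223a88c00339f8b400184d38c9, 0, 0, 0x3fb8100000bad480001550040022a8f30000f14e9800118ec988],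 [0x1456468000acc8ac0005cf07c000692524000684d7c001190b40004913d18000424f989, 0, 0, 0xe2d38000079a4c000029914000083a7000004028000001c10000014816800005cee800005efe4000118ab00000058c800000a5488], [0x10593e80003dce48000208b4000007a94800091a88c9], [0x4dbb48000021a8c00035445400028b4b800011a7740001613fc0000b63540000c6114000ab3728000880f680003fc58c00004458c9], [0x8092b8000192494000030e400003bb6180000bc01c00012f53c0016cf630000b7a0c89], [0x696ff8000441f240000d1c2c000107c6c000300380000039b5000016beec00004dc90000d0d1e0000cb3da4001d9c1ec9], [0x8775f00000a683400008e42400058da200012305e4000183898000568dc49], [0x7b6f1000031390c00043bdf80000c61a0000183cf40001042dc00009f930000037c9c00646e6589]], [], [[], [], [0x95443f8009593b1400278397000319ca74002188a8000768a0749, 0, 0, 0x37e700000081c0d00028a1c1800172c898000ca660c0025293708, 0xb9cf800003d2980000b0420000050a0000034740400043a2c800081ad980000894fc00047fa348, 0x8b4c0000009d380002455000003df9680000b9c200005d40f80001610406, 0x1bc080000009940000067c8000009f58000001224000013f6c00002cb5000002b55800004ac704, 0x2e0d80000019040000086d80000195f000000b6a400002b500000000ec42, 0xf9fb000005be6400010def40012026e0000284ec41,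 0x2ca60000017e6000000576000000786c000000bf40001c0ea40, 0x176f1a80], [0x3f0568000fa8ef40001578f80035fc2e4003b1216800413331c000575f9800099694800072c7780002487c40052d5b1c9, 0x6bc2438001bb109c000c6b6c49, 0, 0x5cc1300001ffc400000ebd8c00036c63c0003a7f3c0002becd40019302e8000ed70a40003ec48000053f2048, 0x392b8000013e8800002ab9c00002a7c80001289dc000410d48000496d5c0005d3ca00000e974c8, 0x394400000013a0000363e600000c42780001fac9800017c61c6, 0xaa08000002470000009c60000005ab8000003298000007da8000002b740000559f8000009fc84, 0xf7980000005640000035b00000065b00000004fc000001ba80000057040000003a82, 0x152e00000056f00000074b0000001dd4000000cd41, 0x18ac8000001fb80000003f80000030380000055900, 0x21498000003ae800000a5100], [0x2490800001983400017f16c00024d7e400011d6f40007dfaac000598c4000054cf8400093cccc000b2cd24000668d54000512038000600e540010ec2740002d04a80022e677c9, 0x28751800007dc7409, 0x277f380000eaabc49, 0x1f2e98000018b3c0000405ec0000f7c200001045e4000103714000138340000121fa400007f278000972bf40004323fc0003965048], [0x812800000dcc400011840c00000318000000219c000323b8400004c31c0004a17ec0001a39840004a85b8000089600000c76824000315dd80007108e80000695740008e60c09,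 0x2bd760000064f8c00059ea4800013fa8c00087044c0007bfe100000d12489, 0x12e6468000ffb3989, 0x87788000027ad400005d6980000742a800005b4d400000ae0c0000573100000272cc00001e7c400001b1c000072a2a400034bfdc0003c6c348], [0x5680000053e9c00000729c0000760b40000010dc000130c4400002ad5c0001c3814000038b7400000611800003ac94000075b140000b1acc0001df4640002790000000a942000003c370000189a480001fc4ec000e968240000221589, 0xbe6b00000b32200000625140000da81c0000136240000152dc00002c74c9, 0xe8a4800008a4ec0001c4a9000007def4000055cd89, 0x3a54000000587000002b5a800000cb7c00003c32800006744800001352c000071c2000000699400002695400001e55000004af480000148e400000a364000032f240000029f8000012a148], [0x49c00000504d40000227fc0000a8b7400001e19c000074168000060bf0000159e8400001b4a0000071c2000003028800004e8e4000036c3c00004194c000012b4c00017097c0000a76240000f1d540000202ec0001db22c9], [0x8170000006207c0000130d0000079b4c00000582000008bf740000249ac0000db6bc00005dce4000093e2800000c10000000d804000041da400001d12c00001661400000c3b4000007584000007120000053d1400005c3a400001d9fc9], [0x996380000432980000475d400003bae80000e26a4000017088000036b5800006b02000000913400010464000002d3c000000a9640000ba0bc00000a59c0000697d40000c5f700002809d09],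 [0xce8a0000014f4c00003eb1000004b6ec0000156ac00001af1400005305c00000d6a40000fcbe000002d5f400002144c000016b6c00003b25400002e2fc00000c038000004a3c00009656400024c7600003064749], [0xe1180000043c54000051bb40000284e400008518800001601c00001680c000097c500000492c400017d3680000110f4000027e440000e2d700001122240000564fc00011f0c09], [0x16c1a000000a5ac0000659300000a7830000054c90000046ad800000b76c000157d700000c275c000071b6c0000992b000001dee40000220cc0000681cc00003750c0001c3d6c9]], [], [[], [], [], [], [0x3d7bea0001ffdca00023946540020a315c000fb5ea40026cb2ac0034cf4d4002e2bb5c9, 0, 0, 0x993bd00005678dc0006aa0900000f755c0002d1d4400070aaf00002390388], [0x13fb7880005549c000108b23c00020c5e0000410dd0000fa758c00074e61c000901050001268ee49, 0x18cb9e0001c7719c000bde0209, 0, 0x285c1000003479000004ee7c00003c2ac000bfda5000042ee300004f67488], [0x2ac53000001bac4000041db40001b328c00004bdb0000025f480000323f40000d600c00005e3ec0004efc24000092ea40000a453c00029deec000290f18000724ef80001367689, 0x2a47400000a10e8000009d7c0000854d89, 0x7e4f00000be12800014ee4000012111c0000aa6a0000041bb49, 0x790d000000eef8000004b080000800b800003dffc0000211cc00003487000000b9cc0000e3040000000e24000078ed0000007a5c000027d408],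 [0xbe58800005031c00009351c0000abb040000038ec000100c940000357a400010ad3400003342400008600800008fd5400004025c0000c9fa0000061010000067ce0000027c20000193f349], [0x2d10000002df400002cb8c000029b8c00002b19c000049c1c0000161f40000634cc0000318d400006c1b800002f75c00000d2b8000045ecc000087d3c00004661400001cc5800000cb48000045fb4000060f0400003035c00000b0540000ee2e80000ead200000c5b8c00000d3589], [0x1cd00000184fc000007f7400001ed3c00003516c00001159400001b930000012c680000581ec0000007cc000040bc800001d0cc00003b084000002d740000340dc000054a1400003cadc00000c33400004f31800000045000006c22c00003a18400009cbe49], [0x164800000ff3c00000333400001521400000098c0000032dc00002774c000004f1800004cf74000026c200000212c400000a704000027dd400000d86c0000282cc00000f4f400004d594000066ba4000001930000009dfc00000ddb80000241c000003e4bc00002637c00000cc400001e87d800003d8040000f2d389], [0x183000000fbf400000485c00000dacc0000086bc00002fdac000000f24000007a0000004106c00003438800001d04c00002bc3400000fe74000017bf8000022d7c0000344340000246f800000478400004197c00000748000000449000002cebc000079e4800006ce4400012cfd09], [0x1b3000001a9d4000000e7400002023c0000004cc000021d2c00000329000000b70000002153400001113c000042b94000006ed400004764400002c0780000187dc00001186400000491c00000c6e8000027864000010bcc0000150e800003a96800001f4a000001a93c000002b040000042580000201f800002eee400002ad089]],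 [], [[], [], [], [], [], [], [0x30999d80002d82f4007c43704004b8b524003dbaa9c9, 0, 0, 0x3c48e00000427440002d95d8000010aec0000bfea88], [0x795a0800017c2bc0000436480001cef0000019c4700006c462c000038f90000e7307c9], [0x1ab18800005adb400010b42000000749400003ff0400007bb4400007ec4c0000e29900000614fc00040cf58000085e7c0000446e00002f0a780001582c8000074ef40000836dc9], [0x17846800002383c000091d3c000058d4400004267c000069f6800012e810000018ff400002a63c0000127f400008246400014a9140001047a49], [0x53d08000006c7800002fd1400002a980000056c7c000072b8400001c57400002390c0000309c00000037a80000201ac0000488b00000ccf28000030c1000000e5f400000caac00001eee400002de0400002b6e400002f740000011c840001a9b0c00016d9580002c33bc9], [0x4261000000fe7c00000d9d400000a2d400005e4ac000050a5c00004557800001004000000000000004c34400001e07c00008a928000037e0c00000eed800002836000001bdb400000788c00001f860000014154000056e14000146bb09], [0x1aab0000000e7400000606800001f924000021d2c000008c0400000136c0000419d400000600800001655c0000218ac00003828000003e4dc00002038c0000062140000100a4000026e8c000005cc00000069fc00002434c00001f32c000028b3400000a5980000013e80000048bc00002805c00002cc1c0000369289]], [], [[], [], [], [], [], [], [], [], [0x14dc1000000b709c00020d0a800063f5c4000a1ffb400059e7d80002924649],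 [0x8f160800007d08c0008c3bec000048590000000e3c001bbad04000038b5c9], [0x4c11680000e498000033a5780000480b8000024f8c0004aad64000025ee40003160900000e5c5c0010b7e5c0009dca3000023c2f09], [0x327de00001145e80000ba0dc000026f5800002bebc00004467c00006419c000a2033800019eca400030e1809], [0x166290000041820000012f340000ab72000005ede800003dc9800005ab780000001e400006c8540000d0a240001234600000014e4000017dec00001af4c0000a708800003e3a40001e93649]], [], [[], [], [], [], [], [], [], [], [], [], [0xad19bc589], [0x66a770909], [0xfc9d5000034d2cc000188cec00008948c00085a4680000710fc006338ba09]]], [[[0xd986fe0015e176e00044b24a800de69ba49, 0, 0, 0x5cb93b800097f41c004f4f8048, 0x8b3380002d6e98000736fc80012946e08, 0x83c7000033cb300000de1206, 0x5be980000115e8000002c344, 0x6b928000078cc000011262c2, 0x484c8000002df80000000941, 0x435100000006d80, 0x241980000010c00000037ec0, 0x1c75800002025c0, 0xe4780000007b41, 406787, 333445], [0xc6b6b80008d536e0009413640001d5b5cc9, 0, 0, 0x5abc7300014440988, 0x17327500010887e08, 0x653960000dbeba000093fd986, 0x6b86800007e1b80000425144, 0x76098000003528000064ba4000013e382, 0x594b8000005f74000009aa41,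 0x5693800000422c0, 0x36c880000003b40, 0x2fdb800000d4dc0000886f00, 0x1eac01, 0x11de83], [0x50f4c5000086bf1400367d340001e0e688004766d4000187d94c0021a9d3400a24b3d49, 0, 0, 0x15f79c80004daa9400016f1e8001d3e3d00007b52f8001a71cf0000f91af40002dd9988, 0x15c6080000ba650000177ac8000068f2400033402c0002a8e480001701d800002bd388, 0x6b33a00001548c40003ccf406, 0x39b9700000126b00000b3ee800005ee784, 0x9268c800008bb642, 0x19c1d000018261800096cd9c00015afc81, 0x16b79000065108c0, 0x112f3800009eaa8000fdebc00, 0x122360000070a3c0, 0x11dbd80000d58981], [0xd0d6ae8001f55f600000cb83400697397800b3e296c9, 0, 0, 0x2aba130000337298002ac4cc0002228d64001bac8f88, 0xde08c80003c53fc0005580388, 0xcf41f00003ff3b46, 0x8b52e00000ffa204, 0x512fc0000027cd42, 0x3e6ba01, 0x5ff5f00, 0x32b9580, 0x3c7d400], [0xd990a00000c6fec0006073380018c67b0001b026e8001a72d7c0027a984800361107000134da880015f5460000648d6c005d3c4ec9, 0, 0, 0x26c0600000d97e000009416800009e0ac0001c8c180000c685400005e1f000154c028001ff893000023f7208], [0xbc2bd0000483250000449e4c00010d560003ebe728001e4bb20000f0614800140f1e4001c973cc000e1dcf09,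 0, 0, 0x1cb2300000376a400021280800004dca80000a97d40022df7c800114f9900013609888], [0x720038000293cfc000456c2800006d794000e515600007fb4a400036453c00059b9240005f69a40036528c800298a838001c70e289, 0, 0, 0x28732800012166000006fa5c000274be80000390240000524588], [0x758f98000037a3c0000b368000037f9e0000d49bc0000298c08000c429c00001c5ee0000bc0d689], [0x26d7560001f455a0000aed54c0000e281c9], [0x2824f6309], [0x3e1f03000005853c008aaf3b801408a528002f20f789], [0x1bf84f80029e8c5c000408f280030f41a09], [0x1f88d40000014ad000005f1240006f2d0400001259000249f3a09]], [], [[], [], [0x6ce95e00052aaad800386bb94002325448001113bf40016799840114b90749, 0, 0, 0x23e7d300002f38cc0010f47a40035072f0000f223900004d00b80004d76208, 0x1ff09000011a5d800002450400038038c00019da880000be5380000e4f888, 0x1b03000000dc3840001a0c480004e328c00014c20800037c0c46, 0x1083c800002c6540002363f000025dd500003d31e84, 0x1f26e8000695c74000062cf82, 0x28f5600009bc90400016f4201, 0x163e1980, 0x15780800165ea000, 0x14f9700, 0x1d7e881], [0x2ade3a8002e15cec0015cb0fc0044cdc640029c4ddc0013904300000306d8000973aa8008090efc9, 0x2d4312800416ddf00011e15f80010c77c89,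 0, 0x35938c0000d6508c0005ce09000011723c8, 0x588a9000048bd940009341d80000ce9e88, 0x4d68a000011a31800049efb80002b19a46, 0x63dd8000009c1400015c3e00000294684, 0x748980000043e000001a7d0000000bac2, 0x6a1b80000023d41, 0x824a8000000de80000197980, 0x692c000000a9500, 0x7e038000000a740, 0x924e01], [0x2005480000b148800009d1580000387ac00006b2240001702480001bd8e40004af52400058f1cc000a0165c00039feec000a65064000eb088c0000b34740021438449, 0x2e6fa8000603e1800033be48000a8ca400002596889, 0x2f5498000809940001df61f00003743b89, 0x13775800010f1900000c14900000a1748000123628000013cf40000f05d400001be1c00006b28400000dbd400077b90c0004c295400023ad348, 0, 0, 0, 0, 0, 0, 0, 0, 0x658281], [0x1d45c00000a7a180000a8b8c00039f4fc000046f380002f6fd800044741c0007437c400087b4700006d5ca40006366ac0003a5fc00001c1cd80007639b00005286089, 0x84d8b000032254c0002d127c0002136ec0009ecad09, 0xa97e800040efc0000fdb3600011b0d709, 0x104ad0000052f3800001cc34000074660000087bfc0000ed7dc000035ad4000062f180007f37b40004ef2cc000562df48], [0xf3ef8000036d380000f50840001345dc0000a5a2c0000f515c0001308f00000f9e08000176a5400007012000002925c000240c6c0002b8ce00000eb5100002481e8000130b400004fdd4c00131f554000174f249,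 0x145a90000026db40000dcb7c00008b688000030bc400000751c9, 0x4b310000008e44000098e9800005c0c40001e03f8000060ff400005d2809, 0x60c100000024a4000028a24000044d600000118180000eead000000c984000008b4400006e6d00000d056000001d1300000257dc0000419d0000019e8c0000095d48], [0x1636b00001134680000b7e140000ff4c80000ef694000122ff000011be6800004bd4800000a8f80001021f800012098c0000751dc00001a0bc0000038e40001987949], [0xf7fb800001c2e4000092c58000047ee000002fac8000202b44000087b7c0000230d00000d99e40000872980000b5fe8000165ccc0000cc0d80000857ec00002ff100005659780003cd6180001a659400004b4a49], [0x13f2480000a074c0001071180000c03200000b22b40000038cc00011ce400000188e0000020038000153cd0000011200000070cb40002ae0800002082f09], [0x165890000122e8400002837000003103c0001820c00000559d8000184a7800002a73c0000119f40000094e40000ee12800002978c00008d160000033a300002e16c4000779b24000a6da949], [0x28d2e00000193e8000049f3800008d2680001fb2680002ab3e80000a6ab8000039e300002dae38000747a2c000067450000f81fe09], [0x3a06a8000050c20000172e780000141380000911200001492b40001eabfc00013cef8000024c20000005db40001751ac000033cbc0004f14189]], [], [[], [], [], [], [0x52e16f000038f1d00024d945c001092d380042dbb80000ce5c34004d2405c9,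 0, 0, 0x3215c00002a50a800083f06800037009c000684ac00000c5d6c000002abc00025930c000000e808], [0x3d91080003b528800021b2c00005a5fc40009b92100006abb980011c88740012bb7a4000da5d3000017abac00054beb40007c188c000ca4be49, 0x140d6000019822c00010357c00024f8200003d32300011ff9380011ea6a4000410a049, 0, 0x9fe600000aa8c000007ffac0000889f00000881d00000cd2e00000bb798000008f380000667840008a5158000406e0000049e9608], [0x17a510000113b780000cc5b00001455c80000ddc9400012d8fc00017182000007049c000060c1c0001f1f680001aca240000d8cec0002698cc0000d6b9c000467210000ae6a680001c91689, 0x7da58000063f240000b561800008a46800017a5180000b31cc000028fa800001b3889, 0x494b800000380400004db7000007f9b8000175bd00001015b40000c479000003ab1c9, 0x118d180000060f800004907c0000aebc8000082dd800008908000003114c000020d400000023cc000008fb48], [0x7c930000015f580000214e800008255c00006801400009e58800008565c00000f2c000006f8cc000047adc00007f84400004c86400007f5340000f117800004e7d800000712000000bcb400032a3bc9], [0x484f80000120980000049d00000176d400001338800002014c00000b2c0000013ff400001a3b4000000ac4000004fa400001c314000037c6400002228400001766400003d67400001307c00005cd0c00001ee0c000017964000012ff40000200b400006de6c00000c7789],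 [0x407800000133380000032a00000218cc00000fef4000010e6c00000222400001646800005138c00002d0a000000b70000004018c00001aaec00005f754000025114000014b3c0000588c40000023fc000051d6400010383c0001483949], [0x40d7800000557800000d1cc00002c254000021140000025004000005370000033508000003dd0000035b0000008059c000004ed000001936c000026cb800001e67000004bb1c0000330e0000002b340000096980000596fc00003f82c00003a03000000e58c0000de5ac000257c4000000b9f89], [0x5f0c8000036f7000002e3d00000458e800008f6c400000215c000014a040000b774000001122c000007e8800001ca10000022df800001485400001be5000000c084000009010000046b4800005ac740000822949], [0x75fd000000f5c000001346800008197400001f174000091ad000000c3d000005372800000b60c00002f9b4000076758000024f700000397c8000008dbc000047874000035af4000008c8c00001bb6800000a8200000038b800000a9e400003349400005dcb49]], [], [[], [], [], [], [], [], [0x93c0d000031eefc000083abc0003deda8000fda2f00001eef3800289fc7000064a3f000405570c0065ce7cc00193888c9, 0, 0, 0x1fa2700000e50000002b48a800009347c00021f5f800000e66000005dde08], [0x39c3e800002becc0001fc57c00034a118000105e7c0000467f4000171b3c00002eb4400015f13c0000654e0000111bf49], [0x273a500000481480000cdc800001a23f00000213840000639e00001ee3700000975200000e741000001517000056389c0003582a40000ef4100000288689],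 [0x8ba20000024e14000029d5800001e30000007ef1c0000b22f00000825140000435bc00007ce78000033d9c000058e9000000d158000007b5c00005a1d800000e0f400007af9400019c4100000130289], [0x547c800000b8ec000024ea800000e51000004345c000001c78000035b6c00007f4700000061a400000f574000030e24000027db40000239e0000038ad400000924c00000f7b40000447b00000370ec0000332d400000a62000000ded00001c2b840001583889], [0x2d208000002b0c000008bec00000eb28000019dd400001112400000659400002d31c00002e5280000044d0000004f9800004b2ec0000172a4000024e24000039f4400001d114000005fd40000212a400000758c000013de40000a4a44000026ae40000a51b49], [0x270e0000007a7800000957000000989800000e884000003d540000005180000082fc00000359c000004bf400001b334000020a0400000eea4000015ab400001435400001b45400001f9d4000006acc000001fa000000257800000984000000a83c000007c2c00000660400000257400003491c0000700609]], [], [[], [], [], [], [], [], [], [], [0xc93870000a02dd80002d37d80001bc05000108837c000d433940006566280000c7a649], [0x403cc800001959000006570c0005170d80000069e000042543c00007a62000001d33c0007d95b4000a5c0609], [0x1e8c78000015ee000000432000003da240000eede00000ef90000021ab780000633e800002d70000011972400003a80400012b14000001b13c00039043c00044d99c0009e81049], [0xff1480000007f40000363d80000f7d9c00001c59c0000872200000d01100000158d000000aeec000004e2800002abc8000023664000398090000091c840001128ec9],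 [0xbf99000004762000006c31400004fe2000001b0d80000137ac000073c580000341bc000035ec000002a1700000011e4000047278000029e68000008e6c00000897800000679000000a18800001a6b000003462c000063be49]], [], [[], [], [], [], [], [], [], [], [], [], [0x4576e4280088dcfb80012ca0fc9], [0x436e6f80005f6e44002c45d549], [0x39e810000029954000169c3000007a528000015de400005cfec0001500400002989480000c8ad4000011f28000044e2000024d68000004ece400045f3889]], [], [[], [], [], [], [], [], [], [], [], [], [], [], [0x22b29e8000059314002259c709]]], [[[0x4352360003b2439400dc0496800d7755900105724bc9, 0, 0, 0x1952fb000000b290003a85a100008753ec002d944448, 0x4d3180000350600001758a0000ca9568002207ea08, 0x4b5d000002084000002f820000345cb00000d85306, 0xa161000000ec0c4, 0x54bc8000006f940003485dc0007666202, 0x4679000000832c00000c204000000b141, 0x3d15000000030c000003ed40, 0x29be000000fafc0, 0x11de3b00, 0x171581], [0x30524c0003b3b8d001050128800357c97000bbe61149, 0, 0, 0xa312f0001655060002f961f00033b33600010cc5e88, 0x367700000618a0000131c80001386da8000e0d9788, 0x34c30000045fa0000395d70000e9700000052b3206, 0x37a98000003c280001bb6d00000eebec4, 0x4efd0000004564000009fb800001ea0c000005d682,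 0x6bb480000798e01, 0x35cc00000021980000089cc0, 0x6c6b80, 0x1a49aa80], [0x17c4738001025b40001c354880002d35f80024a8af4001e807f400c60e4380015b872c003092e8800b73577c9, 0, 0, 0x9c3cf0000511e500005100f0001af93bc001a6a7f800025596400392ff700016b5fbc0017a92888, 0x3a3d800006fa4400002f9bc00006749400012f9ac0004051900003f82c80004b41400002727bc0000750ec8, 0x60df800006331400001c3200000a463c0004e576000002259800033d0f00000b7fc46, 0x26cb8000003270000019ae0000000de800003202c000214a3c00024bdcc00039f6a44, 0x4c7d000002075000000322c0000b789c00000c8b02, 0x3a650000008dc0000094000000039b240000aa95c0009e4f200001638f41, 0x5166000000992800000a9700000f33400, 0x5eb100000111a00000114ec000003700000b1bb500], [0x752b9480017fb76c005de0d7800b7f2ab00017b5b4400862497800a11187c9, 0, 0, 0xc6854000003398400149349000026ddd80030f0fd0001cb5f9400200afd08, 0x965900000c2fc8000034468000092240000a76e8800020570c00045bc288, 0x28a78000023f48000009f680000287f8000223f280000815980003f57380001c638c6, 0x329e8000007520000015c340000fd4e800001cac04, 0x52870000000178000004d380000158b00000006cc2, 0x565200000034340000011381, 0xa88000000380280], [0x276f07000074bf180014b66d000067665c002b282e800386d0200009a8ce00017e1348000dc59240065fdd0c9,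 0, 0, 0x2ffda680001a1a048], [0x4905fb80005230b00041379b0000acc4e8003053e540045af6e09, 0, 0, 0x23df6d80012ba0200014a0af88], [0xaaec2800000ccc400065fc6000077ad4c0002297140002b039c00058ecec0060e03d0000a523480038e0f389, 0, 0, 0x1a3368000034cbc000166ef80001746f000001d30400038a0300000669a40000a83008], [0xaac6d80006d2c20000105a78001b5c750000412fd80030420889], [0xb289c800002b73c0004e44140001014280000007ec0014204c0001ea6c6000099b3bc00006b6909], [0x169bb8b801e3cd3189], [0x675d03a006c3c70889]], [], [[], [], [0x329f2a0000556328002b89370002e2c6a40054285380013621d8003211e900021f07a40145c04349, 0, 0, 0x5466a00002e060c00096fc300006405280015474c8000e3a69c004d8f170000636314000b80238000ad69cc8, 0x7c63900002ad188000023a1c00032077c8, 0x5aa70000000d6ec0004df2f0000082c946, 0x2fad0000003ab0000026f0c000129d2400014d8dc00020a7fc4, 0x2230800001142c0000050dc00000215000000633c00000f3780000321940000025882, 0x25d4800000884c0000069a400002450c000008ed000003f748000245c8c0000531f01, 0x3a6b000000657c000027fbc00000d45400031d35c0, 0x1816000000abd8000006ba8000000650000001acc00068cd400, 0x1b3a00000014b80000038980,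 0x1f2a0000001bdc00001ea081], [0x149cc000010b84c000162dbc00021d3f540027efe8400252ac7c001990ff80006b51e8000b232b400613e9cc9, 0x19ac0980007245400012b9bf00040c14e800161d0589, 0, 0x7edde000093e30c000534328000de93640020a08980003719cc00087b1d0000344cd88, 0x188e00000112c800002bb000000382d8000021c5c000182a100002e189800030045c0006a2078000191bb08, 0xc72000000097c0000052f00000142400000236d000000e7600002e3c280000a9d600002dd7f00001a16346, 0xb1a8000007e70000006308000005ee0000006e500000051140000508000000095504, 0xebc00000012cc000000a58000002d540000027c4000000708000000ae00000005980000000f42, 0xeb100000047fc000001c54000001d340000033d40000003c40000024f81, 0x12e58000002ce40000020e00000031d000000042c000003b980000055e00, 0xf6a8000003b700000011b80000008dc0, 0x19cf00000014900000022f80], [0x25b210000246fb00000d3000000777d980001703d40002d779c00077c7880006429a40010429cc0008e85c4000da1f040018e396c0006bd4dc0005ea88c9, 0x78f940000ab2e080004c961400086c5409, 0x9f4a80000a42f800124783000100cf30001ac3dd89, 0x5fe580000a88b0000084bf8000062f48000174b980000786a0000006cc80000041080001306cc0000460dc00008f50c000003314000699edc0005394f4000128c2c8], [0x2b4e2000001937400056aa7c00016599000040b7080002a9c840007d8224000fb3060000a176840003738f40003c7c50000455fb80005f4e880006e78a09,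 0x9ae0000007915800001df0800000eb780001f2f700006e7f400004797a40001197400007a86b400117b0689, 0x4a7f80000114e0000778a08000c53ca80012718709, 0x5ce6800001c1a800000b624000071d2800008dd900000209b0000029a880000c836c0001be0ac00003265c0000b9be80007a1e8c00037f8d4000413f648], [0x140b480000675fc00008a1740001360940000951340002984c80000e5ed00000b20740001769880000e53800003c00fc0002015000001212f80004abe400000e893000017c7c40019ce72c0000f5e589, 0x5fb30000010a9800000b4980000a163000000880c0000c253c0001ec7a00000491f400004d2e09, 0x2a7c80000020900000029e800000db0c0000565480000339ec000205730000046d7c000064e489, 0x32f800000182b800001ef0800002c9d80000147f000001f08c000027ba000006dc6000008b0400000159ec000052df800000bab000008cca8000032130000008fb00000b8b500000273c40000205588], [0x1d2fd800002ec2c000096f380000bd244000228c400000e37180000e6d580000216d000010aca00001d2e5400002d2ac0002b51900000aa2900002afda89], [0x14963800000a09800004eb000000de0d4000028b0c00003bc000000a71bc0002031200002288c800004136c0000c877800007b3000000569800003729d00004b3ba8000151b0c0000125c49], [0x1d7cd800006b47000008bccc00001ed4c0000c15e800000765c00002e3b00005bff280000a1d380000dc3ac00089e5b000002d89c9], [0x3c1dc00000f91540001f01c8000055c84000068b400000339580004e27a80000106dc00007072c000111ef80008b069000109295c0001120849],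 [0x5eb1e80003276c000014d5b8000153370000483ad8000eaea8400017c068001b9132c9], [0x6624a809]], [], [[], [], [], [], [0x6d49b0000449a00000280f7400141a5a400193e4b80003e1acc003802298000e7bf7c0011c08c4002901758005826bd0000668b1000944d6049, 0, 0, 0xd4be000008945000004c374000009eb80000345380000729880003928900007bdbd00006e00ac0007a67600001fcc740008b53b8000151c240005575388, 0, 0, 0, 0, 0, 0, 0, 0, 0x3355000000239c1], [0x65c0e00002da8180003c2dc400043a8c00008eab5800129da4c00060ff5800039f200000491a540005a75e400090d74c00097348c9, 0xd80c000002eb380000e2f240000bd2540000e19880008398d00009b88b800037db440015f2a349, 0, 0x38c60000042508000013e900000129f00000589f000007100c0001089200000306f000005c39c0000fe6480000711400000653ec00053dee800054dd2800058ef908], [0x93d08000001900000041520000029268000030a800000b5ec000020889000005786c00007f53400006597000002da70000083fa80002120000001f5d940000c37740004102c40000f9d0c0002a42a00010205700000004c09, 0x36c70000049a98000025d60000031e140000611300000fadc000007a8f000013ed2400005c9d000001c53c9, 0x152d800000467800000326800000222800002a7800000414100001a8d900000e55040000e39e80000333549, 0x2091000002111000000545000003001800001619800001031800000e838000001fc40000300300000b237800003f33000001e0fc000078240000053dc0000008530000016b8400003045c00000f3d00000195d48],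 [0x68d580000260900000032c800003fce8000001b8c000012c78000131a30000016b5c000096d7400003d0c80000432f80000974c400004c7a0000020b3400014ccd0000086408000079574000031de400052e28c9], [0x4ddf000000fe4800001babc00002c8a800000105000006f2a800005949800004733c000012f9800001ad040000339b8000025adc000078ecc0000056e000001c9cc00004e0b4000054b30000020b1c00000fd9400005acf800002ca4c00003877c00000a74c9], [0x4d44000001e0f8000002f3000001d1ac00003193c00004b210000010d00000082c9c000098e90000010ff4000072d7c00001bb30000098fac00004c2c800001d10400003bc4c00002a02000006990400016b8dc00002c6a49], [0x681b0000058aec0000171100000375b0000049ab8000033e9800004825400001d494000014d680000d59c000004aee80000222e400006f5f8000034f3000000d9a800001a22800002a73c00006f9c000001253800023c68c0001a8eec00017920c9], [0x83b98000061dd000004f3a000005acec00000b8200000622300000836e800000f088000038b8800000709000014a1b800000e4f800005b1500000588c00000933a00000da6f4000030ffc0002e51209], [0xf580800002a90800005dcd80000078000000058c400007998800002ed8000014a38800000c0140000cb6b400002343c000131874000071b200000684e000001f44000008a30c0000252340001e09e89]], [], [[], [], [], [], [], [], [0x2c18e80000b1944000001f080000894b40002313900002bef040000cf19400021428000157fda80003f12d8001b703e00009134200011e1f5c0067f36d40000f56709,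 0, 0, 0x69158000014b0400000095000002508c00003f870000106e100000484ec0000cff800000a54a0000191df8000084f1c0000bd8e00000441a0000009d188], [0x10afd800003f0c000008965c0000b71ac0001cde4000020bb2000005a6a40000684f4000086de00000570980000741300002d4a8c00016056c000151be000000b6580005aa7589], [0x5c5180000409a4000098ce800000d70800003a1180000529940000178200000336b80000f05480000586d00000578800001410c000004b0ec00001d36400010cf90000078edc00007d3280000155500002d10f40001a893c0000137300000318189], [0x3234800000c500000007a5000002b4f000001527800006622c00000d19c00003d2b800002818c0000278e80000460dc0000294c000000c98000001b320000033958000075a7c00001736800000c5e000002164c000051de40001208c00000581389], [0x1c648000002e4800000b7480000226dc0000008b800002c650000006e740000492b000002bfac000007e3800000521c00001eab800000189400001fb9800003d9a400000028800000267000005896400000bd740000147ec00000fadc00002ce14000025f1c00000d9340000f51d0000025f040000c28b09], [0x1a998000004fa0000001a58000024ce400001d790000008fd000001839000005a42000000d90c00001b394000004308000009a08000014250000017b40000006ffc000055b1400003d69c000014b5400001e21c00001491400002b90400004de4c00003c554000105ad49], [0x2eca8000027088000009a900000157c40000367300000111d400000dacc00005e01000000fc24000003854000019aa800000f79400000f7e800001815c00000d6800000026bc00004282c0000250340000238c000000d32c0000058c000000b44c00001389000002d6b400003f6449]],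 [], [[], [], [], [], [], [], [], [], [0x5816d00002bfd18000040ba40004c6a480004798f00002d21f00001cb350000fe5304000a2192c00041577800000cd1c9], [0x107da000001c66000000308c000033d1c00008665c0001ccf580001ffed0000026be000005536c0001ccad00000817a80000c8fbc000043ed800002e8080000c825400042eec09], [0x8cf880000466c8000057a3c000000d2400001ba540000926f80000611c0000018e78000032564000076c5c00008dd400000fc14800002135000004cdd00000134900000541e40000251880000151f800019809c0000a9c20000143a209], [0x5d29800000390800003a0840000098c80000455f4000052370000033e90000010c4c00004e84c000010d280000632a400005f8100000161480000156f8000020a0800001010000001e6480000561440000188bc000027c689], [0x2de10000009330000027088000001d34000012598000018a9800001dd50000057b600000397d4000000a0c00001022c00001233800000fc60000010c7400000e1c000001573c00001393000004eb0800000cf3800001ed4c000010a8000000b09c00000520000001879400002cabc00003b5749]], [], [[], [], [], [], [], [], [], [], [], [], [0x87b7180001346f00001adc9800032c0b40000d26ec0003b9b10000009d1c000f229440002929a40007ce9f09], [0x3d73f00001821e00001f1cfc0001606600000ca6600000b8d5c000bf79880001516e40003fcf709], [0xa139800002ca18000051ff0000076de000006aed40000549d800003abf0000003b2800007968800000b1840001419f8000053f1000001dde000000f154000185af8000070d7000004088400002f3b0000073a580000de9c00000307ec0001a33409]],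 [], [[], [], [], [], [], [], [], [], [], [], [], [], [0x8a0258000c150980003cfaec000063e24000102538000829568000046afc0064a67589]]], [[[0x246b20b0022b0f31801ae6d63c9, 0, 0, 0x705c900004e997788, 0x1262f80003212b108, 0x3584880000d1ab06, 0x50fe80000032c000000e254000005dac4, 0x582320000c6606c2, 0x78818000003d8c1, 0xe33700, 0xc0f600], [0x1e588a98000d0179800cca6e7c9, 0, 0, 0x1c5f98800208d4680032b8b080018e62a88, 0x25469800137add8000e3bcc88, 0x117556000004a11c6, 0x73f2980003e8c6c4, 0x83b900001cba4000005e2842, 0x13f3981, 0x1142180], [0x172efb7800683cc7c0072c0ff800cf21eb49, 0, 0, 0x5dcc948002b983d4004e3f0508, 0x557f9000005b1f40001471bc00003d04c0002d68408, 0x2da2700003c71d80002d50b80005b11300002ea0806, 0x6750a0000702588000b31fe84, 0xfbd18000057ee000017d36c0000214d02, 0x1239450000276bdc1], [0x1305ef40009a098e400f9d569800954e0e49, 0, 0, 0x3d68e40001a3326c002fc72a88, 0x422ce000038788c000c7223800042421c0006dd0588, 0x92ac00001f1db8000078ea000021bef00001224246, 0xf615000012557c00001ec144, 0x282ba000002ac8400000a1782],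 [0x62bc5880052502b8003166d5800134f2e80030cd7bc9, 0, 0, 0xf88bc800050d65400058327000094b41000187fd080009ce11c8], [0x939f160002fb0ca8003cb4dc400864b4609, 0, 0, 0x41f3300003c140b88], [0xb8c52700031bb32c0074508a09, 0, 0, 0x88e9f80000a66740001495488], [0x2f18428000713a80004ec2fe09], [0x4435308000c34c340001f4e749]], [], [[], [], [0x11f6bce000282f1dc002fb4258005a8a8440212236a49, 0, 0, 0x55f030000177364c001be7d880024547a48, 0x318a200000046080000b49b00001731ac0004e3af00000642ec8, 0x2fa3800002038000000258000003bde000005f7a800047cf580000333b400043e72800004c4f46, 0x296a8000013dac00000494400002235000007e5800000921f00000e18884, 0x495580000070180000250b400002069400004b3980000050ec2, 0x4fe5000006b41000002ac4c000089e040008ffd2800014171c1, 0x6fe8800000b71000036a8500, 0x79f98000016bc800001d8480015f33b00], [0x492ffd80051c9f0c0038df71c00069b33c000401720000d3b20800142423c006da30f49, 0x970f6c8002f994609, 0, 0x17742200013b9524001cb0bb0000a15268001b2bdc8000fc3f688, 0x44ff00000541e00000753ec00036b5b000018d1d8000237afc0006a3e30000302f188, 0x37ad80000048c800001afe0000235f50000085c000004658800001ee2346,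 0x1b5d0000000ff8000008d2000000cb1400006463000000bb104, 0x2f4900000053d0000004ef4000002ac400001f94c0000012a02, 0x311d00000039e8000002654000009afc1, 0x594900000075600000047b800002b2400], [0x12c6dc0000c5649400055eb94000f74d400002cea8c001804d54000a3f21c0000c53740015d16dc0004626e4000255f989, 0x145cc4000094a024001bae7009, 0x1bbc3e000038851800306b0e89, 0x2343b00000691b000011898c00000a9e80000fc2fc0001ebd8800010f2cc00011b128000600f840005f24fc0001e24dc8], [0x21f6248001632afc0002a8c8800027fc90001bc2450001dacc94001262dd89, 0x454710000638a480005fe2f4000535288000e2203c001a78db09, 0xb3aa880009044900013a99a89, 0x124698000037a2800000507c00007e4540003339d400005b4b4000154b0800077d87c000369b6c00041db3c8], [0x4cc500000067e680000655a0000010c8c0001de71000059c6c40001fcf000001358f800078d26000018af680009c21a0002605a4400091e0b89, 0x44dec800006ec5c0000f41309, 0x230978000028d8400006cd989, 0x10371800003874800005922c0000ce5280000618cc00003f150000071aa000005540800018943800003e944000069ce08], [0x41fa280000377a0000135d2800004f4b80002e88e8000572f2400005424c000ac75b000024ece8001225be09], [0x683530000417fc80002b46700000428f40002d2e5000009c8a00001c96fc0005fdb0800009f40c000072b909],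 [0xe489e00001f06f00001cdef400057e1b80010d91549], [0x2387ff80000443300007a37ac0004f7258008c3c3600231b571c00942a9609]], [], [[], [], [], [], [0x2850d00000b90a24003704a8800042bd50001136cb40028cc1d800837c328000fba33001290a2749, 0, 0, 0x4e0d880007047600004f616c0007654b000013e594000d11b38000529cec0004f50e88], [0x756828000021ee40001813500003890080017282840010050700000efbd00000d93980010ea0e40006f4ac00009ea86c9, 0xc914d0000159928000a867780026baf1c9, 0, 0x1665900000059d00000cc5ac0000a67e80000a69300000217940004fd9100002db3d80003511d88], [0x344d9000012262000005c8440000010240000996f00001e85400001a857000036d534000103c6c00031a8740001a3dac00061de7c0011ff5a800059478c9, 0x1549600000175e80000d0794000083ca8000002fdc9, 0x1d90380000c5364000100a5000002b9a49, 0x467100000081d0000020b0c00000e5180000098bc00008eb6800006a5580000482e800000bff800002a2e000000ede800003fca400001f2f000002a36400001a56800000985c8], [0x22dbb800001c01c00010ad7c0001551e000009005800003eb5c0000d758000000b75c00015d3b8000116a18000035a140000137f00007bdb4c9], [0x132450000069d9800005be840000315a400001529000009b8b80000136cc0000b27b400012773000005d740000021d500000da0a800006ea6000000e4340000f871c000068e4c0000370800000007289],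 [0x10b3b00000081fc0000aafbc00009f478000083934000035c8c0000657b800011e11c0000eed2800004b264000157f000000c04b00000e74f400025936c00022334c9], [0x13c5900000061c80000432080000995bc000034728000254af00000394cc000014e5c0000ffa380000d322800001eb380001e5c1800002fab40000575b000009bbc00002c954400078ee7c0002caa489], [0x1e56a800003ceec000031210000044b04000063ad80004690b8000029b3400011b86800019f4e00001b5708000534b3c00004518800092bbf89], [0x44e3780000403140001d6b8c0000f6fb80003e77b400010be48000165938000060bd80001ccac4000019b3c0006c7bc09]], [], [[], [], [], [], [], [], [0x1895ca0000551b38001635290000a3c4680001c9ae80070b1fdc000c17e709, 0, 0, 0x15d18000004fcb40000bfd98000076f8800009a5200000645e4000003db000006ec500000232ac8], [0x29cc8000011e3600000b87f400006cf380000fbabc00017eca000007cb080002aeda40001abf3400013f9980000590fc0003303409], [0xddf9000000e2080000c20980000199940000222440000b1c280000ac5e80000c68e0000056d9800007b0300000f094400003c5dc00004b5380000984e4000013480000000fb00000e7e4c0000e9bcc00007b92c0000272c89], [0x551c0000013218000061f5c00007cc840000a60d000001e86c000026b5c00000bf1c0000070f000005493c00007f618000018eb0000046114000011ed8000076a9c000017eb40000987cc000002c780000624f49],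 [0x44288000026dbc00000216c00003087800004bec40000787100000238fc00007e60800001322800002094000002d7e400005901800000d63000007400000000abf400002399400002d6380000299bc00006cdfc00003107c0000391580000188840002edb9c000160db000013da489], [0xb69880000022d4000029204000018ecc000094d080000139d000005a2e000003324800005347c00004f8100000456f40000042b000003eb50000016eb400004edb800008702c0001a74c49], [0xbba60000019738000038e240000838a800000da0000000507c000046980000014ad800000949c00001b6ac0000ecf9800001dbec0000e64d4000013788000074d3c00000b020000068380000005df40000117e400003566c00004f36c9]], [], [[], [], [], [], [], [], [], [], [0x2148000000919ec000046f2800004e35c0004c14b80001b8fd00000123180003b29500000d708800023fa480001bbe90000b929d40007023b40001e28d800005edc89], [0x25e9c000012df980000792700000024dc0000020c00000eeb400000b8c98000015ea40000066240002343380000c07849], [0xba738000055d2c00002021c0000020c8000043e280000a191000005da2000004a96c000086e3400006aec8000020d48000006ff400003cf3800005458800005c69c00001ecb40000042d8000111f5000034d39c00011be289], [0x357800000239e400003588800000755000003331c00007237000002faec00000f7d80000647b000002e61c000004c1c00005a03000004d3840000341b40000592b40000406d8000004250000025fc400001013800014ea540000460bc00011209c9], [0x44050000000e2800002ac1400006b8a000000529c00005113000001434000000f474000012534000049dc80000029640000051f400001e44400001ca9400001c5e800002c88000004452400002cc08000003db800001358c000012a2400000077000003c2ac00002449c9]],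 [], [[], [], [], [], [], [], [], [], [], [], [0x22e840000035ca00000e2c300001df89c000025744000590f780000c5a880001d0e4000007448c0000ea3b400020fa90000046a200008eedac0005e6aa4000556dbc9], [0x10e39800008605400004210000003a8800001108dc00023e6800001681a000011b45c00015340000006a5a00000067cc0003d79d000009e5ac0004cafa09], [0xe9b3800002a38400000766400000c7f800002b0a00000057fc000013bf80000e85680000014d0000053e000000363480000e76e80000571fc0000084a000000404000006a190000014f60000037d4c00005c59c9]], [], [[], [], [], [], [], [], [], [], [], [], [], [], [0x44374800007b9b000006f948000192b5400049e4480000f6bc00001260ac00008b2200001888a8000268b300000391f400061dd989]]], [[[0x46cd4308035ca43149, 0, 0, 0x21c17c988, 0x3d4c3988, 0x1aa40b86, 0x1f41b984, 0x8ccad482, 0x4ecc2581], [0x74a1ea1000e4b9eec9, 0, 0, 0x21d843708, 0x3dafe708, 0x50c50b86, 0x4808ab84, 0x89ab6402], [0x588920a801d1301f49, 0, 0, 0x11ea85188, 0x40e72008, 0x5b2b6586, 0xc6471504], [0x74474348003bf36749, 0, 0, 0x2731b1308, 0xb0512688, 0xf087e606], [0x72071438006f31edc9, 0, 0, 0x342cd2c08],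 [0x8b23ae389, 0, 0, 0x2ea258888], [0x841fb3409]], [], [[], [], [0x28a72c2801168317c0199178e49, 0, 0, 0x11240068001d725c08, 0x1cec4d00006214d88, 0x1313f500002d52d06, 0x16dc6100015eef584, 0x1ad34402, 0x2916f701], [0x193828b0005c2ac880066a56949, 0x15e043a89, 0, 0x70f3ac0006d339108, 0xef66d8000727b288, 0x64bd40000ad3bb00002d2e8c6, 0x9dccc84, 0x1909db82], [0x93de2c0009483c7c009a713700095fb6749, 0xbc5aeb89, 0x83037409, 0x1bdb4a00009448a40002a2b440007554008], [0xd634ab8004ebdbc4009abcd809, 0x66a14d89, 0x2f9dd509, 0x170ae000006f0b840009a3a7c0006943a48], [0x781a258006db030800a67c7fc004db35c09, 0x1f3bf089, 0x1803f289, 0x1d1cb808], [0x9d57e80000c47eec9], [0x140fc7d89]], [], [[], [], [], [], [0xff71148004d1a0e4008fa29249, 0, 0, 0x19a86f80006cbec0000be5a60001097bcc00051ece88], [0x19d24080005720bc003557e300010e77640013c856c001686cbc0009bdca40016be50c9, 0x2ba1cc0000e9ce049, 0, 0xad7cc8000358c10000433d500003a1328000582a788], [0xc9a7d8000015ab0000155c18000e76364000024c240006eeb4800112a84400031a21c000ddd6bc9,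 0xa8eee800034c1709, 0x5f6ff80000a00489, 0x6d2df0000073508000383220000100cf08], [0x1718098000026508000a8a9d0000fa8d949], [0x16cf4c000097dbcc00106392c00072322c0003b5fb00000abc689], [0x23fbb20000246e54001326a7c00120aa489], [0x4b9b6f80005fba200033b9e0c008a969189]], [], [[], [], [], [], [], [], [0x2a6031800069bf00001b519fc000b297c00010efcfc0011677309, 0, 0, 0x95a6f000001303c8], [0x8d3c800000ec328000189b0c000bddae400027c3c800073fa64000827c409], [0x4d8bf8000032fa800004142400006e074000015c2c00001db8c00000b9a800029549c0001dddb4000139260000022a5400005acd400003838c9], [0x4d92100000361e80000111d8000501b740001627f40002adad800016bbac000647bd400022e9709], [0x93a15000056fe840000665b8000036c88000067790000290af00005ed3040003deb1400000bb1c9], [0xff57180000cb83000023784c00006fb2c00075bec89], [0x2018df80001de8a40000503cc00006a1100007e3fc89]], [], [[], [], [], [], [], [], [], [], [0x196783000023bcdc0000a857c0001925b40000249c89], [0x9c98e00002d991000059fb640000ca9400007f3c500006185649], [0x331568000024884000015fd400001f148000077ccc0002fd42c0000fad2000002773400002ba5c00008276c00012f87c0002c2f40000396e2800008aa289], [0x2f43a8000013b3800002152c0000418d4000024f2000020ceb400002365c000016ccc000074d140000c337400005a9449],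 [0x397d8000000aba400002b33c00000b72800004f2a80003cae0c000054ea4000004a4000003cbb800002527c0001a93b8000262a0c000026c0800000bb8c0000438c49]], [], [[], [], [], [], [], [], [], [], [], [], [0x17c08b80001e7c28000118f1c00000036c000264904000ed75e80008ab45400083a0a49], [0x9f5ad0000503c5c000080d0800017aa000000f1d8400005ba109], [0x53c8f000004872000000b90000004d5c400002695800024a0b40001ca3e000002bec400000ab8400003e2049]], [], [[], [], [], [], [], [], [], [], [], [], [], [], [0x20351d80000f54e800005cb0000079ba609]]]]

@[irreducible] def dataD : List (List (List ℕ)) :=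
  [[[0x2c5ecc13]], [], [[], [], [], [], [], [], [], [], [0xdb27001399c06dee801ff2400241801548c0306d53, 0x2283d00c14a006399812d8280468580cb2e90, 0x1b729001c3880288280eb0b80c2c7013e798e, 0x1c51900c8f200f3060d, 0x305c00058d210, 0x314c803033780e9eac0007b81194c0d, 0x178b00085dc80d7e780b4b7812dca8c, 0x4b2ba0a, 0x49cfe8045804e, 0x3fb238c, 0x1ee1180035040038180017dc0036e0a, 0x3d053000306c0007088]], [[], [], [], [], [], [], [], [0x565a0019f9c00cab0007ee000770c01f6b8005d7001ff78004764000ccc00dfe4033a5d3, 0x72e50066e40024c04009ccc05e36001748803b390099f080a90e8037cb00620d800b63c0204390, 0x39a68002178001bc000f56401945002b1d401ed08002c88009d24006f3400279808702007d348096ad8048ed0019e8009666805de90079438e, 0x166e0004abc006558006b1800994800ce30007ab0013f08007a0801b61006bb9003ca0006afd00605a0071fb8d, 0xd8f3804e478048e280212d8009bd001961c01b94802d7c0018f7c110830016ed90, 0x83b1803952404491004569006211c044360030458013df80f6e700dc2d82362e00da09c032fc80e8458d, 0xb638002ffc003cc00013300023d8005230001b480055c8003e08004710015f20018728025d5800fc600bc79008de2004e1900819380568d0093640c,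 0xf72800201000cef8012090004fa8005b98005f98009e88004980006a58008da8018ff00633b0041ca8016e5001ccd8108f00a, 0x7f01802e57402f1c80283b4065340011a9007b71002a3c403469801dd0c00db0000c49c0827b0008410180ab003313ce, 0xc5e000ae80007b80006740008d4801009c0047780057e80060300066e00054b000a43007913003084801030800eb50049cb80340e001ae2005ad88185900c, 0xc3380003a80005e80004d00005d0000b38000ce40010f40004800000c00001d00002b400017800003c0000cc000110000184a, 0x195d00006840001ac0001f8000cbc0015c400031c00051c0003c400041c0004840002e00000780001f08, 0x167200000b0011110002570004c0c00569800515000adf000c0f8020c20082b1801d230029e1801c80802fe58035138052ce809f3c0d, 0x217c80005bc006fa800864000dec0000e18005ff00061c8005a1000884000c10808c7b8039c48050c18040e5805ace005a330077078a, 0x22bf00001d800181400113c00061800398c0009280005080008d40010300008540000c00001000000880000c08, 0x205f00002f8000a44001a740005e00001380005a800036c00041c0011300000400000747], [], [0x12883801dfac052158024c6403a2953, 0x1e96b80e152007bf700777200ccd980478c81409f90, 0x2bdd7010ba581bce88e, 0x306960d, 0x1af0b008875800fdd8047bc0059c1809111806887c1d5000087ae90, 0x4b80a810f05c062498190fc0d,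 0x1dae000927d80f5ec8c, 0x40b8181ef3d0a, 0x2d67c800a5642b57380282b8e, 0x1b581804a3e0025cc808beb8233790c, 0x222180002f6c0025e8a, 0x58e7508, 0x30c0c016e7a8d, 0x4619a00d7170120198a, 0x58c9488, 0x7456787]], [[], [], [], [], [], [], [0x15a800164400375c0014c800268c005a5c00353c00335000469c00554800319000601400797400d994039b60006aac0043ac00100c0103f400c4f000ed9400a3b8009f1400d86c0005bc04a2ed3, 0x27978006024010a3000f5a001f4f0003c14004b9003c13404aa0006be6801b5bc01adcc091ad001c75801ac180705e0072a580003300234f001150400edbd0, 0x806380129b400e32800f12804da780b57200773b00677e80155c8079a1000b2b0048c78e, 0x9cb80062640050b8021ac8000898000db4002c9c0083b00070c800c4e402d1980423a801ebd804e3600867e8064bc8077990d, 0x11a6800548400aed0000b240107f00011c400e54c0214780360840130cc032a200541b801124408197007d590031ae801cfb802bfe000f4c4011bb800f41000ddf408b70002b6c10, 0x1355000f69400a59400c3e80035d000d318010b9800056c0023b00093ec0611a000c51c005d9803ec900490e002ba88013b3002b7ec18d488087268120e900418740193a0094788d, 0x73600013a00010dc0061c0002c680010780074f0000d400055d000430800558801782001abb0021df000d7000c97580910c004f038083128055a60092110c,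 0x98600019a0000260001918001ad801c0c8003dd8004f48008f58010278004cf00074a000a3d802236808f2e005dca8020c8002964817a2f0a, 0x210280030500006300021f400040c02226001a5b003c6b80318180245fc0042c80415d8014b14076b500238d40017c00177c401df4c02179c05b4d804ef4011346004f374e, 0x10cf000617000570000907800ec34003d18005070006618005db80055b800b1380790e003054001058800f1b0049a980340e001ad9005b9701845e0c, 0x74a00015ec0017200007580000440008d00004f00002880002380006d0000bf80001600003200001f00001280000740001440000280001140000080000d4a, 0xb7d800628c000b04002aa8002b3c0000b00001d40001c000102c0005e80001ac00008c0006cc0000840001400001240001800001f48, 0x8c880052300005f0002ea8001c700029080144d800053800370c006960005ab80090f800c6500210a807c5e801caa8028c6001c05002f2a8032e4004ff30098350d, 0x1e2800016c8006d00003df800a84001c6a80063c800984800eda800ce8800fab8016a8811ae900744f00a2d080828e80b68000b5e280f0ed0a, 0xf3f0000ad800061000088400173c0000d00004980012640007100002240002a400021400014c0000700000ac0000500000008, 0xdaf0000084001a08001f900001cc00032c0014a4000fb40000d40001040002440000bc0001a80000580000c87], [], [0x40438015194030ab00085d400849001fa2800120002411801f7f003242000bdc0024c9001d20c0332553, 0xb2c8804c14400ed600126f002df9004def0090b98052b8002d5c006441801d09808b9090,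 0xeb258027eb80a0cc805b6c80174800bbc200b13c00d8b68e, 0x5ff9804314804bfb808b910069518086598d, 0x647a001518803e534016958053518032a5004f1900655e8030bd00182500260c001701402ffe00308580306640967100565f10, 0x2f900000d7800f32800442003fef40423580030440019c00e2fb005229404a2d004a20001b0a4063d60050bb81e4a180347dc050ef80fa6e8d, 0x1aff80066c8001a80019d3800901800b14000533800ce00073940035e000618c80af1e006ea880b76900971c81015e0c, 0x357180066280013d00021c0003830043c88092298063918022e4002c010190738a, 0xd55a002996800fae801ea4003398802ac6003e72801742809d01801aa78168ef0022138e, 0x8e690032d8000d870009da004ffd80360f801899803d6d019d750c, 0x264b0001eb40013480000bc0001680002940002dc0001f00003cc000200a, 0x4b3a00000cc0001380000180003140002c08, 0x26e0801240800010400d61800d8e00042e806e4a8052e80035ea804d5d805532008f0c0068d100a4d90106c90d, 0x36f4000748800a3d80090581620c808e2a00c6cf80a05b80e02180dd548125608a, 0x4ac4800062c00037c0001a40000d80001308, 0x4cba80001100000687], [], [0xbe60000ae18037a900197c005c098036b4008cf0001601802dead3, 0x29a4681107601fcab90, 0x49af10e, 0, 0x1fd3580667b00dbf700132b41657501217c10,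 0x286d480d2ef80230740075f813e2b02a25c80027140cb6b026cb90d, 0x2c6b20c, 0, 0x2306280819900e27880736d011f3a00162a81b09780d70e0e, 0x1853300068fc02a3c0052d900460400324d81185f81fcaf8c, 0x2ab150a, 0, 0x19e000095ad007aaa00c758808cf880d753014a9b0d, 0x33bdc0093f280cd3900d21b8116570a, 0x54cc60000f30000c248]], [[], [], [], [], [], [0x4e88003d5c0024d4001bdc00149800486c0023e0008c64004754006f9401d6ac01fb000013240083f4001eb40130040029e001a274001d4c00b0e401032400cf9007a3153, 0x334b0000a2002211c01ff28005b48039e140382e805a9d00142bc017aa40f433000f774034af8060c2807ea3800382800216003931c0141f50, 0x926e000ba6c01c9600250280e37800aeff8058c3001800c046fb8023f1c0587d4e, 0x28c18012378009ac8009778007f58018270018d2001458007d1f0055db008f008082fd8093d80d, 0x19788009b3c017338002e4400e7d40032ec02138c00bd600307900432a00142d4055c200f79d001431000824801d2a800bca800da780160800092dc03e58802ae410, 0x2f9b2000ada80d8d400b6a84027f800648c0d, 0x22a88002ab4000454003d500064d8008fb00007880000901331d80b09e0056bf808ffb804d4080831e0c, 0x303a80026a80061f0005c3800b7480085d801289804c938031ba80112c00160780c9d68a,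 0x13897001529c0330f004c77c05a2bc03f7a402a650057cb8100d8808eea4e, 0x25b780074a8006ea800d39800581804c14003bb7802a1400288180378480312b80305f80326d812cfa0145d58c, 0x1a3980038d4000b8800062000081400084000012000031400009400009800022000047400009c0002e8a, 0x2e4100048bc0005d40007400004780000e40004c00003c80000ac0002b00010e40001c00001dc8, 0xf172801f0c002cea800ba30013868036628055fc80c3120d, 0x310d0015bc8000758007b5000bc7000e7f8051ce8023c80033280027178036c30037cf804ac18a, 0x2e8080025300004100007380006640000140004040000540001480002a80001c80003e48, 0x2dd38000d300005640004440011340002e00006040001f800066c0001500000747], [], [0x1ff7000e20c00a088009400006c4c01e38000c9b000e13400b11000a42c0070e0003bdc011bb8005b3400171000d7bc03c44d3, 0x38c48022de8020f4801a31802bd1c0027b408e130009b08006a1c061b20048c0804468805c06004feb000845001ffb800b7d802fc590, 0x4978002c34400aef80111680317e80186c0017e2807e0300471e808d93804de0800740406cab80484b8058528e, 0x428d80099d800d2e0087378041d6006b8a006aaf0078258d, 0x45058002a08004bc80212b0006e14016f7804d3580883380151b00741900829e0029a5002afa80157e00017e4025e7803e618008ca402395806d4810, 0x53dd00010d800bff802e14c051418002dc80016ec09baa006f7b0042b780323c80498e414633806f78812feb803dc0803dd700e4048d,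 0x275d800ac1000eda8017f0003eb2801c9580d09a00b54f00658680a8308076d680c9b18c, 0x4457800d5a800cfd00089d80421d802ace000e278011be80a7ee0a, 0x3bc60001214025bc00063b802d0d401bda804ed3802db3406ae8006213009ac900264580202f800803c01440400d428057110011d600c764002e39ce, 0x2a1d0006e7000696802fbd00580a0029db801d500025cb003977802f6c00279f00ca62014e828c, 0x279200006cc0004380003240004ec00007400017c000114a, 0x46f500005c400103c0000080000380000fc0002340001bc8, 0x3c9d800f00803d2500a300002dcb00429f0036070059a40055c180864e00f67c0d, 0x4320800968800c7f80a54b8044d5005f48804c59006a7c806a75808c958a, 0x462f000075800007400076c00011c0000b40001cc8, 0x405600005880002700003280001400001f07], [], [0x328b8016a68002f8001b44003354800f04c0238e001bc2000367002437001c590025fe804372000da2402bfe53, 0x28cf801cc18011e0400223c009af0000a9004545400d90c04e570029e60048450011b800255d80432e00104a00172c00371a804696807a7901002810, 0x7653001f0f001a92c02df8403ab6000a490031454048ca80318a006f4200888080a60581194c8e, 0x36230006e3800ef8000d1b403518805f99003781806c420056638072e78d, 0x6fa0801185c02c45c04f3400637f0045320051be00159f0000a0c019254001148031768050a40013e740887c00873f90,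 0x286900029c4005460015488003ba0015ba004392804bdbc06dfc80710000491a404636005c1480801380579d00b79881af890063ac007e4f8124f38d, 0x1f098000c100104380080d000b4f0002054005b9007e47003c07804cef00b10a80724100bd44009f15010f310c, 0x43410004e2000b11800bd8801ac280a65b80690a0024b5002e6901a82a8a, 0x4d95800a314024bd403f360075ae802035003b4d80020b4048a1803af1004743804b4f00555b007ae180aa6a006e1d00baef0041058e, 0x160980028c0007880006e20006f8800792000572803dc10042598025b50020be802c42803000802ba780295d00ee3c0127560c, 0x17cc00008500004780008d0000690000bf4000efc0005180000500001880004fc00021c00013c0000bc000024a, 0x40490009c74000fb40022c4000cd00000a400032c0006280001340002208, 0x15870004f18008638008ed8001270001000006d38005f6000974800939004cc980715c002c3c003f10803c4300653b80541080838680df7d0d, 0x218f000763800c26800ccc8006ee800b4780067b800890800b2a8010668096ef003ed08057f480462e0061d10061f08081d18a, 0x2e5d80004dc0001380012a00019040010800001cc0023d400029c0001780002100001ac0002988, 0x3c2b8000bc80007980006280006440019a80001580000947], [], [0x1dff980aa41002ae353, 0x53b4290, 0, 0, 0x23ebd8168a800689d409b0c81712a10, 0x73ac80d, 0, 0, 0x276b400e80300e48f00ad1401556180c4cb0e,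 0x28e7c0018a181634b8238520c, 0, 0, 0x26f6480ace8810a8d0186e78d, 0x508d00a]], [[], [], [], [], [0x8660000560004c9400694400c0b4009ecc0082d000cfd400e73400799400874c003d2c0066ac007ed400373c014a0400b524009c140106b400eec008bad53, 0x12ae5801019c00f67404db1806d82000a43800cfd801024401e4d50, 0x1385480648b806b368029440028f10042fac068f3ce, 0x24b58000638000998001ec0001430007f3000b23c034a6803601001d1f004e0f807e8f00635b806f830d, 0x11cec800ab9400ea4400fa00014a20009c38011a780090d80072f00125190, 0x90ae80095a401394407f5a0007404009d2c0593042875480633e4061ff404e72c0376d8077dd8d, 0x2efa002aae803086c01b35412640006bfc802c0b80490b001185001ddb8c, 0xc510003b28003650009018017e180053100068d000896000df50005b280080a800aae00205980812a805586001dba8025930158cf0a, 0x6a44003f9480201480219340291d0018d28030520076130039e9c0408340480d405f33c01864c01589409309807776009ea74e, 0x5030000840004c780016a80056c00020080031f8003ff80037580049200058a00058200067c00056f80411a003687002089001ffe002c9300280900263b0027b200ead500fcdd0c, 0x4078000f00000c70001570000db8000ca00006800005480002800002280007b80003ac0004180002f00002d800015800000c00000c00002c00002400008c00007ca, 0x76f0000b3c0006bc000d2800043c0003f40003140002cc0003d00005700004b80000940000a400021800010c0000b00000800000380000308,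 0x1c5a80030d4004cd400b55800834000e1d80117d0010a940ba088011f200199200053f4008d6c01a3f0029578073d60d, 0xb35800263000498000e460006b500049200096e80092e8018cc800415800646800dc3000af4800d1c00131200f9c9006667808f6e80733f80a124009ff380d3e28a, 0xa7a800114c0002cc001eb40007e400086c00109800138800034400036c00073000012400010400011400021400027c0000480000500001100001408, 0xd3e0001854001c8c00334c003a140000640000640007c800093800098c00043c0004540000fc0011e40000580000687], [], [0x12d28001d640052400035400004e0007b80006c700023b00030d800aa1c00206c004b5c006964002fec001a4c0054bc008e9c00db6405f94d3, 0x5f37801db6401801406f618049a68014e240864c0042ab003fc8805964007dff000f6e801389000714800d4b10, 0x414500018e8001c78003264008374000d280003e400039c02f8c001a5000bee5806eab0076020042b080422b00193180277a0e, 0x417c000b5a00232c8024fc80609500542180886700787f80873c8d, 0x8249806fa10029e500302780bcff0019908022e88013920019d8001d76003544800628c004e340569a90, 0x61b1000867400e0e001c1c80073a804e8d80635f001a7e0024a28004bcc1fb78800a0d0079c780617c0055d880b9a58d, 0x408e80188a8008fa8111a880b098805b970097e4805c51809d558c, 0x53f9800fad0059360038ee0013840018ac00e5430a, 0x468e000b1780301d80113500128b8015f800318b001dea00292c00649a80017280019d000e2fc012be40291e00244c8093ca807812803edf4e,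 0x3027004b6f003f2e80244a8023af803294002d6e002a9a802c3c8105f1811a0e8c, 0x30a800002280001900008bc0007540000b0000098a, 0x5710800059c0004240001540001248, 0x420800311c009b0400276d80382e002ad600482800481780718e80d4d28d, 0x56fc80ab9500484780653c805010006ff20070620094df8a, 0x56c5000004400004c0001240001548, 0x4b9d00003e80002200002807], [], [0x24a00006e400027400013400606c0035b00033c00013a400a9a8004f1001ae6801124800a698000e9401962800f43c00d10000abc800669c012e0800a5c800b550013138015144026b053, 0x1a010000e7000044000123001e16800ae3001b290025d4800c5e800ab94008aa404d28003305002e04803fe88044de0041e3801b780026b7801907801fae804a0a808b0210, 0x1238800955800257000cda000190c005a90005d9000be58018c28000d6001c28c01a024041ed00247c00118a8050c88056248066930065c5008eb380df9c0e, 0x8bd00026600027d80035980042b8012058000680000a00004c28003208006a8800024c0292c802aa58039f00048e10076288062b8806ecb8d, 0xb2cd0035d7803de380533a800781000a3f0005088006a58016b480290e0030c18026b180956810, 0x1d4300014ac0020d40002940039ec003e4c00186802086002a27800fdb409f3a002951001c85803edd8056a98065eb009589008e3480db9900afca00a188015d520d, 0xf980004260001ec00082880017380088e80075c0009c700089b8012490055910026b8809d9b80b03e80683d00acde8082e500df130c,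 0x10168004a900136380039f80049200068b800a400003ab000547000785001845005ee1803ecc0015ee801bb780fd498a, 0xa8a8005c2000157800eaa8000bac000e0c001c98009ae402a034008cf8001e0800cbe403cec8024c90016d38037c70033188038eb002a0f00379280503b8046d480c3ac009ef980236d8e, 0x7010002b100023900044f80041680033a80042d0003d70002800003080004c88005a1800506803f090034cc001e50801dce802a018025bb00239d0024fa80dacd00eb9a0c, 0x8000000eb8000d900001d80001800002b80002600003f0000dbc0002500002700002600000e00000ac00008400008c00007c0000ec0000d4a, 0xe7a000164c0014c40000f80000e00007d40003780002e80000f40000e40004440000bc0000ec0000ac0000000000008, 0x8408002c70004d80001fd80028700023d00044c00122a80012d4001da400692000583800957800c27002d6a0076f90020a8002e878024e0003e1d803b84805dc080aa148d, 0xd5e800a118003d70002e58005760005a9800d7c0002f20004870007ed0006df800833800c10009456003cdb80553c80446a005fa8805f07007de20a, 0xe3380015440015840016ec0005d40006e40001a00001b80003f800032c0000340000640005b40001e00000080000080000cc0000ec8, 0xee8000089c0009c400017400017c0005880006880003680000080000100000380006600000500000607], [], [0x85f4000a3d4034d380377a000418802e298019568064f300a9eb8032bb80459fd3, 0xce7d0003b8c0366a00340f802360c031dd4074ee80940400f64201ce5690,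 0x3a46800256c00b84800b80800c7b8019f00000e78010c8c00f80c08e34804eb28075c2407c948084d8009b93809a5b01206081c3e00e, 0, 0x2d58801a21401b24c00ce000086180187d800773005a52c068d7801b75001f8f005506800df5c0130fc001aa8002338013e08023f08046fa00385400829a90, 0xd89b000f1f80142fc04503005f118063518062d94082a800c6bb809f1680b4088185550d, 0x956b8043b10031ba00b2dc0075ef00c39400a9a601211f0c, 0, 0x22738000ea00011a0001ce00056bc059b3c00d2ac002a3c01390005b088036f6800aae801a1a80661e8071c20068cd808a7a009b9580895a00f85d80c9c900810b0e, 0x129e8002a40003a500048600034c0003fe80051d8006058004ff0044520039390021420020b3802ddc80293100271500289480f0500102c38c, 0x23e08000b2400036400034c00047000024c0001ac0000bc00009c0000f40000d4a, 0, 0x852000072a8032450047a0805de7009e2d0064ed809efb00e5a90d, 0x30a10005e8000914000c34800bde000e1c80151080eeb38062800089f6006e6c809a660099d480cbc78a, 0x3b9000001d80006940006740003000005740001500001800000d00000f08], [], [0x591ef822acc93, 0, 0, 0, 0x9973890, 0, 0, 0, 0x717510e, 0, 0, 0, 0x82c458d]], [[], [], [], [], [], [0x63a80024d4001c940014a00004240063e4006d1800c5cc013e4c0081080249f400132400304c0101d400364c00c9f400f96401514c008f0401174400cf9007a3153,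 0x455c000155c005b4802ac48044644010eb805b468017aa40f4330033f38011c74057900085298001378003e5800f37803ab050, 0x92e4802e8a80049100e378004d5b80b4548046ca80188f40411e4045df4e, 0x2ca4000c8780051f0007f580161500120a801a4b007d8e005941808ce80083d080931c0d, 0x19448003364009b3c003c5401713001468400ab2001acec00ea3c0307900432a0057b980081dc0f79d0001ab0015b5000371801f45800b67001746803aa1801719402ae410, 0x11f9280004f8000ce800bdd42c1018014a88082c340fb8d8032b8805f930d, 0x1356e00b0610056db008feb804cc80083650c, 0x2ef4800b0480065b00080d0009cb8008a98008d68011a2004c4a00325e80118d0015dc00c9aa8a, 0xdb2600dee7803509800f8cc04202c06215c0223200443ec10d61802158008eea4e, 0x266a000bef0008f680058180482300406c8029358029640036d38031f080309280323c812eb88144368c, 0x1a768000018000688000dd80001600008380003140000680000bc0004040002d80002c8000104a, 0x2e7a80000000005880006780004b00000ec0007040000ac000f5c00078800018c0002008, 0x2d440003ed800c44000b4f80004380ec8c001faf002c78000b920013910036ac8055cd00c3120d, 0x35a68001ed800ab8800995800eba0051b10024c40032740027308036b100389a004a288a, 0x2e8f80004100006fc00004400068c0004180000540002780001980004240001288,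 0x2dd5800035400060c0004400005f40002d00002000011e40000ac0001387], [], [0x23218005070004af0011c9801bba400c9b0004bec006ed400a6380113dc00cf3800cad4003fe000451400d7bc03c44d3, 0x4a53801a31800ba1c02a5240408c007ef00006a1c061b200478e0045a8802d08007142001d33000f7300213b00243110, 0x48e380026e402711801ac1c00e38c01c45802f67007775002eafc0471e8044a3009247006c9c00081b4031a80066c50e, 0x979680428c806b19806b180077c78d, 0x4512800e1bc023860004c2000e9f004d3580883380700f8024f780829e001c678034ac8007434014488020b10041438020a88010a4c06d4810, 0x5807000e228026720003cf8005680002ca40af1f001426801ad6804eda007565815cb2001e86c07ec8811b078085ad80c2cc8d, 0x290c000f818018de803ebe801b8100d01500b5d280655e00a84900761b80ca1f0c, 0x4634800dbe800a4300411d8028e7000dce80119e00a8720a, 0x3ac1000afe00012140118e8008e2001236c00e4c4061c4804953005a3a40269480b322001be2802982801150400d36c0580a00025c80c6d180175ec02e39ce, 0x2aad000696805f0c801f8e001e0380295b803d2e001f6e0025cf8030e1013ea700e2880c, 0x278d80013440006cc0001ac0004f800014c0004c400014c000154a, 0x46f700006700000080000e40000780002140001e48, 0x36c580172e000dc2003d1d80a38a002f150041b70034d4005a5a80550d8086c000f67c0d,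 0x441e000cd100a5220043c480600b004c18806aaa806a08808ce78a, 0x46210000100002cc800007400002c0007840001ac0000f48, 0x405600002780000e40001b80001887], [], [0xea60000a24003ef0005ec0002dac025078017ab801627802187403354800b2fc01c52002416000683402b5c800f5480290f80419f800da2402bfe53, 0x1a47001c38000d5e8014d2800278801a6a000a5d4000a9001bd0c040dfc0453a8037ae0048450011b80044c400225c00107d8017078037ea8045f200903a80f49110, 0x5835004e1b0020eec02feec016d84027e5802c48803145402cc5004bd180895f806e2e00b934010d0f0e, 0x31b000157e4006e38011e90034b5800a7ac05fa10047d48062308068378063048d, 0x5eb9800e314034a0801cb3002c45c04f340036c3806c1d0051be00071fc0146c0007db0017e9402a038054c2808065803261c0873f90, 0x246e00117c80036d0015118006f10003de002719003345004b47406dad80756c0062f500420d805fb78088ac80361280b1d100bfb8818f40008d65011df98d, 0x199800031a80113500017100104a0008ca000ad00001e8c005e1807e49003bc7004cd400b12880721100bd61009f26810f270c, 0xb6358069450024bf802e6d01a81a8a, 0x9f1d80437a8000e280346080325c004084004243003db1005fa980b8560064cd80cd850045810041058e, 0x15418002a30005c68005548008b380065800081a800572804c270031288021608025268034760026df0027b1002d2e0114f08103640c,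 0x174e8004cec0005900007a00004a4000710000de00004a0000f240000500004440002f80001940001dc00003c0000bca, 0x410680022f4000fa4000c0c0000a40004f80004dc0001e800018c8, 0x17a08008ed80006a80017800061d0005598009a300090e804cc880716e002c44803f0a803c0480656080534200840980df7d0d, 0x2472800ccc800781000ae88006d38009a7800a510010740096e8003eca8057f88045e30062068062038081c30a, 0x2dbe80079080001780004cc0012a00011bc00006c000f5000286c00029c0001e00001b80002d00001448, 0x3b52800a0f8000ec80006080007b80006440018100000c40001387], [], [0x1a58680e58c80aa41002ae353, 0x4576082eb4d10, 0, 0, 0x2a687007f3c808918c1712a10, 0x5822284aeb68d, 0, 0, 0x25efd80ab5100ff9080c9e181719680638280c4cb0e, 0x28ef2821c89018c4a0c, 0, 0, 0x22348812a7f00a7a6810de38186e78d, 0x4d77d0161228a]], [[], [], [], [], [], [], [0x3f78001194002818005a5c0018f40032180085b0006e80008b5001a83c00005400e230032ca4006aac00700000e2b400046800d954000a9001205c00720400f3340005bc04a2ed3, 0x10fb0000e2c004fe801960c019688018718010b5c004304018bf8004b9003c56804a69c01113806dff001adcc091ad001bfd001b40004717008fee80224e00085e0002abc016a850, 0x9d5000200800e870003b880033e0002aa00049e800505800003000270c07ed7400cad0013ac4049cd001c78c0b572005fa2807d9f8079cb001467803d4e0028c88e,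 0x9ca00005e0006408004eb4021ac8001004000240006728005d340070c800af3c0413a802ef0801ea3005515808241806b3b8071cf8d, 0x1155000356000a2c00069dc000b24001bcc01071002ca44003a2002a54c01c3c0032a200541b8082b70000f4807d59000ca300381d001aa640263300037e8017208084a4802d2e402b6c10, 0x18b9000a59400244c00c7e800c154004c0400d64000081004bbc800e3500090a40041a0057d800528200051c802fb500819f818f950006bd0000b1c1283f8060c88073618d, 0x6298003be8000b4c0017480061c00045a0000ac80065380007f8005a30003fc000577801773001aa58021de000d5780c975009116804f0c00830d8055bc8092038c, 0x1dc10003f08004e500092200112c80050c000753000a6d00228b808ef2005dbb0020bd80296a017a330a, 0xe96001d9d400305000228400002c00040c02f46c0250d0046c1801926000639403bca001abf4061fa00462480054c00232fc01673c01ebd405672802c89c11d9b8014ea804f374e, 0xb8e0001208005b9c0007e4001a90000124015dd0004360004b40004bf80073e80055b80791e800a54c0112880300c004adb0007240018df003507817c8b0078048c, 0x76a80017200000600007580006a00007a0000290000238000538000c0800047000020800031000012800015c00000c00010c0000500000d4000028a, 0xd098000b04002814002da00001c40000e000049c0003700010e400008400019c0005400000840000b40001880001b40001c88, 0xa2d00012200012f80006a8003f080144d800340c0012b4007a800054a0009ac800cac80210c807c3f801c998028d2801bfe002f2f0032b28050120098350d,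 0xc5e00020e001b6d8001fc0006d880036a000a90801c6a80062c80098f000f7c800d41800f8e8016c3011adb80743900a2e000828380b68800b5de80f0f00a, 0xcf30000ad4008050000558000b3000158c000c2c0004880001080012640005640002dc0002440004d800014c0000bc00005800000c0000488, 0xc5e0000e84005c88000084001c18001dc00003240001d4000c040016fc0001d80002440001040000bc0000380000b80000787], [], [0x4ddd801dacc0085d401a418001c7c027ad800a3c403b4f80006a401aa2001c01801d20c0332553, 0xc24c000ed600126f004fe3802a7c001e4380a3ec80570900435500639d0065f990, 0xc73e007ce2c027eb8050ec00a65480bbef8015cd0079e700fc068e, 0x5f2900029b00442e005a9d80828a00795c80780e0d, 0x781a801695805351804754803d1a00655e80084f8035c0802075401e63000f9700427100878480514dc0565f10, 0xfa0800716f002fca005df98052e400401c000025c036df81e45e008a6280dfdd8d, 0x260e800852800b550004be800c3900738b8035898061a180af40006e9100b7778096f80101738c, 0x56b00092258062f78022be002bfe81909d0a, 0xbcce00635ac012a9c0285680300080240280307b003a20809eae00039d0166be802fd0c022138e, 0x8c338018fac00e6200329b80509600013d00168c8036f28197ca805bc98c, 0x1f5f80012b4015ed4001258001f440000bc00020400022000016800032400017000040ca,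 0x3f5c8000574000708000284000d8402889c0000cc00007000012000023800037c8, 0x2af30003ba8007778012d9000545806e5100526f00366d004d020054ca008f4a00689580a4ff0106c90d, 0x1669f008ddf80c70500a04700e03000dd8181253e8a, 0x3f6d0001174002b980277b000062c00012c0003ac0001100001088, 0x3fc0800032c0004580001c002ab200000380001207], [], [0xc5b2001362405b54001beb40619c807372001601802dead3, 0x2882f009a37810e1581fdef90, 0x42d4481f08f8e, 0, 0x1ea25808a078083d900cbb90157c30063db41217c10, 0x2a85b013a4e000fa5803afa80913d82928a015530022d040d, 0x26c6b815aa70c, 0, 0x22d23003c3f00b6c080ba3e012b52804eeb01abf70042e1c0d70e0e, 0x185410056e3802121802fa28047db81e698813d2b8c, 0x2a46b005f2eca, 0, 0x1b83a00744600cb238086e180db31014a9b0d, 0x30eff810cd380926500ce5500d21e0116550a, 0x5419480adea8000e5c000d188]], [[], [], [], [], [], [], [], [0x148b800316800769001f4c40157a801bab8045054019f9c01dbf0009bfc00f62000708401e1a800c3cc0016e80044cc00dfe4033a5d3, 0x7054801823c00679006d108009ccc05e36003c318014a4806cb580c925005279804cf900212100088d90, 0x17ae8033e14001758001368017528010e7c034c2000c46400124c007b540093d4073b500459b407d34803f1c809b0b8096998018b880466e00883f8e,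 0x15e78004d50004abc00387000883800fa18003ad8007ab0014dd801a1e00098d006bb5004465806632006628806ccf0d, 0xd6dd001e05004e478009a2004f7f801b1240027e0017de002f898103b8005635c016ed90, 0x6f49801a13803572c0428000630400b76500192c00508400c69180c3fb0058938058cf42582d808ff280bd488d, 0xbc68003cc0003290000e00003b200001640063980031c0004d700159f8017fc8025cf000f0080bc64808e37804e2680818b8056738093730c, 0x145a8011ea00046f800627800734000aef0004f20006a00009160018e78063070041a78016c0001ce38108f98a, 0x8e96800ce44046d38052bbc049f28064680038a680245b4015458018fa407ff3001c5f417a358046af403313ce, 0x1a9d80048c00056e00055f8006f900054b0078ff000b22c0110180303d004af20006ba8018e8003507817dca80775d0c, 0xc290000ffc0006800002680006680004000007ac000c340013480000e00004800001d00000900003040000d400001400015c000148a, 0x194c8001ce400024c00065400023c00176c00095400051c00030c0003b000041c00016800052c0002000000208, 0x15688000b1c004c54004b600111100054bc0001900095300078b800a7b000cfd8020c780824a801d7b0029a4001c66802ff500345a805344009f3c0d, 0x23020003e2000dec00052000033c00087e8007bb000766000c72808c4a00399f0050dc8040f5005ac28059c280775c8a, 0x22ad00022f800180c0002240006f80010e400398c0008c800095c000590000fe80008540000e80000e00000a80000a88,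 0x201f8004018000a540002c8000a3800191c000d9800037c0005b800041c000a9000007c0000307], [], [0xfa25809f3540566d000ced8024c6403a2953, 0x1e8f100159fc02a9200fd9f00aba400a39d80e22480ee4810, 0x2bdd1000586c122c981ae238e, 0x301750058fe0d, 0x1c4208040c00022b7004b2c00992301b10080d051c087ae90, 0x4d61200f1db014e988d, 0x1a3fc80dda0808f3b80f7d60c, 0x3f2e380dcd601f0dc0a, 0x2d0e1005a1542a4a480981bc0282b8e, 0x1b2ff002ecc4022fb004b9c82279a80b5250c, 0x219db805e7d4001ef000343ca, 0x57b3f80e8fa48, 0x2c1eb014be5816e7a8d, 0x42569816a7c00da24011dcc0a, 0x57b3380dd8808, 0x72e6d01239387]], [[], [], [], [], [], [], [], [], [0xb53f80078a0032b8007004405237804b8fc01142001afa401548c0306d53, 0x24916810e4500a6af00814200abe590, 0x1b81100eb5b8026a880cecf0136cc0e, 0x194e580cb5d00da5400e3890d, 0x2f18700afbd4058d210, 0x2f2a080122200e4e0003b6b4323b780d60300b68e8d, 0x10b378044d881006a80807980db2700af4f0130f68c, 0x25054003bd6804eb70412138a, 0x483f900f1d1c045804e, 0x3f85b804b408c, 0x1d62b0097cf4002e10003dec003308001f44a,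 0x3a4e8011feb40001040030ec8]], [], [[0x2c5ecc13]]]

/-! ### Kernel-friendly evaluation

Everything is written with recursors, `Nat` operations that the kernel accelerates and continuation
passing, so that a Boolean check reduces quickly. Integers are represented by residues modulo
`modulus`. -/

noncomputable section Evaluator

@[irreducible] def modulus : ℕ := Nat.pow 2 512
/-- The residue of `-1`. -/
def neg1 : ℕ := Nat.sub modulus 1

/-- Evaluates `n` to a numeral before passing it to `k`. -/
def force {γ : Type} (n : ℕ) (k : ℕ → γ) : γ :=
  @Nat.rec (fun _ => γ) (k 0) (fun m _ => k m) (Nat.add n 1)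

/-- The sum of `f j (l j) (l' j)` with indices `j` counted from `i`. -/
def sumZ {α β : Type} (f : ℕ → α → β → ℕ) (l : List α) : List β → ℕ → ℕ :=
  @List.rec α (fun _ => List β → ℕ → ℕ) (fun _ _ => 0)
    (fun a _ ih l' i => @List.rec β (fun _ => ℕ) 0
      (fun b t _ => Nat.add (f i a b) (ih t (Nat.succ i))) l') l

/-- The dot product of two lists. -/
def dotN (l l' : List ℕ) : ℕ :=
  @List.rec ℕ (fun _ => List ℕ → ℕ) (fun _ => 0)
    (fun a _ ih l' => @List.rec ℕ (fun _ => ℕ) 0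
      (fun b t _ => Nat.add (Nat.mul a b) (ih t)) l') l l'

def getL {α : Type} (d : α) (l : List α) : ℕ → α :=
  @List.rec α (fun _ => ℕ → α) (fun _ => d)
    (fun a _ ih n => @Nat.rec (fun _ => α) a (fun m _ => ih m) n) l

def tailL {α : Type} (l : List α) : List α :=
  @List.rec α (fun _ => List α) [] (fun _ t _ => t) l

def dropL {α : Type} (n : ℕ) (l : List α) : List α :=
  @Nat.rec (fun _ => List α → List α) (fun l => l) (fun _ ih l => ih (tailL l)) n l

/-- `List.map` in continuation-passing style. -/
def mapK {α β γ : Type} (f : α → (β → γ) → γ) (l : List α) : (List β → γ) → γ :=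
  @List.rec α (fun _ => (List β → γ) → γ) (fun k => k [])
    (fun a _ ih k => f a (fun b => ih (fun t => k (b :: t)))) l

/-- `List.zipWith` in continuation-passing style. -/
def zipK {α β δ γ : Type} (f : α → β → (δ → γ) → γ) (l : List α) :
    List β → (List δ → γ) → γ :=
  @List.rec α (fun _ => List β → (List δ → γ) → γ) (fun _ k => k [])
    (fun a _ ih l' k => @List.rec β (fun _ => γ) (k [])
      (fun b t _ => f a b (fun c => ih t (fun t => k (c :: t)))) l') l

/-- The list of the values of `f` below `n`, in continuation-passing style. -/
def tabK {β γ : Type} (f : ℕ → (β → γ) → γ) (n : ℕ) (k : List β → γ) : γ :=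
  @Nat.rec (fun _ => List β → γ) k (fun m ih acc => f m (fun v => ih (v :: acc))) n []

/-- The residue of the integer with zigzag code `n`. -/
def zz (n : ℕ) : ℕ :=
  @Nat.rec (fun _ => ℕ) (Nat.div n 2)
    (fun _ _ => Nat.mod (Nat.mul neg1 (Nat.div n 2)) modulus) (Nat.mod n 2)

/-- Decodes a number in base `2 ^ W` into a list of residues scaled by `2 ^ e`. -/
def decK {γ : Type} (W e : ℕ) (fuel : ℕ) : ℕ → (List ℕ → γ) → γ :=
  @Nat.rec (fun _ => ℕ → (List ℕ → γ) → γ) (fun _ k => k [])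
    (fun _ ih n k => @Nat.rec (fun _ => γ) (k [])
      (fun _ _ => force (Nat.mod (Nat.mul (Nat.pow 2 e) (zz (Nat.mod n (Nat.pow 2 W)))) modulus)
        (fun v => force (Nat.div n (Nat.pow 2 W)) (fun n' => ih n' (fun t => k (v :: t))))) n) fuel

def rowK {γ : Type} (W : ℕ) (n : ℕ) (k : List ℕ → γ) : γ :=
  force (Nat.mod n 64) fun e => force (Nat.div n 64) fun m => decK W e 29 m k

def rowsE {γ : Type} (k : List (List (List (List (List ℕ)))) → γ) : γ :=
  mapK (fun l k => mapK (fun l k => mapK (fun l k => mapK (fun n k => rowK 36 n k) l k) l k) l k)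
    dataE k

def rowsD {γ : Type} (k : List (List (List (List ℕ))) → γ) : γ :=
  mapK (fun l k => mapK (fun l k => mapK (fun n k => rowK 24 n k) l k) l k) dataD k

/-- Products of pairs of decoded rows. -/
def tableE {γ : Type} (k : List (List (List (List (List (List ℕ))))) → γ) : γ :=
  rowsE fun R => mapK (fun Ra k => mapK (fun Rb k => mapK (fun r k => mapK (fun r' k =>
    zipK (fun x y k => zipK (fun u v k => force (Nat.mod (dotN u v) modulus) k) x y k) r r' k)
    Rb k) Ra k) R k) R k

/-- Multiplies a polynomial, given by its coefficients, by `1 + c X`. -/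
def rowStep {γ : Type} (c : ℕ) (row : List ℕ) : ℕ → (List ℕ → γ) → γ :=
  @List.rec ℕ (fun _ => ℕ → (List ℕ → γ) → γ)
    (fun prev k => force (Nat.mod (Nat.mul c prev) modulus) fun v => k [v])
    (fun a _ ih prev k => force (Nat.mod (Nat.add a (Nat.mul c prev)) modulus) fun v =>
      ih a (fun t => k (v :: t))) row

def rowP {γ : Type} (c : ℕ) (p : ℕ) : List ℕ → (List ℕ → γ) → γ :=
  @Nat.rec (fun _ => List ℕ → (List ℕ → γ) → γ) (fun r k => k r)
    (fun _ ih r k => rowStep c r 0 (fun r' => ih r' k)) p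

/-- The coefficients of `(1 + X) ^ p * (1 - X) ^ m`. -/
def tableK {γ : Type} (k : List (List (List ℕ)) → γ) : γ :=
  tabK (fun p k => rowP 1 p [1] fun r => tabK (fun m k => rowP neg1 m r k) (Nat.sub 25 p) k) 25 k

/-- The sequence of the numbers `c ^ m * m! * C(a, m) * C(b, m)`. -/
def seqA {γ : Type} (c a b fuel : ℕ) : ℕ → ℕ → (List ℕ → γ) → γ :=
  @Nat.rec (fun _ => ℕ → ℕ → (List ℕ → γ) → γ) (fun _ _ k => k [])
    (fun _ ih m v k => @Nat.rec (fun _ => γ) (k [])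
      (fun _ _ => force (Nat.add m 1) fun m' =>
        force (Nat.div (Nat.mul v (Nat.mul (Nat.sub a m) (Nat.sub b m))) m') fun v' =>
        force (Nat.mod (Nat.mul (Nat.pow c m) v) modulus) fun w =>
          ih m' v' (fun t => k (w :: t))) v) fuel

def tableA {γ : Type} (c : ℕ) (k : List (List (List ℕ)) → γ) : γ :=
  tabK (fun a k => tabK (fun b k => seqA c a b 13 0 1 k) 25 k) 25 k

def conv (A B x : List ℕ) : ℕ :=
  @List.rec ℕ (fun _ => List ℕ → ℕ) (fun _ => 0)
    (fun a _ ih x => @List.rec ℕ (fun _ => ℕ) 0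
      (fun _ t _ => Nat.add (Nat.mul a (dotN B x)) (ih t)) x) A x

def q1 (a c d b : ℕ) : ℕ := Nat.add (Nat.mul a b) (Nat.mul neg1 (Nat.mul c d))
def tri (a : ℕ) : ℕ := Nat.div (Nat.mul a (Nat.sub a 1)) 2
def q2 (a c d b : ℕ) : ℕ :=
  Nat.add (Nat.add (Nat.mul 2 (Nat.mul (tri a) (tri b)))
    (Nat.mul neg1 (Nat.mul (Nat.mul a b) (Nat.mul c d))))
   (Nat.mul 2 (Nat.mul (tri c) (tri d)))

def leaf (TA TB : List (List (List ℕ))) (n11 n10 n01 n00 s11 s10 s01 s00 : ℕ)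
    (e : List ℕ) : ℕ :=
  @List.rec ℕ (fun _ => ℕ) 0 (fun x0 t _ => Nat.add x0
    (@List.rec ℕ (fun _ => ℕ) 0 (fun x1 t _ => Nat.add (Nat.mul x1 (q1 s11 s10 s01 s00))
      (@List.rec ℕ (fun _ => ℕ) 0 (fun x2 t _ => Nat.add (Nat.mul x2 (q2 s11 s10 s01 s00))
        (@List.rec ℕ (fun _ => ℕ) 0 (fun x3 t _ => Nat.add
          (Nat.mul x3 (q1 (Nat.sub n11 s11) (Nat.sub n10 s10) (Nat.sub n01 s01) (Nat.sub n00 s00)))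
          (@List.rec ℕ (fun _ => ℕ) 0 (fun _ _ _ =>
            force (Nat.sub n11 s11) fun m11 => force (Nat.sub n10 s10) fun m10 =>
            force (Nat.sub n01 s01) fun m01 => force (Nat.sub n00 s00) fun m00 =>
            conv (getL [] (getL [] TA m11) m00) (getL [] (getL [] TB m10) m01) (0 :: 0 :: t)) t))
          t)) t)) t)) e

/-- The index of an even distance in the tables. -/
def idx (w : ℕ) : ℕ := @Nat.rec (fun _ => ℕ) 0 (fun _ _ => Nat.div (Nat.sub w 8) 2) w

def sumE00 (TA TB : List (List (List ℕ))) (n11 n10 n01 n00 : ℕ) (K00 : List ℕ)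
    (s11 s10 s01 : ℕ) (e : List (List ℕ)) : ℕ :=
  sumZ (fun s00 k e => Nat.mul k (leaf TA TB n11 n10 n01 n00 s11 s10 s01 s00 e))
    K00 (dropL (Nat.add s11 (Nat.add s10 s01)) e) 0

def sumE01 (TA TB : List (List (List ℕ))) (n11 n10 n01 n00 : ℕ) (K01 K00 : List ℕ)
    (s11 s10 : ℕ) (r : List (List (List ℕ))) : ℕ :=
  sumZ (fun s01 k e => Nat.mul k (sumE00 TA TB n11 n10 n01 n00 K00 s11 s10 s01 e))
    K01 (dropL s11 r) 0

def sumE10 (TA TB : List (List (List ℕ))) (n11 n10 n01 n00 : ℕ) (K10 K01 K00 : List ℕ)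
    (s11 : ℕ) (X : List (List (List (List ℕ)))) : ℕ :=
  sumZ (fun s10 k r => Nat.mul k
    (Nat.mod (sumE01 TA TB n11 n10 n01 n00 K01 K00 s11 s10 r) modulus)) K10 (dropL s11 X) 0

def sumE11 (TA TB : List (List (List ℕ))) (n11 n10 n01 n00 : ℕ) (K11 K10 K01 K00 : List ℕ)
    (X : List (List (List (List ℕ)))) : ℕ :=
  sumZ (fun s11 k _ => Nat.mul k (sumE10 TA TB n11 n10 n01 n00 K10 K01 K00 s11 X)) K11 K11 0

def evalE (TE : List (List (List (List (List (List ℕ)))))) (TK TA TB : List (List (List ℕ)))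
    (p11 m11 p10 m10 p01 m01 p00 m00 : ℕ) : ℕ :=
  force (Nat.add p11 m11) fun n11 => force (Nat.add p10 m10) fun n10 =>
  force (Nat.add p01 m01) fun n01 => force (Nat.add p00 m00) fun n00 =>
  force (idx (Nat.add n11 n10)) fun a => force (idx (Nat.add n11 n01)) fun b =>
  sumE11 TA TB n11 n10 n01 n00
    (getL [] (getL [] TK p11) m11) (getL [] (getL [] TK p10) m10)
    (getL [] (getL [] TK p01) m01) (getL [] (getL [] TK p00) m00) (getL [] (getL [] TE a) b)

def qlist (A B : List ℕ) : List ℕ :=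
  (fun a1 a2 a3 b1 b2 b3 => [1, Nat.add a1 b1, Nat.add a2 (Nat.add (Nat.mul a1 b1) b2),
    Nat.add (Nat.add a3 (Nat.mul a2 b1)) (Nat.add (Nat.mul a1 b2) b3)])
  (getL 0 A 1) (getL 0 A 2) (getL 0 A 3) (getL 0 B 1) (getL 0 B 2) (getL 0 B 3)

def evalD (TD : List (List (List (List ℕ)))) (TA TB : List (List (List ℕ)))
    (n111 n110 n101 n100 n011 n010 n001 n000 : ℕ) : ℕ :=
  force (Nat.add n111 n110) fun i => force (Nat.add n011 n010) fun j =>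
  force (Nat.add n111 n101) fun i' => force (Nat.add n011 n001) fun j' =>
  @Bool.rec (fun _ => ℕ) 0
   (mapK (fun n k => force (Nat.mod n modulus) k)
     (qlist (getL [] (getL [] TA n111) n100) (getL [] (getL [] TB n110) n101)) fun qk =>
    mapK (fun n k => force (Nat.mod n modulus) k)
     (qlist (getL [] (getL [] TA n011) n000) (getL [] (getL [] TB n010) n001)) fun ql =>
    (fun r r' => sumZ (fun kl u v => Nat.mul
       (Nat.mul (getL 0 qk (Nat.div kl 4)) (getL 0 ql (Nat.mod kl 4)))
       (dotN u v)) r r' 0)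
    (getL [] (getL [] TD i) j) (getL [] (getL [] TD i') j'))
   (Nat.beq (Nat.add (Nat.add n111 n110) (Nat.add n101 n100)) 12)

/-- The kernel at a quadruple of words, of which `tpqr` is the number of coordinates where the sums
of the first word with the other three are `p`, `q`, `r`. -/
def evalG (TE : List (List (List (List (List (List ℕ)))))) (TD : List (List (List (List ℕ))))
    (TK TA TB : List (List (List ℕ)))
    (t111 t110 t101 t100 t011 t010 t001 t000 : ℕ) : ℕ :=
  (fun fE fD => Nat.mod (Nat.add
    (Nat.add (fE t101 t110 t100 t111 t001 t010 t000 t011)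
    (Nat.add (fE t011 t110 t010 t111 t001 t100 t000 t101)
      (fE t011 t101 t001 t111 t010 t100 t000 t110)))
    (Nat.add (Nat.add (Nat.add
    (Nat.add (fD t111 t110 t101 t100 t011 t010 t001 t000)
      (fD t100 t101 t110 t111 t011 t010 t001 t000))
    (Nat.add (fD t111 t110 t011 t010 t101 t100 t001 t000)
      (fD t010 t011 t110 t111 t101 t100 t001 t000)))
    (Nat.add (fD t111 t101 t011 t001 t110 t100 t010 t000)
      (fD t001 t011 t101 t111 t110 t100 t010 t000)))
    (Nat.add (Nat.add (Nat.add (fD t100 t101 t011 t010 t110 t111 t001 t000)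
      (fD t010 t011 t101 t100 t110 t111 t001 t000))
    (Nat.add (fD t100 t110 t011 t001 t101 t111 t010 t000)
      (fD t001 t011 t110 t100 t101 t111 t010 t000)))
    (Nat.add (fD t010 t110 t101 t001 t011 t111 t100 t000)
      (fD t001 t101 t110 t010 t011 t111 t100 t000))))) modulus)
  (evalE TE TK TA TB) (evalD TD TA TB)

end Evaluator

/-- Whether `f` holds on the list `l`. -/
def allL (f : ℕ → Bool) (l : List ℕ) : Bool :=
  @List.rec ℕ (fun _ => Bool) true (fun a _ ih => @Bool.rec (fun _ => Bool) false ih (f a)) l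

/-- Evaluates `f` on the precomputed tables. -/
def all5 (f : List (List (List (List (List (List ℕ))))) → List (List (List (List ℕ))) →
    List (List (List ℕ)) → List (List (List ℕ)) → List (List (List ℕ)) → Bool) : Bool :=
  tableE fun TE => rowsD fun TD => tableK fun TK => tableA 1 fun TA => tableA neg1 fun TB => f TE TD TK TA TB

/-- Whether `f` holds below `n`. -/
def allB (n : ℕ) (f : ℕ → Bool) : Bool :=
  @Nat.rec (fun _ => Bool) true (fun m ih => @Bool.rec (fun _ => Bool) false ih (f m)) n

def impB (a b : Bool) : Bool := @Bool.rec (fun _ => Bool) true b a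

def andB (a b : Bool) : Bool := @Bool.rec (fun _ => Bool) false b a

/-- Whether `d` is an even number that is at least 10. -/
def okd (d : ℕ) : Bool := andB (Nat.ble 10 d) (Nat.beq (Nat.mod d 2) 0)

/-- The number with the given digits in base 32. -/
def code (a b c d e f : ℕ) : ℕ :=
  Nat.add (Nat.mul 32 (Nat.add (Nat.mul 32 (Nat.add (Nat.mul 32
    (Nat.add (Nat.mul 32 (Nat.add (Nat.mul 32 a) b)) c)) d)) e)) f

/-- Whether the distances of a quadruple have the smallest code among all orderings of the words. -/
def canon (d01 d02 d12 d03 d13 d23 : ℕ) : Bool :=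
  force (code d01 d02 d12 d03 d13 d23) fun c =>
  allL (fun x => Nat.ble c x) [
    code d01 d03 d13 d02 d12 d23, code d02 d01 d12 d03 d23 d13, code d02 d03 d23 d01 d12 d13,
    code d03 d01 d13 d02 d23 d12, code d03 d02 d23 d01 d13 d12, code d01 d12 d02 d13 d03 d23,
    code d01 d13 d03 d12 d02 d23, code d12 d01 d02 d13 d23 d03, code d12 d13 d23 d01 d02 d03,
    code d13 d01 d03 d12 d23 d02, code d13 d12 d23 d01 d03 d02, code d02 d12 d01 d23 d03 d13,
    code d02 d23 d03 d12 d01 d13, code d12 d02 d01 d23 d13 d03, code d12 d23 d13 d02 d01 d03,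
    code d23 d02 d03 d12 d13 d01, code d23 d12 d13 d02 d03 d01, code d03 d13 d01 d23 d02 d12,
    code d03 d23 d02 d13 d01 d12, code d13 d03 d01 d23 d12 d02, code d13 d23 d12 d03 d01 d02,
    code d23 d03 d02 d13 d12 d01, code d23 d13 d12 d03 d02 d01]

/-- Whether `v` is the residue of a nonpositive integer that is not too large. -/
def nonpos (v : ℕ) : Bool :=
  @Bool.rec (fun _ => Bool) (Nat.beq v 0) true (Nat.beq (Nat.div v (Nat.pow 2 511)) 1)

/-- The inequalities for quadruples with the two given distances. -/
def quads (TE : List (List (List (List (List (List ℕ)))))) (TD : List (List (List (List ℕ))))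
    (TK TA TB : List (List (List ℕ))) (d01 d02 : ℕ) : Bool :=
  allB 25 fun c11 => impB (Nat.ble c11 d01) <| impB (Nat.ble c11 d02) <|
  force (Nat.sub d01 c11) fun c10 => force (Nat.sub d02 c11) fun c01 =>
  force (Nat.add c11 (Nat.add c10 c01)) fun c => impB (Nat.ble c 24) <|
  force (Nat.sub 24 c) fun c00 =>
  force (Nat.add c10 c01) fun d12 => impB (okd d12) <| impB (Nat.ble d02 d12) <|
  allB (Nat.add c11 1) fun e11 => allB (Nat.add c10 1) fun e10 =>
  allB (Nat.add c01 1) fun e01 => allB (Nat.add c00 1) fun e00 =>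
  force (Nat.sub c11 e11) fun f11 => force (Nat.sub c10 e10) fun f10 =>
  force (Nat.sub c01 e01) fun f01 =>
  force (Nat.add e11 (Nat.add e10 (Nat.add e01 e00))) fun d03 => impB (okd d03) <|
  force (Nat.add f11 (Nat.add f10 (Nat.add e01 e00))) fun d13 => impB (okd d13) <|
  force (Nat.add f11 (Nat.add f01 (Nat.add e10 e00))) fun d23 => impB (okd d23) <|
  impB (canon d01 d02 d12 d03 d13 d23) <|
  force (Nat.sub c00 e00) fun f00 =>
  nonpos (evalG TE TD TK TA TB e11 f11 e10 f10 e01 f01 e00 f00)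

/-- The bound for triples as a function of distance. -/
def hneg : List ℕ :=
  [0, 0, 0, 0, 0, 0, 0, 0, 0, 0, 153200543778119480246272, 0, 43360480338607945537776, 0,
   66500793726235534426112, 0, 92604347731893322514432, 0, 209897417984307462406144]

/-- The coefficients of the bound for pairs. -/
def delta : List ℕ :=
  [0, 31599568907529040775086080, 7779591026945863402389504, 3218205900069808851910656,
   1506772846395419904, 91107402971049456, 30289236680936635, 17159615731951194, 8126937404742384,
   3810771686016324, 2461134927843831, 2112689822500938, 2063387983658298]

/-- The constant in the bound for pairs. -/
def kap : ℕ := 242861158954617562718000000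

/-- The inequalities for triples. -/
def triples (TE : List (List (List (List (List (List ℕ)))))) (TD : List (List (List (List ℕ))))
    (TK TA TB : List (List (List ℕ))) : Bool :=
  allB 25 fun c11 => allB (Nat.sub 25 c11) fun c10 => allB (Nat.sub 25 (Nat.add c11 c10)) fun c01 =>
  force (Nat.sub 24 (Nat.add c11 (Nat.add c10 c01))) fun c00 =>
  force (Nat.add c11 c10) fun d01 => force (Nat.add c11 c01) fun d02 =>
  force (Nat.add c10 c01) fun d12 =>
  impB (okd d01) <| impB (okd d02) <| impB (okd d12) <| impB (Nat.ble d01 d02) <|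
  impB (Nat.ble d02 d12) <| nonpos (Nat.mod (Nat.add (Nat.add
    (evalG TE TD TK TA TB 0 0 0 0 c11 c10 c01 c00) (Nat.add
    (evalG TE TD TK TA TB 0 0 0 0 c10 c11 c01 c00)
    (evalG TE TD TK TA TB 0 0 0 0 c01 c11 c10 c00)))
    (Nat.mul neg1 (Nat.add (getL 0 hneg d01) (Nat.add (getL 0 hneg d02) (getL 0 hneg d12))))) modulus)

/-- The inequalities for pairs. -/
def pairs (TE : List (List (List (List (List (List ℕ)))))) (TD : List (List (List (List ℕ))))
    (TK TA TB : List (List (List ℕ))) : Bool :=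
  allB 25 fun d => impB (okd d) <| nonpos (Nat.mod (Nat.add (Nat.add
    (Nat.mul 4 (evalG TE TD TK TA TB 0 0 0 0 0 0 d (Nat.sub 24 d)))
    (Nat.mul 3 (evalG TE TD TK TA TB 0 0 0 0 d 0 0 (Nat.sub 24 d))))
    (Nat.add (dotN delta (getL [] (getL [] TK (Nat.sub 24 d)) d))
     (Nat.add (Nat.mul 1602 (getL 0 hneg d)) kap))) modulus)

/-- The bound for the constant quadruple. -/
def const (TE : List (List (List (List (List (List ℕ)))))) (TD : List (List (List (List ℕ))))
    (TK TA TB : List (List (List ℕ))) : Bool :=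
  nonpos (Nat.mod (Nat.add (evalG TE TD TK TA TB 0 0 0 0 0 0 0 24)
    (Nat.mul neg1 55695727428406170122230000000)) modulus)

section Pure

lemma force_eq {γ : Type} (n : ℕ) (k : ℕ → γ) : force n k = k n := rfl

lemma getL_eq {α : Type} (d : α) (l : List α) (n : ℕ) : getL d l n = l.getD n d := by
  induction l generalizing n with
  | nil => rfl
  | cons a l ih => cases n with
    | zero => rfl
    | succ n => exact (ih n).trans (by simp)

lemma dropL_eq {α : Type} (n : ℕ) (l : List α) : dropL n l = l.drop n := by
  induction n generalizing l with
  | zero => rfl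
  | succ n ih => cases l with
    | nil => exact (ih []).trans (by simp)
    | cons a l => exact (ih l).trans (by simp)

lemma mapK_eq {α β γ : Type} {f : α → (β → γ) → γ} (f' : α → β) (h : ∀ a k, f a k = k (f' a))
    (l : List α) (k : List β → γ) : mapK f l k = k (l.map f') := by
  induction l generalizing k with
  | nil => rfl
  | cons a l ih => exact (h _ _).trans (ih _)

lemma zipK_eq {α β δ γ : Type} {f : α → β → (δ → γ) → γ} (f' : α → β → δ)
    (h : ∀ a b k, f a b k = k (f' a b)) (l : List α) (l' : List β) (k : List δ → γ) :
    zipK f l l' k = k (List.zipWith f' l l') := by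
  induction l generalizing l' k with
  | nil => rfl
  | cons a l ih => cases l' with
    | nil => rfl
    | cons b l' => exact (h _ _ _).trans (ih _ _)

/-- `[f 0, …, f (n - 1)]` -/
def tab {β : Type} (f : ℕ → β) (n : ℕ) : List β := (List.range n).map f

lemma tabK_eq {β γ : Type} {f : ℕ → (β → γ) → γ} (f' : ℕ → β) (h : ∀ a k, f a k = k (f' a))
    (n : ℕ) (k : List β → γ) : tabK f n k = k (tab f' n) := by
  have : ∀ acc, @Nat.rec (fun _ => List β → γ) k
      (fun m ih acc => f m (fun v => ih (v :: acc))) n acc = k (tab f' n ++ acc) := by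
    induction n with
    | zero => intro acc; rfl
    | succ n ih =>
      intro acc
      refine (h _ _).trans ((ih _).trans ?_)
      simp [tab, List.range_succ]
  exact (this []).trans (by simp)

lemma getD_tab {β : Type} (f : ℕ → β) {n i : ℕ} (d : β) (h : i < n) : (tab f n).getD i d = f i := by
  simp [tab, List.getD, h]

end Pure

section Rows

lemma one_lt_modulus : 1 < modulus := by
  unfold modulus; exact Nat.one_lt_two_pow (n := 512) (by decide)

/-- The ring of residues modulo `modulus`. -/
def R : Type := ZMod modulus

instance instCommRingR : CommRing R := ZMod.commRing modulus

instance instCharPR : CharP R modulus := ZMod.charP modulus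

attribute [irreducible] R instCommRingR

lemma intCast_eq_iff (a b : ℤ) : (a : R) = b ↔ (modulus : ℤ) ∣ b - a :=
  (CharP.intCast_eq_intCast R modulus).trans Int.modEq_iff_dvd

lemma cast_mod (n : ℕ) : ((Nat.mod n modulus : ℕ) : R) = n :=
  (CharP.cast_eq_mod R modulus n).symm

lemma cast_neg1 : ((neg1 : ℕ) : R) = -1 := by
  have h0 : ((modulus : ℕ) : R) = 0 := CharP.cast_eq_zero R modulus
  have h : ((modulus - 1 : ℕ) : R) = -1 := by
    rw [Nat.cast_sub one_lt_modulus.le, h0]; simp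
  exact h

/-- Signed integer from its zigzag code. -/
def zzZ (n : ℕ) : ℤ := if n % 2 = 0 then ((n / 2 : ℕ) : ℤ) else -((n / 2 : ℕ) : ℤ)

lemma cast_zz (n : ℕ) : ((zz n : ℕ) : R) = zzZ n := by
  unfold zz zzZ
  have h0 : Nat.mod n 2 = n % 2 := rfl
  have h1 : Nat.div n 2 = n / 2 := rfl
  rcases Nat.mod_two_eq_zero_or_one n with h | h
  · rw [h0, h, h1, if_pos rfl]
    exact (Int.cast_natCast (n / 2)).symm
  · rw [h0, h, h1, if_neg one_ne_zero]
    refine (cast_mod _).trans ?_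
    rw [Nat.mul_eq, Nat.cast_mul, cast_neg1, Int.cast_neg, Int.cast_natCast, neg_one_mul]

/-- The integer row coded by `m` in base `2 ^ W`, scaled by `2 ^ e`. -/
def decZ (W e : ℕ) : ℕ → ℕ → List ℤ
  | 0, _ => []
  | _ + 1, 0 => []
  | f + 1, n + 1 => 2 ^ e * zzZ ((n + 1) % 2 ^ W) :: decZ W e f ((n + 1) / 2 ^ W)

/-- The integer row coded by `n`. -/
def rowZ (W n : ℕ) : List ℤ := decZ W (n % 64) 29 (n / 64)

/-- Residues of the entries of `decZ`. -/
def decN (W e : ℕ) : ℕ → ℕ → List ℕ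
  | 0, _ => []
  | _ + 1, 0 => []
  | f + 1, n + 1 => Nat.mod (Nat.mul (Nat.pow 2 e) (zz (Nat.mod (n + 1) (Nat.pow 2 W)))) modulus ::
      decN W e f ((n + 1) / 2 ^ W)

/-- Residues of the entries of `rowZ`. -/
def rowN (W n : ℕ) : List ℕ := decN W (n % 64) 29 (n / 64)

lemma decK_eq {γ : Type} (W e f n : ℕ) (k : List ℕ → γ) : decK W e f n k = k (decN W e f n) := by
  induction f generalizing n k with
  | zero => rfl
  | succ f ih => cases n with
    | zero => rfl
    | succ n => exact ih _ _

lemma rowK_eq {γ : Type} (W n : ℕ) (k : List ℕ → γ) : rowK W n k = k (rowN W n) :=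
  decK_eq W (n % 64) 29 (n / 64) k

lemma decN_cast (W e f n t : ℕ) : (((decN W e f n).getD t 0 : ℕ) : R) = (decZ W e f n).getD t 0 := by
  induction f generalizing n t with
  | zero => simp [decN, decZ]
  | succ f ih => cases n with
    | zero => simp [decN, decZ]
    | succ n => cases t with
      | succ t => simpa [decN, decZ] using ih _ t
      | zero =>
        simp only [decN, decZ, List.getD_cons_zero, cast_mod]
        have h := cast_zz ((n + 1) % 2 ^ W)
        simp only [Nat.mul_eq, Nat.cast_mul, Int.cast_mul]
        congr 1
        simp [Nat.pow_eq]

lemma length_decN (W e f n : ℕ) : (decN W e f n).length ≤ f := by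
  induction f generalizing n with
  | zero => simp [decN]
  | succ f ih => cases n with
    | zero => simp [decN]
    | succ n => simpa [decN] using ih _

lemma length_rowN (W n : ℕ) : (rowN W n).length ≤ 29 := length_decN _ _ _ _

lemma rowN_cast (W n t : ℕ) : (((rowN W n).getD t 0 : ℕ) : R) = (rowZ W n).getD t 0 :=
  decN_cast _ _ _ _ _

/-- The dot product of the first 29 entries. -/
def dotZ (u v : List ℤ) : ℤ := ∑ t ∈ range 29, u.getD t 0 * v.getD t 0

/-- The linear functional `f ↦ ∑ lⱼ f(j)`. -/
def rs : List ℕ → (ℕ → R) → R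
  | [], _ => 0
  | a :: l, f => a * f 0 + rs l fun n => f (n + 1)

lemma rs_eq_sum (l : List ℕ) (f : ℕ → R) {n : ℕ} (h : l.length ≤ n) :
    rs l f = ∑ j ∈ range n, (l.getD j 0 : R) * f j := by
  induction l generalizing f n with
  | nil => simp [rs]
  | cons a l ih =>
    obtain ⟨n, rfl⟩ : ∃ m, n = m + 1 := ⟨n - 1, by simp at h; omega⟩
    rw [sum_range_succ', rs, ih _ (by simpa using h), add_comm]
    simp

lemma rs_congr {l : List ℕ} {f g : ℕ → R} (h : ∀ j < l.length, f j = g j) : rs l f = rs l g := by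
  rw [rs_eq_sum l f le_rfl, rs_eq_sum l g le_rfl]
  exact sum_congr rfl fun j hj => by rw [h j (mem_range.1 hj)]

lemma dotN_cast (u v : List ℕ) : ((dotN u v : ℕ) : R) = rs u fun t => v.getD t 0 := by
  induction u generalizing v with
  | nil => simp [rs, dotN]
  | cons a u ih => cases v with
    | nil =>
      rw [rs_eq_sum _ _ le_rfl]; simp [dotN]
    | cons b v =>
      have : dotN (a :: u) (b :: v) = a * b + dotN u v := rfl
      rw [this, rs]; push_cast; rw [ih]; simp

lemma dotN_rowN (W m n : ℕ) : ((dotN (rowN W m) (rowN W n) : ℕ) : R) = dotZ (rowZ W m) (rowZ W n) := by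
  rw [dotN_cast, rs_eq_sum _ _ (length_rowN _ _), dotZ]
  push_cast
  refine sum_congr rfl fun t _ => ?_
  rw [rowN_cast, rowN_cast]

end Rows

section Tables

lemma getD_map_of_eq {α β : Type} (f : α → β) {d : α} {d' : β} (h : f d = d') (l : List α) (n : ℕ) :
    (l.map f).getD n d' = f (l.getD n d) := by
  subst h; exact List.getD_map ..

lemma getD_map_of_lt {α β : Type} (f : α → β) {l : List α} {n : ℕ} (h : n < l.length) (d : α)
    (d' : β) : (l.map f).getD n d' = f (l.getD n d) := by
  rw [List.getD_eq_getElem _ _ (by rwa [List.length_map]), List.getElem_map,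
    List.getD_eq_getElem _ _ h]

lemma getD_map_of_le {α β : Type} (f : α → β) {l : List α} {n : ℕ} (h : l.length ≤ n) (d' : β) :
    (l.map f).getD n d' = d' :=
  List.getD_eq_default _ _ (by rwa [List.length_map])

lemma getD_nil' {α : Type} (n : ℕ) (d : α) : ([] : List α).getD n d = d := rfl

lemma getD_zipWith_of_eq {α β δ : Type} (f : α → β → δ) {a : α} {b : β} {d : δ}
    (ha : ∀ y, f a y = d) (hb : ∀ x, f x b = d) (l : List α) (l' : List β) (n : ℕ) :
    (List.zipWith f l l').getD n d = f (l.getD n a) (l'.getD n b) := by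
  induction l generalizing l' n with
  | nil => simp [ha]
  | cons x l ih => cases l' with
    | nil => simp [hb]
    | cons y l' => cases n with
      | zero => simp
      | succ n => simpa using ih l' n

/-- The code number of the row with the given labels. -/
def numE (a i s g : ℕ) : ℕ := (((dataE.getD a []).getD i []).getD s []).getD g 0

lemma rowsE_eq {γ : Type} (k : List (List (List (List (List ℕ)))) → γ) :
    rowsE k = k (dataE.map fun l => l.map fun l => l.map fun l => l.map fun n => rowN 36 n) :=
  mapK_eq _ (mapK_eq _ (mapK_eq _ (mapK_eq _ (rowK_eq 36)))) _ _

/-- Products of a row list with another one. -/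
def prodRows (x y : List (List ℕ)) : List ℕ :=
  List.zipWith (fun u v => Nat.mod (dotN u v) modulus) x y

/-- The table computed by `tableE` from its rows. -/
def pureTableE (T : List (List (List (List (List ℕ))))) :
    List (List (List (List (List (List ℕ))))) :=
  T.map fun Ra => T.map fun Rb => Ra.map fun r => Rb.map fun r' => List.zipWith prodRows r r'

/-- The table computed by `tableE`. -/
def TE0 : List (List (List (List (List (List ℕ))))) :=
  pureTableE (dataE.map fun l => l.map fun l => l.map fun l => l.map fun n => rowN 36 n)

lemma tableE_eq {γ : Type} (k : List (List (List (List (List (List ℕ))))) → γ) :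
    tableE k = k TE0 := by
  refine (rowsE_eq _).trans ?_
  have h1 : ∀ (x y : List (List ℕ)) (k : List ℕ → γ),
      zipK (fun u v k => force (Nat.mod (dotN u v) modulus) k) x y k = k (prodRows x y) :=
    fun x y k => zipK_eq _ (fun u v k => rfl) _ _ _
  refine mapK_eq _ (fun Ra k => ?_) _ _
  refine mapK_eq _ (fun Rb k => ?_) _ _
  refine mapK_eq _ (fun r k => ?_) _ _
  refine mapK_eq _ (fun r' k => ?_) _ _
  exact zipK_eq _ h1 _ _ _

/-- The list of kernel coefficients with the given labels. -/
def entE (a b i j s : ℕ) : List ℕ :=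
  ((((TE0.getD a []).getD b []).getD i []).getD j []).getD s []

lemma entE_eq (a b i j s : ℕ) : entE a b i j s =
    prodRows ((((dataE.getD a []).getD i []).getD s []).map (rowN 36))
      ((((dataE.getD b []).getD j []).getD s []).map (rowN 36)) := by
  have key : ∀ T : List (List (List (List (List ℕ)))), ((((((pureTableE T).getD a []).getD b
      []).getD i []).getD j []).getD s []) =
      prodRows (((T.getD a []).getD i []).getD s []) (((T.getD b []).getD j []).getD s []) := by
    intro T
    have hz : ∀ x y n, (List.zipWith prodRows x y).getD n [] =
        prodRows (x.getD n []) (y.getD n []) := fun x y n =>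
      getD_zipWith_of_eq _ (fun y => by simp [prodRows]) (fun x => by simp [prodRows]) _ _ _
    rw [← hz]
    have h2 : ∀ (Ra Rb : List (List (List (List ℕ)))), ((Ra.map fun r => Rb.map fun r' =>
        List.zipWith prodRows r r').getD i []).getD j [] =
        List.zipWith prodRows (Ra.getD i []) (Rb.getD j []) := by
      intro Ra Rb
      rcases lt_or_ge i Ra.length with h | h
      · rw [getD_map_of_lt _ h [], getD_map_of_eq _ (d := []) List.zipWith_nil_right]
      · rw [getD_map_of_le _ h, List.getD_eq_default Ra _ h]
        rfl
    rw [← h2]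
    rcases lt_or_ge a T.length with h | h
    · rcases lt_or_ge b T.length with h' | h'
      · rw [pureTableE, getD_map_of_lt _ h [], getD_map_of_lt _ h' []]
      · rw [pureTableE, getD_map_of_lt _ h [], getD_map_of_le _ h',
          List.getD_eq_default _ _ h', h2]
        simp only [getD_nil', List.zipWith_nil_right]
    · rw [pureTableE, getD_map_of_le _ h, List.getD_eq_default _ _ h, h2, getD_nil', getD_nil',
        getD_nil', List.zipWith_nil_left]
  rw [entE, TE0, key]
  simp only [getD_map_of_eq _ (List.map_nil)]

lemma entE_cast (a b i j s g : ℕ) : (((entE a b i j s).getD g 0 : ℕ) : R) =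
    dotZ (rowZ 36 (numE a i s g)) (rowZ 36 (numE b j s g)) := by
  have h0 : rowN 36 0 = [] := rfl
  rw [entE_eq, prodRows, getD_zipWith_of_eq (a := []) (b := []) _ (fun y => Nat.zero_mod _)
    (fun x => by cases x <;> exact Nat.zero_mod _), cast_mod, getD_map_of_eq _ h0, getD_map_of_eq _ h0, dotN_rowN]
  rfl

lemma length_dataE_le : ∀ x ∈ dataE, ∀ y ∈ x, ∀ z ∈ y, z.length ≤ 15 := by
  decide +kernel

lemma dataE_odd : ∀ x ∈ dataE, ∀ i < 25, i % 2 = 1 → x.getD i [] = [] := by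
  decide +kernel

lemma length_entE (a b i j s : ℕ) : (entE a b i j s).length ≤ 15 := by
  rw [entE_eq, prodRows, List.length_zipWith]
  refine (min_le_left _ _).trans ?_
  rw [List.length_map]
  have mem : ∀ {α : Type} (l : List (List α)) (n : ℕ), l.getD n [] = [] ∨ l.getD n [] ∈ l := by
    intro α l n
    rcases lt_or_ge n l.length with h | h
    · right; rw [List.getD_eq_getElem _ _ h]; exact List.getElem_mem h
    · left; exact List.getD_eq_default _ _ h
  rcases mem dataE a with h | h
  · rw [h]; simp
  rcases mem _ i with h' | h'
  · rw [h']; simp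
  rcases mem _ s with h'' | h''
  · rw [h'']; simp
  exact length_dataE_le _ h _ h' _ h''

end Tables

section Krawtchouk

/-- Pure form of `rowStep`. -/
def rowStepN (c : ℕ) : List ℕ → ℕ → List ℕ
  | [], prev => [Nat.mod (Nat.mul c prev) modulus]
  | a :: l, prev => Nat.mod (Nat.add a (Nat.mul c prev)) modulus :: rowStepN c l a

/-- Pure form of `rowP`. -/
def rowPN (c : ℕ) : ℕ → List ℕ → List ℕ
  | 0, r => r
  | p + 1, r => rowPN c p (rowStepN c r 0)

lemma rowStep_eq {γ : Type} (c : ℕ) (row : List ℕ) (prev : ℕ) (k : List ℕ → γ) :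
    rowStep c row prev k = k (rowStepN c row prev) := by
  induction row generalizing prev k with
  | nil => rfl
  | cons a l ih => exact ih a _

lemma rowP_eq {γ : Type} (c p : ℕ) (r : List ℕ) (k : List ℕ → γ) :
    rowP c p r k = k (rowPN c p r) := by
  induction p generalizing r with
  | zero => rfl
  | succ p ih => exact (rowStep_eq c r 0 _).trans (ih _)

/-- The table computed by `tableK`. -/
def TK0 : List (List (List ℕ)) :=
  tab (fun p => tab (fun m => rowPN neg1 m (rowPN 1 p [1])) (Nat.sub 25 p)) 25

lemma tableK_eq {γ : Type} (k : List (List (List ℕ)) → γ) : tableK k = k TK0 := by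
  refine tabK_eq _ (fun p k => ?_) 25 k
  refine (rowP_eq 1 p [1] _).trans ?_
  exact tabK_eq _ (fun m k => rowP_eq neg1 m (rowPN 1 p [1]) k) _ _

/-- The operator `f ↦ f + c • f(· + 1)`. -/
def op (c : R) (f : ℕ → R) (n : ℕ) : R := f n + c * f (n + 1)

lemma rs_rowStepN (c : ℕ) (row : List ℕ) (prev : ℕ) (f : ℕ → R) :
    rs (rowStepN c row prev) f = c * prev * f 0 + rs row (op c f) := by
  induction row generalizing prev f with
  | nil => simp [rowStepN, rs, cast_mod]
  | cons a l ih =>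
    rw [rowStepN, rs, ih, rs, cast_mod]
    simp only [Nat.add_eq, Nat.mul_eq, Nat.cast_add, Nat.cast_mul, op]
    have : (op (c : R) fun n => f (n + 1)) = fun n => op c f (n + 1) := rfl
    rw [this]
    simp only [op]
    ring

lemma rs_rowPN (c p : ℕ) (r : List ℕ) (f : ℕ → R) : rs (rowPN c p r) f = rs r ((op c)^[p] f) := by
  induction p generalizing r with
  | zero => rfl
  | succ p ih => rw [rowPN, ih, rs_rowStepN, Function.iterate_succ_apply']; simp

/-- The coefficient functional of `(1 + X) ^ p * (1 - X) ^ m`. -/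
def cs (p m : ℕ) (f : ℕ → R) : R := (op 1)^[p] ((op (-1))^[m] f) 0

lemma rs_TK0 {p m : ℕ} (h : p + m < 25) (f : ℕ → R) :
    rs (getL [] (getL [] TK0 p) m) f = cs p m f := by
  have h1 : m < Nat.sub 25 p := by rw [Nat.sub_eq]; omega
  rw [getL_eq, getL_eq, TK0, getD_tab _ _ (by omega), getD_tab _ _ h1, rs_rowPN, rs_rowPN, cast_neg1]
  simp [rs, cs]

lemma cs_succ_left (p m : ℕ) (f : ℕ → R) : cs (p + 1) m f = cs p m (op 1 f) := by
  have hc : Function.Commute (op 1) (op (-1)) := fun f => by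
    funext n; simp only [op]; ring
  rw [cs, cs, Function.iterate_succ_apply, (hc.iterate_right m).eq]

lemma cs_succ_right (p m : ℕ) (f : ℕ → R) : cs p (m + 1) f = cs p m (op (-1) f) := by
  rw [cs, cs, Function.iterate_succ_apply]

lemma op_iterate_lin (c d : R) (p : ℕ) (f g : ℕ → R) :
    (op c)^[p] (fun n => f n + d * g n) = fun n => (op c)^[p] f n + d * (op c)^[p] g n := by
  induction p generalizing f g with
  | zero => rfl
  | succ p ih =>
    have : op c (fun n => f n + d * g n) = fun n => op c f n + d * op c g n := by
      funext n; simp only [op]; ring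
    rw [Function.iterate_succ_apply, this, ih]; rfl

lemma cs_lin (d : R) (p m : ℕ) (f g : ℕ → R) :
    cs p m (fun n => f n + d * g n) = cs p m f + d * cs p m g := by
  simp only [cs, op_iterate_lin]

lemma cs_succ_left' (p m : ℕ) (f : ℕ → R) :
    cs (p + 1) m f = cs p m f + 1 * cs p m fun n => f (n + 1) :=
  (cs_succ_left p m f).trans (cs_lin 1 p m f fun n => f (n + 1))

lemma cs_succ_right' (p m : ℕ) (f : ℕ → R) :
    cs p (m + 1) f = cs p m f + -1 * cs p m fun n => f (n + 1) :=
  (cs_succ_right p m f).trans (cs_lin (-1) p m f fun n => f (n + 1))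

end Krawtchouk

section SignedSum

variable {ι : Type*} [DecidableEq ι]

lemma cell_insert {S : Finset ι} {a : ι} (ha : a ∉ S) (u v : ι → Bool) (p q : Bool) :
    cell (insert a S) u v p q = cell S u v p q + if u a = p ∧ v a = q then 1 else 0 := by
  unfold cell
  rw [filter_insert]
  split_ifs with h
  · rw [card_insert_of_notMem (by simp [ha])]
  · rfl

/-- The number of `i ∈ S` at which `(u i, v i, e i) = (p, q, r)`. -/
def cell3 (S : Finset ι) (u v e : ι → Bool) (p q r : Bool) : ℕ :=
  #{i ∈ S | u i = p ∧ v i = q ∧ e i = r}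

lemma cell3_insert {S : Finset ι} {a : ι} (ha : a ∉ S) (u v e : ι → Bool) (p q r : Bool) :
    cell3 (insert a S) u v e p q r =
      cell3 S u v e p q r + if u a = p ∧ v a = q ∧ e a = r then 1 else 0 := by
  unfold cell3
  rw [filter_insert]
  split_ifs with h
  · rw [card_insert_of_notMem (by simp [ha])]
  · rfl

/-- The sign `(-1) ^ b`. -/
def sgn (b : Bool) : ℤ := if b then -1 else 1

lemma signedSum (u v e : ι → Bool) (A : Finset ι) (F : ℕ → ℕ → ℕ → ℕ → R) :
    ∑ S ∈ A.powerset, ((∏ i ∈ S, sgn (e i) : ℤ) : R) *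
      F (cell S u v true true) (cell S u v true false) (cell S u v false true)
        (cell S u v false false) =
    cs (cell3 A u v e true true false) (cell3 A u v e true true true) fun a =>
    cs (cell3 A u v e true false false) (cell3 A u v e true false true) fun b =>
    cs (cell3 A u v e false true false) (cell3 A u v e false true true) fun c =>
    cs (cell3 A u v e false false false) (cell3 A u v e false false true) fun d => F a b c d := by
  induction A using Finset.induction_on generalizing F with
  | empty => simp [cell, cell3, cs]
  | insert x A hx ih =>
    rw [sum_powerset_insert hx]
    have h1 : ∀ S ∈ A.powerset, ((∏ i ∈ insert x S, sgn (e i) : ℤ) : R) *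
        F (cell (insert x S) u v true true) (cell (insert x S) u v true false)
          (cell (insert x S) u v false true) (cell (insert x S) u v false false) =
        ((∏ i ∈ S, sgn (e i) : ℤ) : R) * ((sgn (e x) : R) *
        F (cell S u v true true + if u x = true ∧ v x = true then 1 else 0)
          (cell S u v true false + if u x = true ∧ v x = false then 1 else 0)
          (cell S u v false true + if u x = false ∧ v x = true then 1 else 0)
          (cell S u v false false + if u x = false ∧ v x = false then 1 else 0)) := by
      intro S hS
      have hxS : x ∉ S := fun h => hx (mem_powerset.1 hS h)
      rw [prod_insert hxS]
      simp only [cell_insert hxS]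
      push_cast
      ring
    rw [sum_congr rfl h1, ← sum_add_distrib]
    simp only [← mul_add]
    rw [ih fun a b c d => F a b c d + (sgn (e x) : R) *
        F (a + if u x = true ∧ v x = true then 1 else 0)
          (b + if u x = true ∧ v x = false then 1 else 0)
          (c + if u x = false ∧ v x = true then 1 else 0)
          (d + if u x = false ∧ v x = false then 1 else 0)]
    simp only [cell3_insert hx, cs_lin]
    cases u x <;> cases v x <;> cases e x <;>
      simp only [sgn, and_self, and_true, and_false, if_true, if_false, reduceCtorEq,
        Bool.false_eq_true, cs_succ_left', cs_succ_right', cs_lin, add_zero, Int.cast_one,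
        Int.cast_neg]

end SignedSum

section Zonal

/-- Natural number version of `pairCount`. -/
def pairN (m a b : ℕ) : ℕ := m.factorial * a.choose m * b.choose m

lemma pairN_succ (m a b : ℕ) : pairN m a b * ((a - m) * (b - m)) / (m + 1) = pairN (m + 1) a b := by
  apply Nat.div_eq_of_eq_mul_left (Nat.succ_pos m)
  have h1 := Nat.choose_succ_right_eq a m
  have h2 := Nat.choose_succ_right_eq b m
  simp only [pairN, Nat.factorial_succ]
  calc _ = m.factorial * (a.choose m * (a - m)) * (b.choose m * (b - m)) := by ring
    _ = _ := by rw [← h1, ← h2, Nat.succ_eq_add_one]; ring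

lemma pairN_eq_zero_mono {m n a b : ℕ} (h : m ≤ n) (h0 : pairN m a b = 0) : pairN n a b = 0 := by
  simp only [pairN, mul_eq_zero, Nat.choose_eq_zero_iff] at h0 ⊢
  rcases h0 with (h0 | h0) | h0
  · exact absurd h0 (Nat.factorial_ne_zero m)
  · exact Or.inl (Or.inr (by omega))
  · exact Or.inr (by omega)

/-- Pure form of `seqA`. -/
def seqN (c a b : ℕ) : ℕ → ℕ → ℕ → List ℕ
  | 0, _, _ => []
  | _ + 1, _, 0 => []
  | f + 1, m, v + 1 => Nat.mod (Nat.mul (Nat.pow c m) (v + 1)) modulus ::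
      seqN c a b f (m + 1) ((v + 1) * ((a - m) * (b - m)) / (m + 1))

lemma seqA_eq {γ : Type} (c a b f m v : ℕ) (k : List ℕ → γ) :
    seqA c a b f m v k = k (seqN c a b f m v) := by
  induction f generalizing m v k with
  | zero => rfl
  | succ f ih => cases v with
    | zero => rfl
    | succ v => exact ih _ _ _

lemma seqN_cast (c a b : ℕ) {f j : ℕ} (m : ℕ) (h : j < f) :
    (((seqN c a b f m (pairN m a b)).getD j 0 : ℕ) : R) = (c : R) ^ (m + j) * pairN (m + j) a b := by
  induction f generalizing m j with
  | zero => omega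
  | succ f ih =>
    rcases h0 : pairN m a b with _ | v
    · rw [pairN_eq_zero_mono (Nat.le_add_right m j) h0]; simp [seqN]
    · rw [seqN, ← h0, pairN_succ]
      cases j with
      | zero =>
        rw [List.getD_cons_zero, cast_mod]; simp [Nat.mul_eq, Nat.pow_eq]
      | succ j =>
        rw [List.getD_cons_succ, ih (m + 1) (by omega), show m + 1 + j = m + (j + 1) by omega]

/-- The table computed by `tableA`. -/
def TA0 (c : ℕ) : List (List (List ℕ)) := tab (fun a => tab (fun b => seqN c a b 13 0 1) 25) 25

lemma tableA_eq {γ : Type} (c : ℕ) (k : List (List (List ℕ)) → γ) : tableA c k = k (TA0 c) := by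
  refine tabK_eq _ (fun a k => ?_) 25 k
  exact tabK_eq _ (fun b k => seqA_eq c a b 13 0 1 k) _ _

lemma TA0_cast (c : ℕ) {a b j : ℕ} (ha : a < 25) (hb : b < 25) (hj : j < 13) :
    (((getL [] (getL [] (TA0 c) a) b).getD j 0 : ℕ) : R) = (c : R) ^ j * pairN j a b := by
  rw [getL_eq, getL_eq, TA0, getD_tab _ _ ha, getD_tab _ _ hb]
  have h : pairN 0 a b = 1 := by simp [pairN]
  have := seqN_cast c a b 0 hj
  rwa [h, zero_add] at this

lemma conv_cast (A B x : List ℕ) : ((conv A B x : ℕ) : R) =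
    rs x fun l => ∑ y ∈ antidiagonal l, (A.getD y.1 0 : R) * (B.getD y.2 0 : R) := by
  induction A generalizing x with
  | nil =>
    rw [rs_eq_sum _ _ le_rfl]; simp [conv]
  | cons a A ih => cases x with
    | nil => simp [conv, rs]
    | cons b x =>
      have h : conv (a :: A) B (b :: x) = a * dotN B (b :: x) + conv A B x := rfl
      have h1 : rs B (fun t => ((b :: x).getD t 0 : R)) = rs (b :: x) (fun t => (B.getD t 0 : R)) := by
        rw [rs_eq_sum _ _ (le_max_left _ (b :: x).length),
          rs_eq_sum _ _ (le_max_right B.length (b :: x).length)]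
        exact sum_congr rfl fun t _ => mul_comm _ _
      rw [h, Nat.cast_add, Nat.cast_mul, ih, dotN_cast, h1, rs, rs]
      simp only [Nat.sum_antidiagonal_succ, Nat.antidiagonal_zero, sum_singleton,
        List.getD_cons_zero, List.getD_cons_succ]
      rw [rs_eq_sum x _ le_rfl, rs_eq_sum x _ le_rfl, rs_eq_sum x _ le_rfl, mul_add, mul_sum,
        add_assoc, ← sum_add_distrib]
      congr 1
      · ring
      · exact sum_congr rfl fun t _ => by ring

lemma sum_TA0_eq_zonal {l a c d b : ℕ} (hl : l < 13) (ha : a < 25) (hb : b < 25) (hc : c < 25)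
    (hd : d < 25) :
    ∑ y ∈ antidiagonal l, ((getL [] (getL [] (TA0 1) a) b).getD y.1 0 : R) *
      ((getL [] (getL [] (TA0 neg1) c) d).getD y.2 0 : R) = (zonal l a c d b : ℤ) := by
  rw [zonal]
  push_cast
  refine sum_congr rfl fun y hy => ?_
  have := mem_antidiagonal.1 hy
  rw [TA0_cast 1 ha hb (by omega), TA0_cast neg1 hc hd (by omega), cast_neg1]
  simp only [pairCount, pairN]
  push_cast
  ring

/-- Degree on the subset for the coefficient with index `g`. -/
def kE (g : ℕ) : ℕ := if g = 1 then 1 else if g = 2 then 2 else 0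

/-- The product of zonal polynomials with index `g`. -/
def zE (n11 n10 n01 n00 s11 s10 s01 s00 g : ℕ) : ℤ :=
  zonal (kE g) s11 s10 s01 s00 * zonal (g - 2) (n11 - s11) (n10 - s10) (n01 - s01) (n00 - s00)

lemma q1_cast (a c d b : ℕ) : ((q1 a c d b : ℕ) : R) = (zonal 1 a c d b : ℤ) := by
  rw [zonal_one, q1]
  simp only [Nat.add_eq, Nat.mul_eq, Nat.cast_add, Nat.cast_mul, cast_neg1]
  push_cast
  ring

lemma tri_eq (a : ℕ) : tri a = a.choose 2 := (Nat.choose_two_right a).symm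

lemma q2_cast (a c d b : ℕ) : ((q2 a c d b : ℕ) : R) = (zonal 2 a c d b : ℤ) := by
  have h : zonal 2 a c d b = 2 * (a.choose 2 * b.choose 2) - a * b * (c * d) +
      2 * (c.choose 2 * d.choose 2) := by
    simp [zonal, pairCount, Nat.antidiagonal_succ]
    ring
  rw [h, q2]
  simp only [Nat.add_eq, Nat.mul_eq, Nat.cast_add, Nat.cast_mul, cast_neg1, tri_eq]
  push_cast
  ring

lemma leaf_cast {n11 n10 n01 n00 : ℕ} (s11 s10 s01 s00 : ℕ) {e : List ℕ} (h11 : n11 < 25)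
    (h10 : n10 < 25) (h01 : n01 < 25) (h00 : n00 < 25) (he : e.length ≤ 15) :
    ((leaf (TA0 1) (TA0 neg1) n11 n10 n01 n00 s11 s10 s01 s00 e : ℕ) : R) =
      rs e fun g => (zE n11 n10 n01 n00 s11 s10 s01 s00 g : ℤ) := by
  have z0 : zE n11 n10 n01 n00 s11 s10 s01 s00 0 = 1 := by simp [zE, kE]
  have z1 : zE n11 n10 n01 n00 s11 s10 s01 s00 1 = zonal 1 s11 s10 s01 s00 := by simp [zE, kE]
  have z2 : zE n11 n10 n01 n00 s11 s10 s01 s00 2 = zonal 2 s11 s10 s01 s00 := by simp [zE, kE]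
  have z3 : ∀ l, zE n11 n10 n01 n00 s11 s10 s01 s00 (l + 3) = zonal (l + 1)
      (n11 - s11) (n10 - s10) (n01 - s01) (n00 - s00) := fun l => by simp [zE, kE]
  rcases e with _ | ⟨x0, _ | ⟨x1, _ | ⟨x2, _ | ⟨x3, _ | ⟨x4, t⟩⟩⟩⟩⟩
  · simp [leaf, rs]
  · simp [leaf, rs, z0]
  · simp [leaf, rs, z0, z1, q1_cast]
  · simp [leaf, rs, z0, z1, z2, q1_cast, q2_cast]
  · simp [leaf, rs, z0, z1, z2, z3 0, q1_cast, q2_cast]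
  · have h : leaf (TA0 1) (TA0 neg1) n11 n10 n01 n00 s11 s10 s01 s00
        (x0 :: x1 :: x2 :: x3 :: x4 :: t) = x0 + (x1 * q1 s11 s10 s01 s00 +
          (x2 * q2 s11 s10 s01 s00 +
          (x3 * q1 (n11 - s11) (n10 - s10) (n01 - s01) (n00 - s00) +
            conv (getL [] (getL [] (TA0 1) (n11 - s11)) (n00 - s00))
              (getL [] (getL [] (TA0 neg1) (n10 - s10)) (n01 - s01)) (0 :: 0 :: x4 :: t)))) := rfl
    rw [h]
    simp only [Nat.cast_add, Nat.cast_mul, q1_cast, q2_cast, conv_cast]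
    have h2 : ∀ f : ℕ → R, rs (0 :: 0 :: x4 :: t) f = rs (x4 :: t) fun l => f (l + 2) := by
      intro f; simp [rs]
    have h3 : ∀ f : ℕ → R, rs (x0 :: x1 :: x2 :: x3 :: x4 :: t) f =
        x0 * f 0 + (x1 * f 1 + (x2 * f 2 + (x3 * f 3 + rs (x4 :: t) fun l => f (l + 4)))) := by
      intro f; simp [rs]
    have h4 : rs (x4 :: t) (fun l => ((zE n11 n10 n01 n00 s11 s10 s01 s00 (l + 4) : ℤ) : R)) =
        rs (x4 :: t) fun l => ∑ y ∈ antidiagonal (l + 2),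
          ((getL [] (getL [] (TA0 1) (n11 - s11)) (n00 - s00)).getD y.1 0 : R) *
          ((getL [] (getL [] (TA0 neg1) (n10 - s10)) (n01 - s01)).getD y.2 0 : R) := by
      refine rs_congr fun l hl => ?_
      simp only [List.length_cons] at he hl
      rw [z3 (l + 1), sum_TA0_eq_zonal (by omega) (by omega) (by omega) (by omega) (by omega)]
    rw [h2, h3, h4, z0, z1, z2, z3 0]
    simp

end Zonal

section EvalE

lemma rs_zero (l : List ℕ) : rs l (fun _ => 0) = 0 := by
  rw [rs_eq_sum _ _ le_rfl]; simp

lemma sumZ_cast {β : Type} (h : ℕ → β → R) (d : β) {f : ℕ → ℕ → β → ℕ}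
    (hf : ∀ i k x, (f i k x : R) = k * h i x) (h0 : ∀ i, h i d = 0) (K : List ℕ) (L : List β)
    (i : ℕ) : ((sumZ f K L i : ℕ) : R) = rs K fun j => h (i + j) (L.getD j d) := by
  induction K generalizing L i with
  | nil => simp [sumZ, rs]
  | cons k K ih => cases L with
    | nil =>
      simp only [getD_nil', h0, rs_zero]
      exact Nat.cast_zero
    | cons x L =>
      have h1 : sumZ f (k :: K) (x :: L) i = f i k x + sumZ f K L (i + 1) := rfl
      rw [h1, Nat.cast_add, hf, ih, rs]
      simp only [List.getD_cons_zero, List.getD_cons_succ, add_zero]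
      congr 2
      funext j
      rw [show i + 1 + j = i + (j + 1) by omega]

lemma sumZ_self_cast (h : ℕ → R) {f : ℕ → ℕ → ℕ → ℕ} (hf : ∀ i k x, (f i k x : R) = k * h i)
    (K : List ℕ) (i : ℕ) : ((sumZ f K K i : ℕ) : R) = rs K fun j => h (i + j) := by
  induction K generalizing i with
  | nil => simp [sumZ, rs]
  | cons k K ih =>
    have h1 : sumZ f (k :: K) (k :: K) i = f i k k + sumZ f K K (i + 1) := rfl
    rw [h1, Nat.cast_add, hf, ih, rs, add_zero]
    congr 2
    funext j
    rw [show i + 1 + j = i + (j + 1) by omega]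

lemma getD_dropL {α : Type} (l : List α) (m j : ℕ) (d : α) :
    (dropL m l).getD j d = l.getD (m + j) d := by
  rw [dropL_eq, List.getD_eq_getElem?_getD, List.getElem?_drop, ← List.getD_eq_getElem?_getD]

variable (TA TB : List (List (List ℕ))) (n11 n10 n01 n00 : ℕ)

lemma sumE00_cast (K00 : List ℕ) (s11 s10 s01 : ℕ) (e : List (List ℕ)) :
    ((sumE00 TA TB n11 n10 n01 n00 K00 s11 s10 s01 e : ℕ) : R) = rs K00 fun s00 =>
      (leaf TA TB n11 n10 n01 n00 s11 s10 s01 s00 (e.getD (s11 + (s10 + s01) + s00) []) : R) := by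
  refine (sumZ_cast (fun s00 e => (leaf TA TB n11 n10 n01 n00 s11 s10 s01 s00 e : R)) []
    (fun i k x => by rw [Nat.mul_eq, Nat.cast_mul]) (fun i => Nat.cast_zero) _ _ _).trans ?_
  simp only [getD_dropL, zero_add, Nat.add_eq]

lemma sumE01_cast (K01 K00 : List ℕ) (s11 s10 : ℕ) (r : List (List (List ℕ))) :
    ((sumE01 TA TB n11 n10 n01 n00 K01 K00 s11 s10 r : ℕ) : R) = rs K01 fun s01 => rs K00 fun s00 =>
      (leaf TA TB n11 n10 n01 n00 s11 s10 s01 s00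
        ((r.getD (s11 + s01) []).getD (s11 + (s10 + s01) + s00) []) : R) := by
  refine (sumZ_cast (fun s01 e => (sumE00 TA TB n11 n10 n01 n00 K00 s11 s10 s01 e : R)) []
    (fun i k x => by rw [Nat.mul_eq, Nat.cast_mul]) (fun i => ?_) _ _ _).trans ?_
  · rw [sumE00_cast]; simp only [getD_nil']
    exact (rs_congr fun _ _ => Nat.cast_zero).trans (rs_zero _)
  · simp only [getD_dropL, zero_add, sumE00_cast]

lemma sumE10_cast (K10 K01 K00 : List ℕ) (s11 : ℕ) (X : List (List (List (List ℕ)))) :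
    ((sumE10 TA TB n11 n10 n01 n00 K10 K01 K00 s11 X : ℕ) : R) =
      rs K10 fun s10 => rs K01 fun s01 => rs K00 fun s00 =>
      (leaf TA TB n11 n10 n01 n00 s11 s10 s01 s00
        (((X.getD (s11 + s10) []).getD (s11 + s01) []).getD (s11 + (s10 + s01) + s00) []) : R) := by
  refine (sumZ_cast (fun s10 r => (sumE01 TA TB n11 n10 n01 n00 K01 K00 s11 s10 r : R)) []
    (fun i k x => by rw [Nat.mul_eq, Nat.cast_mul, cast_mod]) (fun i => ?_) _ _ _).trans ?_
  · rw [sumE01_cast]; simp only [getD_nil']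
    refine (rs_congr fun _ _ => ?_).trans (rs_zero _)
    exact (rs_congr fun _ _ => Nat.cast_zero).trans (rs_zero _)
  · simp only [getD_dropL, zero_add, sumE01_cast]

lemma sumE11_cast (K11 K10 K01 K00 : List ℕ) (X : List (List (List (List ℕ)))) :
    ((sumE11 TA TB n11 n10 n01 n00 K11 K10 K01 K00 X : ℕ) : R) =
      rs K11 fun s11 => rs K10 fun s10 => rs K01 fun s01 => rs K00 fun s00 =>
      (leaf TA TB n11 n10 n01 n00 s11 s10 s01 s00
        (((X.getD (s11 + s10) []).getD (s11 + s01) []).getD (s11 + (s10 + s01) + s00) []) : R) := by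
  refine (sumZ_self_cast (fun s11 => (sumE10 TA TB n11 n10 n01 n00 K10 K01 K00 s11 X : R))
    (fun i k x => by rw [Nat.mul_eq, Nat.cast_mul]) _ _).trans ?_
  simp only [zero_add, sumE10_cast]

/-- The kernel as a function of cell sizes. -/
def FE (n11 n10 n01 n00 s11 s10 s01 s00 : ℕ) : ℤ :=
  ∑ g ∈ range 15, dotZ (rowZ 36 (numE (idx (n11 + n10)) (s11 + s10) (s11 + (s10 + s01) + s00) g))
    (rowZ 36 (numE (idx (n11 + n01)) (s11 + s01) (s11 + (s10 + s01) + s00) g)) *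
    zE n11 n10 n01 n00 s11 s10 s01 s00 g

lemma evalE_cast {p11 m11 p10 m10 p01 m01 p00 m00 : ℕ} (h11 : p11 + m11 < 25)
    (h10 : p10 + m10 < 25) (h01 : p01 + m01 < 25) (h00 : p00 + m00 < 25) :
    ((evalE TE0 TK0 (TA0 1) (TA0 neg1) p11 m11 p10 m10 p01 m01 p00 m00 : ℕ) : R) =
      cs p11 m11 fun s11 => cs p10 m10 fun s10 => cs p01 m01 fun s01 => cs p00 m00 fun s00 =>
      (FE (p11 + m11) (p10 + m10) (p01 + m01) (p00 + m00) s11 s10 s01 s00 : R) := by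
  simp only [← rs_TK0 h11, ← rs_TK0 h10, ← rs_TK0 h01, ← rs_TK0 h00]
  refine (sumE11_cast (TA0 1) (TA0 neg1) (p11 + m11) (p10 + m10) (p01 + m01) (p00 + m00)
    _ _ _ _ _).trans ?_
  refine rs_congr fun s11 _ => rs_congr fun s10 _ => rs_congr fun s01 _ => rs_congr fun s00 _ => ?_
  simp only [getL_eq, Nat.add_eq]
  have := length_entE (idx (p11 + m11 + (p10 + m10))) (idx (p11 + m11 + (p01 + m01)))
    (s11 + s10) (s11 + s01) (s11 + (s10 + s01) + s00)
  refine (leaf_cast s11 s10 s01 s00 h11 h10 h01 h00 this).trans ?_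
  rw [rs_eq_sum _ _ this, FE, Int.cast_sum]
  refine sum_congr rfl fun g _ => ?_
  rw [entE_cast, Int.cast_mul]

end EvalE

section EvalD

/-- The table computed by `rowsD`. -/
def TD0 : List (List (List (List ℕ))) :=
  dataD.map fun l => l.map fun l => l.map fun n => rowN 24 n

lemma rowsD_eq {γ : Type} (k : List (List (List (List ℕ))) → γ) : rowsD k = k TD0 :=
  mapK_eq _ (mapK_eq _ (mapK_eq _ (rowK_eq 24))) _ _

/-- The code number of the row with the given labels. -/
def numD (i j kl : ℕ) : ℕ := ((dataD.getD i []).getD j []).getD kl 0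

lemma length_dataD_le : ∀ x ∈ dataD, ∀ y ∈ x, y.length ≤ 16 := by
  decide +kernel

lemma getD_nil_or_mem {α : Type} (l : List (List α)) (n : ℕ) : l.getD n [] = [] ∨ l.getD n [] ∈ l := by
  rcases lt_or_ge n l.length with h | h
  · right; rw [List.getD_eq_getElem _ _ h]; exact List.getElem_mem h
  · left; exact List.getD_eq_default _ _ h

lemma TD0_getD (i j : ℕ) : (TD0.getD i []).getD j [] =
    ((dataD.getD i []).getD j []).map (rowN 24) := by
  rw [TD0, getD_map_of_eq _ (List.map_nil), getD_map_of_eq _ (List.map_nil)]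

lemma length_TD0 (i j : ℕ) : ((TD0.getD i []).getD j []).length ≤ 16 := by
  rw [TD0_getD, List.length_map]
  rcases getD_nil_or_mem dataD i with h | h
  · rw [h]; simp
  rcases getD_nil_or_mem (dataD.getD i []) j with h' | h'
  · rw [h']; simp
  exact length_dataD_le _ h _ h'

lemma TD0_getD_getD (i j kl : ℕ) : ((TD0.getD i []).getD j []).getD kl [] =
    rowN 24 (numD i j kl) := by
  have h0 : rowN 24 0 = [] := rfl
  rw [TD0_getD, getD_map_of_eq _ h0]; rfl

lemma sumZ_eq_sum {α β : Type} {f : ℕ → α → β → ℕ} (a : α) (b : β) (ha : ∀ i y, f i a y = 0)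
    (hb : ∀ i x, f i x b = 0) {n : ℕ} (l : List α) (l' : List β) (i : ℕ) (h : l.length ≤ n) :
    sumZ f l l' i = ∑ j ∈ range n, f (i + j) (l.getD j a) (l'.getD j b) := by
  induction l generalizing l' i n with
  | nil => simp [sumZ, ha]
  | cons x l ih => cases l' with
    | nil => simp only [getD_nil', hb, sum_const_zero]; rfl
    | cons y l' =>
      obtain ⟨n, rfl⟩ : ∃ m, n = m + 1 := ⟨n - 1, by simp at h; omega⟩
      have h1 : sumZ f (x :: l) (y :: l') i = f i x y + sumZ f l l' (i + 1) := rfl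
      rw [h1, ih l' (i + 1) (by simpa using h), sum_range_succ', add_comm]
      simp only [List.getD_cons_zero, List.getD_cons_succ, add_zero]
      congr 1
      exact sum_congr rfl fun j _ => by rw [show i + 1 + j = i + (j + 1) by omega]

lemma getL_qlist_cast {a c d b k : ℕ} (ha : a < 25) (hb : b < 25) (hc : c < 25) (hd : d < 25)
    (hk : k < 4) :
    ((getL 0 ((qlist (getL [] (getL [] (TA0 1) a) b) (getL [] (getL [] (TA0 neg1) c) d)).map
      fun n => Nat.mod n modulus) k : ℕ) : R) = (zonal k a c d b : ℤ) := by
  have hA : ((getL [] (getL [] (TA0 1) a) b).getD 0 0 : R) = 1 := by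
    rw [TA0_cast 1 ha hb (by omega)]; simp [pairN]
  have hB : ((getL [] (getL [] (TA0 neg1) c) d).getD 0 0 : R) = 1 := by
    rw [TA0_cast neg1 hc hd (by omega)]; simp [pairN]
  rw [← sum_TA0_eq_zonal (by omega) ha hb hc hd, getL_eq,
    getD_map_of_eq (fun n => Nat.mod n modulus) (Nat.zero_mod modulus), cast_mod]
  generalize getL [] (getL [] (TA0 1) a) b = A at *
  generalize getL [] (getL [] (TA0 neg1) c) d = B at *
  interval_cases k <;>
    simp only [qlist, getL_eq, List.getD_cons_zero, List.getD_cons_succ, Nat.antidiagonal_succ,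
      Nat.antidiagonal_zero, sum_cons, map_singleton, sum_singleton, map_cons,
      Function.Embedding.prodMap, Function.Embedding.coeFn_mk, Prod.map_fst, Prod.map_snd,
      Function.Embedding.refl_apply, hA, hB, Nat.add_eq, Nat.mul_eq, Nat.cast_add, Nat.cast_mul,
      Nat.cast_one, Nat.succ_eq_add_one, zero_add, mul_one, one_mul] <;> ring

/-- The kernel for pairs of words at distance 12 as a function of cell sizes. -/
def FD (n111 n110 n101 n100 n011 n010 n001 n000 : ℕ) : ℤ :=
  if n111 + n110 + (n101 + n100) = 12 then
    ∑ kl ∈ range 16, zonal (kl / 4) n111 n110 n101 n100 * zonal (kl % 4) n011 n010 n001 n000 *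
      dotZ (rowZ 24 (numD (n111 + n110) (n011 + n010) kl))
        (rowZ 24 (numD (n111 + n101) (n011 + n001) kl))
  else 0

lemma evalD_cast {n111 n110 n101 n100 n011 n010 n001 n000 : ℕ} (h111 : n111 < 25)
    (h110 : n110 < 25) (h101 : n101 < 25) (h100 : n100 < 25) (h011 : n011 < 25) (h010 : n010 < 25)
    (h001 : n001 < 25) (h000 : n000 < 25) :
    ((evalD TD0 (TA0 1) (TA0 neg1) n111 n110 n101 n100 n011 n010 n001 n000 : ℕ) : R) =
      (FD n111 n110 n101 n100 n011 n010 n001 n000 : ℤ) := by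
  have h : evalD TD0 (TA0 1) (TA0 neg1) n111 n110 n101 n100 n011 n010 n001 n000 =
      @Bool.rec (fun _ => ℕ) 0
      (sumZ (fun kl u v => Nat.mul (Nat.mul
        (getL 0 ((qlist (getL [] (getL [] (TA0 1) n111) n100)
          (getL [] (getL [] (TA0 neg1) n110) n101)).map fun n => Nat.mod n modulus) (kl / 4))
        (getL 0 ((qlist (getL [] (getL [] (TA0 1) n011) n000)
          (getL [] (getL [] (TA0 neg1) n010) n001)).map fun n => Nat.mod n modulus) (kl % 4)))
        (dotN u v)) (getL [] (getL [] TD0 (n111 + n110)) (n011 + n010))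
          (getL [] (getL [] TD0 (n111 + n101)) (n011 + n001)) 0)
      (Nat.beq (n111 + n110 + (n101 + n100)) 12) := rfl
  rw [h, FD]
  rcases eq_or_ne (n111 + n110 + (n101 + n100)) 12 with h12 | h12
  · rw [if_pos h12, h12]
    refine (congrArg Nat.cast (sumZ_eq_sum (n := 16) [] [] (fun i y => by rfl)
      (fun i x => by cases x <;> rfl) _ _ _ ?_)).trans ?_
    · rw [getL_eq, getL_eq]; exact length_TD0 _ _
    · rw [Nat.cast_sum, Int.cast_sum]
      refine sum_congr rfl fun kl hkl => ?_
      have hkl' : kl < 16 := mem_range.1 hkl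
      simp only [Nat.mul_eq, Nat.cast_mul, Int.cast_mul, zero_add]
      rw [getL_qlist_cast h111 h100 h110 h101 (by omega),
        getL_qlist_cast h011 h000 h010 h001 (by omega)]
      simp only [getL_eq, TD0_getD_getD, dotN_rowN]
  · rw [if_neg h12, Int.cast_zero]
    have : Nat.beq (n111 + n110 + (n101 + n100)) 12 = false := by
      rw [← Bool.not_eq_true, Nat.beq_eq]; exact h12
    rw [this]; exact Nat.cast_zero

end EvalD

section Kernels

/-- Binary words of length 24. -/
abbrev Word : Type := Fin 24 → Bool

/-- Coordinatewise sum of two words. -/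
def xr (x y : Word) : Word := fun i => xor (x i) (y i)

lemma xr_comm (x y : Word) : xr x y = xr y x := funext fun _ => Bool.xor_comm _ _

/-- The number of ones of `u` on `S`. -/
def wt (S : Finset (Fin 24)) (u : Word) : ℕ := #{i ∈ S | u i = true}

/-- The character of `S`. -/
def chi (S : Finset (Fin 24)) (x : Word) : ℤ := ∏ i ∈ S, sgn (x i)

lemma sgn_xor (a b : Bool) : sgn (xor a b) = sgn a * sgn b := by cases a <;> cases b <;> rfl

lemma chi_xr (S : Finset (Fin 24)) (x y : Word) : chi S (xr x y) = chi S x * chi S y := by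
  simp only [chi, xr, sgn_xor, prod_mul_distrib]

lemma chi_eq_pow (S : Finset (Fin 24)) (x : Word) : chi S x = (-1) ^ wt S x := by
  simp only [chi, sgn, wt, prod_ite, prod_const, one_pow, mul_one]

/-- The rows attached to a subset and a word. -/
def rowOfE (S : Finset (Fin 24)) (u : Word) (g : ℕ) : List ℤ :=
  rowZ 36 (numE (idx (wt univ u)) (wt S u) #S g)

/-- The positive semidefinite kernel attached to a subset. -/
def PhiE (S : Finset (Fin 24)) (u v : Word) : ℤ :=
  ∑ g ∈ range 15, zonalOn (kE g) S u v * (zonalOn (g - 2) Sᶜ u v *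
    dotZ (rowOfE S u g) (rowOfE S v g))

/-- The kernel on pairs of words built from characters. -/
def E (x y z w : Word) : ℤ := ∑ S : Finset (Fin 24), chi S (xr x z) * PhiE S (xr x y) (xr z w)

/-- The rows attached to a word and a subset of size 12. -/
def rowOfD (T : Finset (Fin 24)) (u : Word) (kl : ℕ) : List ℤ :=
  rowZ 24 (numD (wt T u) (wt Tᶜ u) kl)

/-- The kernel attached to a subset of size 12. -/
def PhiD (T : Finset (Fin 24)) (u v : Word) : ℤ :=
  ∑ kl ∈ range 16, zonalOn (kl / 4) T u v * (zonalOn (kl % 4) Tᶜ u v *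
    dotZ (rowOfD T u kl) (rowOfD T v kl))

/-- The kernel based at a pair of words at distance 12. -/
def D (x y z w : Word) : ℤ :=
  if wt univ (xr x y) = 12 then PhiD {i | xr x y i = true} (xr x z) (xr x w) else 0

lemma PSDOn.dotZ {α : Type*} (P : Finset α) (r : α → List ℤ) :
    PSDOn P fun p q => dotZ (r p) (r q) :=
  PSDOn.sum fun t _ => PSDOn.mul_self P fun p => (r p).getD t 0

lemma PhiE_psd {α : Type*} (P : Finset α) (S : Finset (Fin 24)) (u : α → Word) :
    PSDOn P fun p q => PhiE S (u p) (u q) :=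
  PSDOn.sum fun g _ => PSDOn.zonalOn_mul u (kE g) S (PSDOn.zonalOn_mul u (g - 2) Sᶜ
    (PSDOn.dotZ P fun p => rowOfE S (u p) g))

lemma PhiD_psd {α : Type*} (P : Finset α) (T : Finset (Fin 24)) (u : α → Word) :
    PSDOn P fun p q => PhiD T (u p) (u q) :=
  PSDOn.sum fun kl _ => PSDOn.zonalOn_mul u (kl / 4) T (PSDOn.zonalOn_mul u (kl % 4) Tᶜ
    (PSDOn.dotZ P fun p => rowOfD T (u p) kl))

lemma sum_E_nonneg (C : Finset Word) : 0 ≤ ∑ x ∈ C, ∑ y ∈ C, ∑ z ∈ C, ∑ w ∈ C, E x y z w := by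
  have h1 : ∑ x ∈ C, ∑ y ∈ C, ∑ z ∈ C, ∑ w ∈ C, E x y z w =
      ∑ S : Finset (Fin 24), ∑ p ∈ C ×ˢ C, ∑ q ∈ C ×ˢ C,
        chi S p.1 * chi S q.1 * PhiE S (xr p.1 p.2) (xr q.1 q.2) := by
    symm
    simp only [sum_product, E, chi_xr]
    rw [sum_comm]
    refine sum_congr rfl fun x _ => ?_
    rw [sum_comm]
    refine sum_congr rfl fun y _ => ?_
    rw [sum_comm]
    refine sum_congr rfl fun z _ => ?_
    exact sum_comm
  rw [h1]
  exact sum_nonneg fun S _ =>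
    PhiE_psd (C ×ˢ C) S (fun p : Word × Word => xr p.1 p.2) fun p => chi S p.1

lemma sum_D_nonneg (C : Finset Word) : 0 ≤ ∑ x ∈ C, ∑ y ∈ C, ∑ z ∈ C, ∑ w ∈ C, D x y z w := by
  refine sum_nonneg fun x _ => sum_nonneg fun y _ => ?_
  unfold D
  split_ifs
  · have := PhiD_psd C {i | xr x y i = true} (fun z => xr x z) fun _ => 1
    simpa only [one_mul] using this
  · simp

lemma pairCount_comm (m a b : ℕ) : pairCount m a b = pairCount m b a := by
  simp only [pairCount]; push_cast; ring

lemma cell_comm {S : Finset (Fin 24)} (u v : Word) (p q : Bool) : cell S u v p q = cell S v u q p := by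
  simp only [cell, and_comm]

lemma zonalOn_comm (k : ℕ) (S : Finset (Fin 24)) (u v : Word) : zonalOn k S u v = zonalOn k S v u := by
  rw [zonalOn, zonalOn, cell_comm u v true false, cell_comm u v false true, cell_comm u v true true,
    cell_comm u v false false]
  simp only [zonal]
  exact sum_congr rfl fun x _ => by rw [pairCount_comm x.2]

lemma dotZ_comm (u v : List ℤ) : dotZ u v = dotZ v u := sum_congr rfl fun _ _ => mul_comm _ _

lemma PhiE_comm (S : Finset (Fin 24)) (u v : Word) : PhiE S u v = PhiE S v u :=
  sum_congr rfl fun g _ => by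
    rw [zonalOn_comm, zonalOn_comm (g - 2), dotZ_comm]

lemma PhiD_comm (S : Finset (Fin 24)) (u v : Word) : PhiD S u v = PhiD S v u :=
  sum_congr rfl fun kl _ => by
    rw [zonalOn_comm, zonalOn_comm (kl % 4), dotZ_comm]

lemma D_comm (x y z w : Word) : D x y z w = D x y w z := by
  rw [D, D, PhiD_comm]

lemma E_comm (x y z w : Word) : E x y z w = E z w x y :=
  sum_congr rfl fun S _ => by rw [xr_comm x z, PhiE_comm]

lemma wt_le (S : Finset (Fin 24)) (u : Word) : wt S u ≤ 24 :=
  (card_le_univ _).trans (by simp)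

lemma rowOfE_of_odd {S : Finset (Fin 24)} {u : Word} (h : wt S u % 2 = 1) (g : ℕ) :
    rowOfE S u g = [] := by
  have h1 : (dataE.getD (idx (wt univ u)) []).getD (wt S u) [] = [] := by
    rcases getD_nil_or_mem dataE (idx (wt univ u)) with h' | h'
    · rw [h']; rfl
    · exact dataE_odd _ h' _ (by have := wt_le S u; omega) h
  rw [rowOfE, numE, h1]; simp only [getD_nil']; rfl

lemma E_swap (x y z w : Word) : E y x z w = E x y z w := by
  refine sum_congr rfl fun S _ => ?_
  rw [xr_comm y x]
  rcases Nat.mod_two_eq_zero_or_one (wt S (xr x y)) with h | h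
  · have h1 : chi S x * chi S y = 1 := by
      rw [← chi_xr, chi_eq_pow, Even.neg_one_pow (Nat.even_iff.2 h)]
    have h2 : chi S x * chi S x = 1 := by
      rw [chi_eq_pow, ← mul_pow]; simp
    rw [chi_xr, chi_xr]
    have h3 : chi S y = chi S x := by
      calc chi S y = chi S x * chi S x * chi S y := by rw [h2, one_mul]
        _ = chi S x * (chi S x * chi S y) := by ring
        _ = chi S x := by rw [h1, mul_one]
    rw [h3]
  · have : PhiE S (xr x y) (xr z w) = 0 :=
      sum_eq_zero fun g _ => by rw [rowOfE_of_odd h]; simp [dotZ]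
    rw [this, mul_zero, mul_zero]

/-- The symmetrized kernel. -/
def G (a b c d : Word) : ℤ :=
  (E a b c d + (E a c b d + E a d b c)) +
  ((((D a b c d + D b a c d) + (D a c b d + D c a b d)) + (D a d b c + D d a b c)) +
  (((D b c a d + D c b a d) + (D b d a c + D d b a c)) + (D c d a b + D d c a b)))

lemma G_swap01 (a b c d : Word) : G b a c d = G a b c d := by
  simp only [G]
  rw [E_swap a b, E_comm b c, E_comm b d, D_comm c d b, D_comm d c b]
  ring

lemma G_swap12 (a b c d : Word) : G a c b d = G a b c d := by
  simp only [G]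
  rw [E_comm a d c b, E_swap b c, ← E_comm a d b c, D_comm a d c, D_comm d a c]
  ring

lemma G_swap23 (a b c d : Word) : G a b d c = G a b c d := by
  simp only [G]
  rw [E_comm a b d c, E_swap c d, E_comm c d, D_comm a b d, D_comm b a d]
  ring

/-- The sum over all quadruples from `C`. -/
def quadSum (C : Finset Word) (f : Word → Word → Word → Word → ℤ) : ℤ :=
  ∑ x ∈ C, ∑ y ∈ C, ∑ z ∈ C, ∑ w ∈ C, f x y z w

lemma quadSum_swap01 {C : Finset Word} {f : Word → Word → Word → Word → ℤ}
    (h : 0 ≤ quadSum C f) : 0 ≤ quadSum C fun a b c d => f b a c d := by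
  rw [quadSum] at h ⊢; rwa [sum_comm]

lemma quadSum_swap12 {C : Finset Word} {f : Word → Word → Word → Word → ℤ}
    (h : 0 ≤ quadSum C f) : 0 ≤ quadSum C fun a b c d => f a c b d := by
  rw [quadSum] at h ⊢; rwa [sum_congr rfl fun x _ => sum_comm]

lemma quadSum_swap23 {C : Finset Word} {f : Word → Word → Word → Word → ℤ}
    (h : 0 ≤ quadSum C f) : 0 ≤ quadSum C fun a b c d => f a b d c := by
  rw [quadSum] at h ⊢; rwa [sum_congr rfl fun x _ => sum_congr rfl fun y _ => sum_comm]

lemma quadSum_add {C : Finset Word} (f g : Word → Word → Word → Word → ℤ) :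
    quadSum C (fun a b c d => f a b c d + g a b c d) = quadSum C f + quadSum C g := by
  simp only [quadSum, sum_add_distrib]

lemma quadSum_G_nonneg (C : Finset Word) : 0 ≤ quadSum C G := by
  have e0 : 0 ≤ quadSum C E := sum_E_nonneg C
  have e1 := quadSum_swap12 e0
  have e2 := quadSum_swap23 e1
  have d0 : 0 ≤ quadSum C D := sum_D_nonneg C
  have d1 := quadSum_swap01 d0
  have d2 := quadSum_swap12 d0
  have d3 := quadSum_swap12 d1
  have d4 := quadSum_swap23 d2
  have d5 := quadSum_swap23 d3
  have d6 := quadSum_swap01 d2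
  have d7 := quadSum_swap01 d3
  have d8 := quadSum_swap01 d4
  have d9 := quadSum_swap01 d5
  have d10 := quadSum_swap12 d8
  have d11 := quadSum_swap12 d9
  unfold G
  simp only [quadSum_add]
  exact add_nonneg (add_nonneg e0 (add_nonneg e1 e2)) (add_nonneg (add_nonneg (add_nonneg
    (add_nonneg d0 d1) (add_nonneg d2 d3)) (add_nonneg d4 d5)) (add_nonneg (add_nonneg
    (add_nonneg d6 d7) (add_nonneg d8 d9)) (add_nonneg d10 d11)))

end Kernels

section Casts

lemma cell_add_cell (S : Finset (Fin 24)) (u v : Word) :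
    cell S u v true true + cell S u v true false = wt S u := by
  rw [cell, cell, wt, ← card_filter_add_card_filter_not (s := {i ∈ S | u i = true})
    (fun i => v i = true), filter_filter, filter_filter]
  simp

lemma cell_add_cell' (S : Finset (Fin 24)) (u v : Word) :
    cell S u v true true + cell S u v false true = wt S v := by
  rw [← cell_add_cell S v u, cell_comm u v true true, cell_comm u v false true]

lemma cell_add_cell_false (S : Finset (Fin 24)) (u v : Word) :
    cell S u v false true + cell S u v false false = #S - wt S u := by
  have h := card_filter_add_card_filter_not (s := S) (fun i => u i = true)
  have h' := card_filter_add_card_filter_not (s := {i ∈ S | ¬ u i = true}) (fun i => v i = true)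
  rw [filter_filter, filter_filter] at h'
  simp only [Bool.not_eq_true] at h h'
  simp only [cell, wt]
  omega

lemma wt_le_card (S : Finset (Fin 24)) (u : Word) : wt S u ≤ #S := card_filter_le _ _

lemma sum_cells (S : Finset (Fin 24)) (u v : Word) :
    cell S u v true true + (cell S u v true false + cell S u v false true) +
      cell S u v false false = #S := by
  have h1 := cell_add_cell S u v
  have h2 := cell_add_cell_false S u v
  have h3 := wt_le_card S u
  omega

lemma cell_compl (S : Finset (Fin 24)) (u v : Word) (p q : Bool) :
    cell Sᶜ u v p q = cell univ u v p q - cell S u v p q := by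
  have : cell S u v p q + cell Sᶜ u v p q = cell univ u v p q := by
    simp only [cell]
    rw [← card_union_of_disjoint (disjoint_filter_filter disjoint_compl_right),
      ← filter_union, union_compl]
  omega

lemma PhiE_eq (S : Finset (Fin 24)) (u v : Word) : PhiE S u v =
    FE (cell univ u v true true) (cell univ u v true false) (cell univ u v false true)
      (cell univ u v false false) (cell S u v true true) (cell S u v true false)
      (cell S u v false true) (cell S u v false false) := by
  rw [PhiE, FE]
  refine sum_congr rfl fun g _ => ?_
  rw [rowOfE, rowOfE, zE, cell_add_cell, cell_add_cell, cell_add_cell', cell_add_cell', sum_cells,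
    zonalOn, zonalOn]
  simp only [cell_compl]
  ring

lemma cell3_add (u v e : Word) (p q : Bool) :
    cell3 univ u v e p q false + cell3 univ u v e p q true = cell univ u v p q := by
  rw [cell3, cell3, cell, ← card_filter_add_card_filter_not (s := {i | u i = p ∧ v i = q})
    (fun i => e i = false), filter_filter, filter_filter]
  simp [and_assoc]

lemma cell3_lt (u v e : Word) (p q r : Bool) : cell3 univ u v e p q r < 25 :=
  Nat.lt_succ_of_le ((card_le_univ _).trans (by simp))

lemma cell_lt (S : Finset (Fin 24)) (u v : Word) (p q : Bool) : cell S u v p q < 25 :=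
  Nat.lt_succ_of_le ((card_le_univ _).trans (by simp))

/-- The number of coordinates with prescribed differences to the first word. -/
def cnt (a b c d : Word) (p q r : Bool) : ℕ := cell3 univ (xr a b) (xr a c) (xr a d) p q r

lemma evalE_eq (a b c d x y z w : Word) (f g h : Bool → Bool → Bool → Bool)
    (H : ∀ i p q r, (xr x y i = p ∧ xr z w i = q ∧ xr x z i = r) ↔
      (xr a b i = f p q r ∧ xr a c i = g p q r ∧ xr a d i = h p q r)) :
    let t (p q r) := cnt a b c d (f p q r) (g p q r) (h p q r)
    ((evalE TE0 TK0 (TA0 1) (TA0 neg1) (t true true false) (t true true true) (t true false false)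
      (t true false true) (t false true false) (t false true true) (t false false false)
      (t false false true) : ℕ) : R) = E x y z w := by
  intro t
  have ht : ∀ p q r, t p q r = cell3 univ (xr x y) (xr z w) (xr x z) p q r := fun p q r => by
    simp only [t, cnt, cell3, H]
  simp only [ht]
  rw [evalE_cast, E, Int.cast_sum]
  · simp only [cell3_add]
    rw [← signedSum, powerset_univ]
    refine sum_congr rfl fun S _ => ?_
    rw [PhiE_eq, Int.cast_mul]; rfl
  all_goals rw [cell3_add]; exact cell_lt _ _ _ _ _

lemma cell_eq_cell3 (T : Finset (Fin 24)) (s u v : Word) (p q r : Bool)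
    (h : ∀ i, i ∈ T ↔ s i = p) : cell T u v q r = cell3 univ s u v p q r := by
  rw [cell, cell3]
  congr 1
  ext i
  simp [h]

lemma D_eq (x y z w : Word) :
    let t := cell3 univ (xr x y) (xr x z) (xr x w)
    D x y z w = FD (t true true true) (t true true false) (t true false true) (t true false false)
      (t false true true) (t false true false) (t false false true) (t false false false) := by
  intro t
  have h1 : ∀ q r, t true q r = cell {i | xr x y i = true} (xr x z) (xr x w) q r := fun q r =>
    (cell_eq_cell3 _ _ _ _ _ _ _ (by simp)).symm
  have h2 : ∀ q r, t false q r =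
      cell ({i | xr x y i = true} : Finset (Fin 24))ᶜ (xr x z) (xr x w) q r := fun q r =>
    (cell_eq_cell3 _ _ _ _ _ _ _ (by simp)).symm
  simp only [h1, h2]
  rw [D, FD]
  have h3 : #({i | xr x y i = true} : Finset (Fin 24)) = wt univ (xr x y) := rfl
  refine if_congr ?_ ?_ rfl
  · rw [← h3, ← sum_cells _ (xr x z) (xr x w)]; omega
  · rw [PhiD]
    refine sum_congr rfl fun kl _ => ?_
    rw [rowOfD, rowOfD, cell_add_cell, cell_add_cell, cell_add_cell', cell_add_cell', mul_assoc]
    rfl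

lemma evalD_eq (a b c d x y z w : Word) (f g h : Bool → Bool → Bool → Bool)
    (H : ∀ i p q r, (xr x y i = p ∧ xr x z i = q ∧ xr x w i = r) ↔
      (xr a b i = f p q r ∧ xr a c i = g p q r ∧ xr a d i = h p q r)) :
    let t (p q r) := cnt a b c d (f p q r) (g p q r) (h p q r)
    ((evalD TD0 (TA0 1) (TA0 neg1) (t true true true) (t true true false) (t true false true)
      (t true false false) (t false true true) (t false true false) (t false false true)
      (t false false false) : ℕ) : R) = D x y z w := by
  intro t
  have ht : ∀ p q r, t p q r = cell3 univ (xr x y) (xr x z) (xr x w) p q r := fun p q r => by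
    simp only [t, cnt, cell3, H]
  simp only [ht]
  rw [evalD_cast, D_eq]
  all_goals exact cell3_lt _ _ _ _ _ _

lemma add_eq_add {a b c d : R} (h : a = b) (h' : c = d) : a + c = b + d := h ▸ h' ▸ rfl

/-- The value of the evaluator at a quadruple of words. -/
def valG (a b c d : Word) : ℕ :=
  evalG TE0 TD0 TK0 (TA0 1) (TA0 neg1) (cnt a b c d true true true) (cnt a b c d true true false)
    (cnt a b c d true false true) (cnt a b c d true false false) (cnt a b c d false true true)
    (cnt a b c d false true false) (cnt a b c d false false true) (cnt a b c d false false false)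

lemma valG_cast (a b c d : Word) : (valG a b c d : R) = (G a b c d : ℤ) := by
  rw [valG, evalG, cast_mod, G]
  simp only [Nat.add_eq, Nat.cast_add, Int.cast_add]
  refine add_eq_add (add_eq_add ?_ (add_eq_add ?_ ?_)) (add_eq_add (add_eq_add (add_eq_add
    (add_eq_add ?_ ?_) (add_eq_add ?_ ?_)) (add_eq_add ?_ ?_)) (add_eq_add (add_eq_add
    (add_eq_add ?_ ?_) (add_eq_add ?_ ?_)) (add_eq_add ?_ ?_)))
  · exact evalE_eq a b c d _ _ _ _ (fun p _ _ => p) (fun _ _ r => r) (fun _ q r => xor q r)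
      fun i p q r => by
        simp only [xr]; revert p q r; generalize a i = a, b i = b, c i = c, d i = d; revert a b c d; decide
  · exact evalE_eq a b c d _ _ _ _ (fun _ _ r => r) (fun p _ _ => p) (fun _ q r => xor q r)
      fun i p q r => by
        simp only [xr]; revert p q r; generalize a i = a, b i = b, c i = c, d i = d; revert a b c d; decide
  · exact evalE_eq a b c d _ _ _ _ (fun _ _ r => r) (fun _ q r => xor q r) (fun p _ _ => p)
      fun i p q r => by
        simp only [xr]; revert p q r; generalize a i = a, b i = b, c i = c, d i = d; revert a b c d; decide
  · exact evalD_eq a b c d _ _ _ _ (fun p _ _ => p) (fun _ q _ => q) (fun _ _ r => r)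
      fun i p q r => Iff.rfl
  · exact evalD_eq a b c d _ _ _ _ (fun p _ _ => p) (fun p q _ => xor p q) (fun p _ r => xor p r)
      fun i p q r => by
        simp only [xr]; revert p q r; generalize a i = a, b i = b, c i = c, d i = d; revert a b c d; decide
  · exact evalD_eq a b c d _ _ _ _ (fun _ q _ => q) (fun p _ _ => p) (fun _ _ r => r)
      fun i p q r => by
        simp only [xr]; revert p q r; generalize a i = a, b i = b, c i = c, d i = d; revert a b c d; decide
  · exact evalD_eq a b c d _ _ _ _ (fun p q _ => xor p q) (fun p _ _ => p) (fun p _ r => xor p r)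
      fun i p q r => by
        simp only [xr]; revert p q r; generalize a i = a, b i = b, c i = c, d i = d; revert a b c d; decide
  · exact evalD_eq a b c d _ _ _ _ (fun _ q _ => q) (fun _ _ r => r) (fun p _ _ => p)
      fun i p q r => by
        simp only [xr]; revert p q r; generalize a i = a, b i = b, c i = c, d i = d; revert a b c d; decide
  · exact evalD_eq a b c d _ _ _ _ (fun p q _ => xor p q) (fun p _ r => xor p r) (fun p _ _ => p)
      fun i p q r => by
        simp only [xr]; revert p q r; generalize a i = a, b i = b, c i = c, d i = d; revert a b c d; decide
  · exact evalD_eq a b c d _ _ _ _ (fun _ q _ => q) (fun p q _ => xor p q) (fun _ q r => xor q r)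
      fun i p q r => by
        simp only [xr]; revert p q r; generalize a i = a, b i = b, c i = c, d i = d; revert a b c d; decide
  · exact evalD_eq a b c d _ _ _ _ (fun p q _ => xor p q) (fun _ q _ => q) (fun _ q r => xor q r)
      fun i p q r => by
        simp only [xr]; revert p q r; generalize a i = a, b i = b, c i = c, d i = d; revert a b c d; decide
  · exact evalD_eq a b c d _ _ _ _ (fun _ q _ => q) (fun _ q r => xor q r) (fun p q _ => xor p q)
      fun i p q r => by
        simp only [xr]; revert p q r; generalize a i = a, b i = b, c i = c, d i = d; revert a b c d; decide
  · exact evalD_eq a b c d _ _ _ _ (fun p q _ => xor p q) (fun _ q r => xor q r) (fun _ q _ => q)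
      fun i p q r => by
        simp only [xr]; revert p q r; generalize a i = a, b i = b, c i = c, d i = d; revert a b c d; decide
  · exact evalD_eq a b c d _ _ _ _ (fun _ q r => xor q r) (fun _ q _ => q) (fun p q _ => xor p q)
      fun i p q r => by
        simp only [xr]; revert p q r; generalize a i = a, b i = b, c i = c, d i = d; revert a b c d; decide
  · exact evalD_eq a b c d _ _ _ _ (fun _ q r => xor q r) (fun p q _ => xor p q) (fun _ q _ => q)
      fun i p q r => by
        simp only [xr]; revert p q r; generalize a i = a, b i = b, c i = c, d i = d; revert a b c d; decide

end Casts

section Bounds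

lemma abs_zzZ_le (n W : ℕ) (h : n < 2 ^ (W + 1)) : |zzZ n| ≤ 2 ^ W := by
  have h1 : ((n / 2 : ℕ) : ℤ) ≤ 2 ^ W := by
    rw [pow_succ] at h
    have : n / 2 ≤ 2 ^ W := by omega
    exact_mod_cast this
  unfold zzZ
  split_ifs
  · rwa [abs_of_nonneg (by positivity)]
  · rwa [abs_neg, abs_of_nonneg (by positivity)]

lemma abs_decZ_le (W e f n t : ℕ) : |(decZ (W + 1) e f n).getD t 0| ≤ 2 ^ e * 2 ^ W := by
  induction f generalizing n t with
  | zero => simp [decZ]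
  | succ f ih => cases n with
    | zero => simp [decZ]
    | succ n => cases t with
      | succ t => simpa [decZ] using ih _ t
      | zero =>
        simp only [decZ, List.getD_cons_zero, abs_mul, abs_pow, abs_two]
        exact mul_le_mul_of_nonneg_left (abs_zzZ_le _ _ (Nat.mod_lt _ (by positivity)))
          (by positivity)

lemma abs_rowZ_le {W : ℕ} (hW : W ≤ 35) (n t : ℕ) : |(rowZ (W + 1) n).getD t 0| ≤ 2 ^ 98 := by
  refine (abs_decZ_le W (n % 64) 29 (n / 64) t).trans ?_
  have h1 : (2 : ℤ) ^ (n % 64) ≤ 2 ^ 63 := pow_le_pow_right₀ (by norm_num) (by omega)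
  have h2 : (2 : ℤ) ^ W ≤ 2 ^ 35 := pow_le_pow_right₀ (by norm_num) hW
  calc _ ≤ (2 : ℤ) ^ 63 * 2 ^ 35 := mul_le_mul h1 h2 (by positivity) (by positivity)
    _ = 2 ^ 98 := by norm_num

lemma abs_sum_le {ι : Type*} (s : Finset ι) (f : ι → ℤ) (n : ℕ) {B : ℤ} (hs : #s ≤ n) (hB : 0 ≤ B)
    (h : ∀ i ∈ s, |f i| ≤ B) : |∑ i ∈ s, f i| ≤ n * B := by
  refine (abs_sum_le_sum_abs f s).trans ((sum_le_card_nsmul s _ B h).trans ?_)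
  rw [nsmul_eq_mul]
  exact mul_le_mul_of_nonneg_right (by exact_mod_cast hs) hB

lemma abs_mul_le {a b A B : ℤ} (ha : |a| ≤ A) (hb : |b| ≤ B) : |a * b| ≤ A * B := by
  rw [abs_mul]
  exact mul_le_mul ha hb (abs_nonneg b) ((abs_nonneg a).trans ha)

lemma abs_dotZ_le {W : ℕ} (hW : W ≤ 35) (m n : ℕ) :
    |dotZ (rowZ (W + 1) m) (rowZ (W + 1) n)| ≤ 2 ^ 201 := by
  refine (abs_sum_le (range 29) _ 29 (by simp) (B := 2 ^ 98 * 2 ^ 98) (by positivity) fun t _ =>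
    abs_mul_le (abs_rowZ_le hW m t) (abs_rowZ_le hW n t)).trans (by norm_num)

lemma abs_pairCount_le {m a b : ℕ} (ha : a < 25) (hb : b < 25) :
    |pairCount m a b| ≤ 576 ^ m := by
  rw [pairCount, abs_of_nonneg (by positivity)]
  have h1 : m.factorial * a.choose m ≤ 24 ^ m := by
    rw [← Nat.descFactorial_eq_factorial_mul_choose]
    exact (Nat.descFactorial_le_pow a m).trans (Nat.pow_le_pow_left (by omega) m)
  have h2 : b.choose m ≤ 24 ^ m := (Nat.choose_le_pow b m).trans (Nat.pow_le_pow_left (by omega) m)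
  have h3 := Nat.mul_le_mul h1 h2
  rw [← mul_pow] at h3
  exact_mod_cast h3

lemma abs_zonal_le {k a c d b : ℕ} (hk : k ≤ 12) (ha : a < 25) (hb : b < 25) (hc : c < 25)
    (hd : d < 25) : |zonal k a c d b| ≤ 2 ^ 115 := by
  refine (abs_sum_le _ _ 13 (B := 576 ^ 12) ?_ (by positivity) fun x hx => ?_).trans (by norm_num)
  · rw [Nat.card_antidiagonal]; omega
  · have hx' := mem_antidiagonal.1 hx
    have h1 := abs_mul_le (abs_pairCount_le (m := x.1) ha hb) (abs_pairCount_le (m := x.2) hc hd)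
    rw [← pow_add, hx'] at h1
    rw [mul_assoc, abs_mul, abs_pow, abs_neg, abs_one, one_pow, one_mul]
    exact h1.trans (pow_le_pow_right₀ (by norm_num) hk)

lemma abs_zonalOn_le {k : ℕ} (hk : k ≤ 12) (S : Finset (Fin 24)) (u v : Word) :
    |zonalOn k S u v| ≤ 2 ^ 115 :=
  abs_zonal_le hk (cell_lt _ _ _ _ _) (cell_lt _ _ _ _ _) (cell_lt _ _ _ _ _) (cell_lt _ _ _ _ _)

lemma kE_le (g : ℕ) : kE g ≤ 12 := by
  unfold kE; split_ifs <;> omega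

lemma abs_PhiE_le (S : Finset (Fin 24)) (u v : Word) : |PhiE S u v| ≤ 2 ^ 435 := by
  refine (abs_sum_le (range 15) _ 15 (by simp) (B := 2 ^ 115 * (2 ^ 115 * 2 ^ 201)) (by positivity)
    fun g hg => ?_).trans (by norm_num)
  have := mem_range.1 hg
  exact abs_mul_le (abs_zonalOn_le (kE_le g) S u v)
    (abs_mul_le (abs_zonalOn_le (by omega) _ u v) (abs_dotZ_le le_rfl _ _))

lemma abs_PhiD_le (T : Finset (Fin 24)) (u v : Word) : |PhiD T u v| ≤ 2 ^ 435 := by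
  refine (abs_sum_le (range 16) _ 16 (by simp) (B := 2 ^ 115 * (2 ^ 115 * 2 ^ 201)) (by positivity)
    fun g hg => ?_).trans (by norm_num)
  have := mem_range.1 hg
  exact abs_mul_le (abs_zonalOn_le (by omega) T u v)
    (abs_mul_le (abs_zonalOn_le (by omega) _ u v) (abs_dotZ_le (by norm_num) _ _))

lemma abs_E_le (x y z w : Word) : |E x y z w| ≤ 2 ^ 459 := by
  refine (abs_sum_le univ _ (2 ^ 24) ?_ (B := 1 * 2 ^ 435) (by positivity)
    fun S _ => abs_mul_le ?_ (abs_PhiE_le _ _ _)).trans (by norm_num)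
  · rw [card_univ, Fintype.card_finset, Fintype.card_fin]
  · rw [chi_eq_pow, abs_pow, abs_neg, abs_one, one_pow]

lemma abs_D_le (x y z w : Word) : |D x y z w| ≤ 2 ^ 459 := by
  unfold D
  split_ifs
  · exact (abs_PhiD_le _ _ _).trans (by norm_num)
  · norm_num

lemma abs_add_le_of_le {a b A B : ℤ} (ha : |a| ≤ A) (hb : |b| ≤ B) : |a + b| ≤ A + B :=
  (abs_add_le a b).trans (add_le_add ha hb)

lemma abs_G_le (a b c d : Word) : |G a b c d| ≤ 2 ^ 463 := by
  have hE := abs_E_le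
  have hD := abs_D_le
  unfold G
  generalize E = E at *
  generalize D = D at *
  refine (abs_add_le_of_le (abs_add_le_of_le (hE _ _ _ _) (abs_add_le_of_le (hE _ _ _ _)
    (hE _ _ _ _))) (abs_add_le_of_le (abs_add_le_of_le (abs_add_le_of_le
    (abs_add_le_of_le (hD _ _ _ _) (hD _ _ _ _)) (abs_add_le_of_le (hD _ _ _ _) (hD _ _ _ _)))
    (abs_add_le_of_le (hD _ _ _ _) (hD _ _ _ _))) (abs_add_le_of_le (abs_add_le_of_le
    (abs_add_le_of_le (hD _ _ _ _) (hD _ _ _ _)) (abs_add_le_of_le (hD _ _ _ _) (hD _ _ _ _)))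
    (abs_add_le_of_le (hD _ _ _ _) (hD _ _ _ _))))).trans (by norm_num)

lemma nonpos_of_cast {v : ℕ} {X : ℤ} (hv : nonpos v = true) (h : (v : R) = (X : ℤ))
    (hX : |X| ≤ 2 ^ 500) : X ≤ 0 := by
  have hmod : (modulus : ℤ) = 2 * 2 ^ 511 := by
    unfold modulus; rw [Nat.pow_eq]; push_cast
  have hdvd : (modulus : ℤ) ∣ X - v := by
    rw [← intCast_eq_iff]; simpa using h
  have hX' : X < 2 ^ 511 := ((le_abs_self X).trans hX).trans_lt (by norm_num)
  have hX2 : -2 ^ 511 < X := by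
    have := (neg_abs_le X).trans' (neg_le_neg hX)
    exact lt_of_lt_of_le (by norm_num) this
  have hv' : v = 0 ∨ v / 2 ^ 511 = 1 := by
    cases h1 : Nat.beq (v / 2 ^ 511) 1
    · have : nonpos v = @Bool.rec (fun _ => Bool) (Nat.beq v 0) true (Nat.beq (v / 2 ^ 511) 1) := rfl
      rw [this, h1] at hv
      exact Or.inl (Nat.eq_of_beq_eq_true hv)
    · exact Or.inr (Nat.eq_of_beq_eq_true h1)
  have hmod' : ((2 ^ 511 : ℕ) : ℤ) = 2 ^ 511 := by norm_num
  rw [← hmod'] at hmod hX' hX2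
  have hp : 0 < 2 ^ 511 := by positivity
  generalize (2 ^ 511 : ℕ) = M at *
  by_contra! hpos
  rcases hv' with rfl | hv'
  · have h1 := Int.le_of_dvd (by simpa using hpos) hdvd
    rw [hmod] at h1
    omega
  · have hlow : M ≤ v := by
      have := (Nat.le_div_iff_mul_le hp).1 hv'.ge; rwa [one_mul] at this
    have hup : v < 2 * M := (Nat.div_lt_iff_lt_mul hp).1 (by rw [hv']; norm_num)
    have h1 := Int.le_of_dvd (by omega) (dvd_neg.2 hdvd)
    rw [hmod] at h1
    omega

end Bounds

theorem quads_10_10 : (all5 fun TE TD TK TA TB => allL (quads TE TD TK TA TB 10) [10]) = true := by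
  decide +kernel

theorem quads_10_12 : (all5 fun TE TD TK TA TB => allL (quads TE TD TK TA TB 10) [12]) = true := by
  decide +kernel

theorem quads_10_14 : (all5 fun TE TD TK TA TB => allL (quads TE TD TK TA TB 10) [14, 16, 18]) = true := by
  decide +kernel

theorem quads_12 :
    (all5 fun TE TD TK TA TB => allL (quads TE TD TK TA TB 12) [12, 14, 16, 18]) = true := by
  decide +kernel

theorem quads_ge_14 : (all5 fun TE TD TK TA TB => andB (allL (quads TE TD TK TA TB 14) [14, 16])
    (andB (quads TE TD TK TA TB 16 16) (andB (triples TE TD TK TA TB)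
    (andB (pairs TE TD TK TA TB) (const TE TD TK TA TB))))) = true := by
  decide +kernel

section Checks

lemma all5_eq (f : List (List (List (List (List (List ℕ))))) → List (List (List (List ℕ))) →
    List (List (List ℕ)) → List (List (List ℕ)) → List (List (List ℕ)) → Bool) :
    all5 f = f TE0 TD0 TK0 (TA0 1) (TA0 neg1) := by
  rw [all5, tableE_eq, rowsD_eq, tableK_eq, tableA_eq, tableA_eq]

lemma impB_elim {a b : Bool} (h : impB a b = true) (ha : a = true) : b = true := by
  subst ha; exact h

lemma andB_eq_true {a b : Bool} : andB a b = true ↔ a = true ∧ b = true := by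
  cases a <;> cases b <;> decide

lemma allB_elim {n : ℕ} {f : ℕ → Bool} (h : allB n f = true) {i : ℕ} (hi : i < n) :
    f i = true := by
  induction n with
  | zero => omega
  | succ n ih =>
    have h' : andB (f n) (allB n f) = true := h
    rw [andB_eq_true] at h'
    rcases Nat.lt_succ_iff_lt_or_eq.1 hi with h1 | rfl
    · exact ih h'.2 h1
    · exact h'.1

lemma allL_eq_true {f : ℕ → Bool} {l : List ℕ} : allL f l = true ↔ ∀ x ∈ l, f x = true := by
  induction l with
  | nil => simp [allL]
  | cons a l ih =>
    have h' : allL f (a :: l) = andB (f a) (allL f l) := rfl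
    rw [h', andB_eq_true, ih, List.forall_mem_cons]

lemma okd_of {d : ℕ} (h : 10 ≤ d) (h' : d % 2 = 0) : okd d = true :=
  andB_eq_true.2 ⟨Nat.ble_eq_true_of_le h, by rw [Nat.beq_eq]; exact h'⟩

lemma quads_elim {TE : List (List (List (List (List (List ℕ)))))} {TD : List (List (List (List ℕ)))}
    {TK TA TB : List (List (List ℕ))} {e11 f11 e10 f10 e01 f01 e00 f00 : ℕ}
    (h : quads TE TD TK TA TB (e11 + f11 + (e10 + f10)) (e11 + f11 + (e01 + f01)) = true)
    (hs : e11 + f11 + (e10 + f10) + (e01 + f01) + (e00 + f00) = 24)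
    (h12 : okd (e10 + f10 + (e01 + f01)) = true)
    (h03 : okd (e11 + (e10 + (e01 + e00))) = true)
    (h13 : okd (f11 + (f10 + (e01 + e00))) = true)
    (h23 : okd (f11 + (f01 + (e10 + e00))) = true)
    (hle : e11 + f11 + (e01 + f01) ≤ e10 + f10 + (e01 + f01))
    (hc : canon (e11 + f11 + (e10 + f10)) (e11 + f11 + (e01 + f01)) (e10 + f10 + (e01 + f01))
      (e11 + (e10 + (e01 + e00))) (f11 + (f10 + (e01 + e00))) (f11 + (f01 + (e10 + e00))) = true) :
    nonpos (evalG TE TD TK TA TB e11 f11 e10 f10 e01 f01 e00 f00) = true := by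
  unfold quads at h
  simp only [force_eq, Nat.add_eq, Nat.sub_eq] at h
  have h1 := impB_elim (impB_elim (allB_elim h (i := e11 + f11) (by omega))
    (Nat.ble_eq_true_of_le (by omega))) (Nat.ble_eq_true_of_le (by omega))
  simp only [Nat.add_sub_cancel_left] at h1
  have h2 := impB_elim (impB_elim (impB_elim h1 (Nat.ble_eq_true_of_le (by omega))) h12)
    (Nat.ble_eq_true_of_le hle)
  have h0 : 24 - (e11 + f11 + (e10 + f10 + (e01 + f01))) = e00 + f00 := by omega
  simp only [h0] at h2
  have h3 := allB_elim (allB_elim (allB_elim (allB_elim h2 (i := e11) (by omega)) (i := e10)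
    (by omega)) (i := e01) (by omega)) (i := e00) (by omega)
  simp only [Nat.add_sub_cancel_left] at h3
  exact impB_elim (impB_elim (impB_elim (impB_elim h3 h03) h13) h23) hc

end Checks

section Distances

lemma xr_eq_true (x y : Word) (i : Fin 24) : xr x y i = true ↔ x i ≠ y i := by
  simp [xr]

lemma xr_apply (a b c : Word) (i : Fin 24) : xr b c i = xor (xr a b i) (xr a c i) := by
  simp only [xr]
  generalize a i = a, b i = b, c i = c; revert a b c; decide

lemma hammingDist_eq_wt (x y : Word) : hammingDist x y = wt univ (xr x y) := by
  simp only [hammingDist, wt, xr_eq_true]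

lemma hammingDist_le (x y : Word) : hammingDist x y ≤ 24 := by
  rw [hammingDist_eq_wt]; exact wt_le _ _

lemma sum_cnt (a b c d : Word) :
    cnt a b c d true true true + cnt a b c d true true false +
    (cnt a b c d true false true + cnt a b c d true false false) +
    (cnt a b c d false true true + cnt a b c d false true false) +
    (cnt a b c d false false true + cnt a b c d false false false) = 24 := by
  have : (24 : ℕ) = ∑ i : Fin 24, 1 := by simp
  rw [this]
  simp only [cnt, cell3, card_filter, ← sum_add_distrib]
  refine sum_congr rfl fun i _ => ?_
  generalize xr a b i = p, xr a c i = q, xr a d i = r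
  revert p q r; decide

lemma hammingDist_01 (a b c d : Word) : hammingDist a b =
    cnt a b c d true true true + cnt a b c d true true false +
    (cnt a b c d true false true + cnt a b c d true false false) := by
  simp only [hammingDist_eq_wt, wt, cnt, cell3, card_filter, ← sum_add_distrib]
  refine sum_congr rfl fun i _ => ?_
  generalize xr a b i = p, xr a c i = q, xr a d i = r
  revert p q r; decide

lemma hammingDist_02 (a b c d : Word) : hammingDist a c =
    cnt a b c d true true true + cnt a b c d true true false +
    (cnt a b c d false true true + cnt a b c d false true false) := by
  simp only [hammingDist_eq_wt, wt, cnt, cell3, card_filter, ← sum_add_distrib]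
  refine sum_congr rfl fun i _ => ?_
  generalize xr a b i = p, xr a c i = q, xr a d i = r
  revert p q r; decide

lemma hammingDist_12 (a b c d : Word) : hammingDist b c =
    cnt a b c d true false true + cnt a b c d true false false +
    (cnt a b c d false true true + cnt a b c d false true false) := by
  simp only [hammingDist_eq_wt, wt, cnt, cell3, card_filter, ← sum_add_distrib]
  refine sum_congr rfl fun i _ => ?_
  rw [xr_apply a b c]
  generalize xr a b i = p, xr a c i = q, xr a d i = r
  revert p q r; decide

lemma hammingDist_03 (a b c d : Word) : hammingDist a d =
    cnt a b c d true true true + (cnt a b c d true false true +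
    (cnt a b c d false true true + cnt a b c d false false true)) := by
  simp only [hammingDist_eq_wt, wt, cnt, cell3, card_filter, ← sum_add_distrib]
  refine sum_congr rfl fun i _ => ?_
  generalize xr a b i = p, xr a c i = q, xr a d i = r
  revert p q r; decide

lemma hammingDist_13 (a b c d : Word) : hammingDist b d =
    cnt a b c d true true false + (cnt a b c d true false false +
    (cnt a b c d false true true + cnt a b c d false false true)) := by
  simp only [hammingDist_eq_wt, wt, cnt, cell3, card_filter, ← sum_add_distrib]
  refine sum_congr rfl fun i _ => ?_
  rw [xr_apply a b d]
  generalize xr a b i = p, xr a c i = q, xr a d i = r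
  revert p q r; decide

lemma hammingDist_23 (a b c d : Word) : hammingDist c d =
    cnt a b c d true true false + (cnt a b c d false true false +
    (cnt a b c d true false true + cnt a b c d false false true)) := by
  simp only [hammingDist_eq_wt, wt, cnt, cell3, card_filter, ← sum_add_distrib]
  refine sum_congr rfl fun i _ => ?_
  rw [xr_apply a c d]
  generalize xr a b i = p, xr a c i = q, xr a d i = r
  revert p q r; decide

end Distances

section Quadruples

/-- The distance of `x` and `y` is at least 10 and even. -/
def Ok (x y : Word) : Prop := 10 ≤ hammingDist x y ∧ hammingDist x y % 2 = 0

lemma Ok.symm {x y : Word} (h : Ok x y) : Ok y x := by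
  rwa [Ok, hammingDist_comm]

lemma Ok.okd {x y : Word} (h : Ok x y) : okd (hammingDist x y) = true := okd_of h.1 h.2

lemma quads_of_le {m n k : ℕ} (hm : 10 ≤ m) (hm' : m % 2 = 0) (hn' : n % 2 = 0) (hmn : m ≤ n)
    (hnk : n ≤ k) (hs : m + n + k ≤ 48) : quads TE0 TD0 TK0 (TA0 1) (TA0 neg1) m n = true := by
  have h1 := quads_10_10
  have h2 := quads_10_12
  have h3 := quads_10_14
  have h4 := quads_12
  have h5 := quads_ge_14
  rw [all5_eq] at h1 h2 h3 h4 h5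
  rw [andB_eq_true, andB_eq_true] at h5
  obtain ⟨h5, h6, -⟩ := h5
  generalize quads TE0 TD0 TK0 (TA0 1) (TA0 neg1) = Q at *
  simp only [allL_eq_true, List.forall_mem_cons] at h1 h2 h3 h4 h5
  obtain ⟨i, rfl⟩ : ∃ i, m = 2 * i := ⟨m / 2, by omega⟩
  obtain ⟨j, rfl⟩ : ∃ j, n = 2 * j := ⟨n / 2, by omega⟩
  have hi : i ≤ 8 := by omega
  have hi' : 5 ≤ i := by omega
  have hj : j ≤ 9 := by omega
  have hj' : 5 ≤ j := by omega
  interval_cases i <;> interval_cases j <;> first | omega | tauto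

/-- The code of the ordered distances of four words. -/
def wordCode (a b c d : Word) : ℕ := code (hammingDist a b) (hammingDist a c) (hammingDist b c)
  (hammingDist a d) (hammingDist b d) (hammingDist c d)

lemma nonpos_valG {a b c d : Word} (hab : Ok a b) (hac : Ok a c) (hbc : Ok b c) (had : Ok a d)
    (hbd : Ok b d) (hcd : Ok c d) (h1 : hammingDist a b ≤ hammingDist a c)
    (h2 : hammingDist a c ≤ hammingDist b c) (hc : canon (hammingDist a b) (hammingDist a c)
      (hammingDist b c) (hammingDist a d) (hammingDist b d) (hammingDist c d) = true) :
    nonpos (valG a b c d) = true := by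
  have hs := sum_cnt a b c d
  have hq := quads_of_le hab.1 hab.2 hac.2 h1 h2 (by
    rw [hammingDist_01 a b c d, hammingDist_02 a b c d, hammingDist_12 a b c d]; omega)
  have hbc := hbc.okd
  have had := had.okd
  have hbd := hbd.okd
  have hcd := hcd.okd
  rw [hammingDist_01 a b c d, hammingDist_02 a b c d] at hq
  rw [hammingDist_12 a b c d, hammingDist_02 a b c d] at h2
  rw [hammingDist_01 a b c d, hammingDist_02 a b c d, hammingDist_12 a b c d,
    hammingDist_03 a b c d, hammingDist_13 a b c d, hammingDist_23 a b c d] at hc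
  rw [hammingDist_12 a b c d] at hbc
  rw [hammingDist_03 a b c d] at had
  rw [hammingDist_13 a b c d] at hbd
  rw [hammingDist_23 a b c d] at hcd
  exact quads_elim hq hs hbc had hbd hcd h2 hc

lemma canon_eq_true {d01 d02 d12 d03 d13 d23 : ℕ} : canon d01 d02 d12 d03 d13 d23 = true ↔
    ∀ x ∈ [code d01 d03 d13 d02 d12 d23, code d02 d01 d12 d03 d23 d13, code d02 d03 d23 d01 d12 d13,
    code d03 d01 d13 d02 d23 d12, code d03 d02 d23 d01 d13 d12, code d01 d12 d02 d13 d03 d23,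
    code d01 d13 d03 d12 d02 d23, code d12 d01 d02 d13 d23 d03, code d12 d13 d23 d01 d02 d03,
    code d13 d01 d03 d12 d23 d02, code d13 d12 d23 d01 d03 d02, code d02 d12 d01 d23 d03 d13,
    code d02 d23 d03 d12 d01 d13, code d12 d02 d01 d23 d13 d03, code d12 d23 d13 d02 d01 d03,
    code d23 d02 d03 d12 d13 d01, code d23 d12 d13 d02 d03 d01, code d03 d13 d01 d23 d02 d12,
    code d03 d23 d02 d13 d01 d12, code d13 d03 d01 d23 d12 d02, code d13 d23 d12 d03 d01 d02,
    code d23 d03 d02 d13 d12 d01, code d23 d13 d12 d03 d02 d01],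
    code d01 d02 d12 d03 d13 d23 ≤ x := by
  simp only [canon, force_eq, allL_eq_true, Nat.ble_eq]

lemma le_of_canon {d01 d02 d12 d03 d13 d23 : ℕ} (h : canon d01 d02 d12 d03 d13 d23 = true)
    (h2 : d02 ≤ 24) (h3 : d12 ≤ 24) (h4 : d03 ≤ 24) (h5 : d13 ≤ 24)
    (h6 : d23 ≤ 24) : d01 ≤ d02 ∧ d02 ≤ d12 := by
  rw [canon_eq_true] at h
  have e1 := h (code d02 d01 d12 d03 d23 d13) (by simp)
  have e2 := h (code d01 d12 d02 d13 d03 d23) (by simp)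
  simp only [code, Nat.add_eq, Nat.mul_eq] at e1 e2
  omega

lemma G_nonpos {a b c d : Word} (hab : Ok a b) (hac : Ok a c) (hbc : Ok b c) (had : Ok a d)
    (hbd : Ok b d) (hcd : Ok c d) : G a b c d ≤ 0 := by
  induction hn : wordCode a b c d using Nat.strong_induction_on generalizing a b c d with
  | _ n ih =>
    subst hn
    rcases Bool.eq_false_or_eq_true (canon (hammingDist a b) (hammingDist a c)
      (hammingDist b c) (hammingDist a d) (hammingDist b d) (hammingDist c d)) with h | h
    · have hle := le_of_canon h (hammingDist_le _ _) (hammingDist_le _ _)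
        (hammingDist_le _ _) (hammingDist_le _ _) (hammingDist_le _ _)
      exact nonpos_of_cast (nonpos_valG hab hac hbc had hbd hcd hle.1 hle.2 h)
        (valG_cast a b c d) ((abs_G_le a b c d).trans (pow_le_pow_right₀ one_le_two (by norm_num)))
    · have key (p q r s : Word) (h1 : Ok p q) (h2 : Ok p r) (h3 : Ok q r) (h4 : Ok p s)
          (h5 : Ok q s) (h6 : Ok r s) (hG : G p q r s = G a b c d)
          (hlt : wordCode p q r s < wordCode a b c d) : G a b c d ≤ 0 :=
        hG ▸ ih _ hlt h1 h2 h3 h4 h5 h6 rfl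
      rw [← Bool.not_eq_true, canon_eq_true] at h
      push Not at h
      obtain ⟨x, hx, hlt⟩ := h
      have hba := hab.symm
      have hca := hac.symm
      have hcb := hbc.symm
      have hda := had.symm
      have hdb := hbd.symm
      have hdc := hcd.symm
      simp only [List.mem_cons, List.not_mem_nil, or_false] at hx
      rcases hx with rfl | rfl | rfl | rfl | rfl | rfl | rfl | rfl | rfl | rfl | rfl | rfl | rfl | rfl | rfl | rfl | rfl | rfl | rfl | rfl | rfl | rfl | rfl
      · refine key a b d c ?_ ?_ ?_ ?_ ?_ ?_ (by simp only [G_swap01, G_swap12, G_swap23])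
          (by simpa only [wordCode, hammingDist_comm] using hlt) <;> assumption
      · refine key a c b d ?_ ?_ ?_ ?_ ?_ ?_ (by simp only [G_swap01, G_swap12, G_swap23])
          (by simpa only [wordCode, hammingDist_comm] using hlt) <;> assumption
      · refine key a c d b ?_ ?_ ?_ ?_ ?_ ?_ (by simp only [G_swap01, G_swap12, G_swap23])
          (by simpa only [wordCode, hammingDist_comm] using hlt) <;> assumption
      · refine key a d b c ?_ ?_ ?_ ?_ ?_ ?_ (by simp only [G_swap01, G_swap12, G_swap23])
          (by simpa only [wordCode, hammingDist_comm] using hlt) <;> assumption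
      · refine key a d c b ?_ ?_ ?_ ?_ ?_ ?_ (by simp only [G_swap01, G_swap12, G_swap23])
          (by simpa only [wordCode, hammingDist_comm] using hlt) <;> assumption
      · refine key b a c d ?_ ?_ ?_ ?_ ?_ ?_ (by simp only [G_swap01, G_swap12, G_swap23])
          (by simpa only [wordCode, hammingDist_comm] using hlt) <;> assumption
      · refine key b a d c ?_ ?_ ?_ ?_ ?_ ?_ (by simp only [G_swap01, G_swap12, G_swap23])
          (by simpa only [wordCode, hammingDist_comm] using hlt) <;> assumption
      · refine key b c a d ?_ ?_ ?_ ?_ ?_ ?_ (by simp only [G_swap01, G_swap12, G_swap23])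
          (by simpa only [wordCode, hammingDist_comm] using hlt) <;> assumption
      · refine key b c d a ?_ ?_ ?_ ?_ ?_ ?_ (by simp only [G_swap01, G_swap12, G_swap23])
          (by simpa only [wordCode, hammingDist_comm] using hlt) <;> assumption
      · refine key b d a c ?_ ?_ ?_ ?_ ?_ ?_ (by simp only [G_swap01, G_swap12, G_swap23])
          (by simpa only [wordCode, hammingDist_comm] using hlt) <;> assumption
      · refine key b d c a ?_ ?_ ?_ ?_ ?_ ?_ (by simp only [G_swap01, G_swap12, G_swap23])
          (by simpa only [wordCode, hammingDist_comm] using hlt) <;> assumption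
      · refine key c a b d ?_ ?_ ?_ ?_ ?_ ?_ (by simp only [G_swap01, G_swap12, G_swap23])
          (by simpa only [wordCode, hammingDist_comm] using hlt) <;> assumption
      · refine key c a d b ?_ ?_ ?_ ?_ ?_ ?_ (by simp only [G_swap01, G_swap12, G_swap23])
          (by simpa only [wordCode, hammingDist_comm] using hlt) <;> assumption
      · refine key c b a d ?_ ?_ ?_ ?_ ?_ ?_ (by simp only [G_swap01, G_swap12, G_swap23])
          (by simpa only [wordCode, hammingDist_comm] using hlt) <;> assumption
      · refine key c b d a ?_ ?_ ?_ ?_ ?_ ?_ (by simp only [G_swap01, G_swap12, G_swap23])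
          (by simpa only [wordCode, hammingDist_comm] using hlt) <;> assumption
      · refine key c d a b ?_ ?_ ?_ ?_ ?_ ?_ (by simp only [G_swap01, G_swap12, G_swap23])
          (by simpa only [wordCode, hammingDist_comm] using hlt) <;> assumption
      · refine key c d b a ?_ ?_ ?_ ?_ ?_ ?_ (by simp only [G_swap01, G_swap12, G_swap23])
          (by simpa only [wordCode, hammingDist_comm] using hlt) <;> assumption
      · refine key d a b c ?_ ?_ ?_ ?_ ?_ ?_ (by simp only [G_swap01, G_swap12, G_swap23])
          (by simpa only [wordCode, hammingDist_comm] using hlt) <;> assumption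
      · refine key d a c b ?_ ?_ ?_ ?_ ?_ ?_ (by simp only [G_swap01, G_swap12, G_swap23])
          (by simpa only [wordCode, hammingDist_comm] using hlt) <;> assumption
      · refine key d b a c ?_ ?_ ?_ ?_ ?_ ?_ (by simp only [G_swap01, G_swap12, G_swap23])
          (by simpa only [wordCode, hammingDist_comm] using hlt) <;> assumption
      · refine key d b c a ?_ ?_ ?_ ?_ ?_ ?_ (by simp only [G_swap01, G_swap12, G_swap23])
          (by simpa only [wordCode, hammingDist_comm] using hlt) <;> assumption
      · refine key d c a b ?_ ?_ ?_ ?_ ?_ ?_ (by simp only [G_swap01, G_swap12, G_swap23])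
          (by simpa only [wordCode, hammingDist_comm] using hlt) <;> assumption
      · refine key d c b a ?_ ?_ ?_ ?_ ?_ ?_ (by simp only [G_swap01, G_swap12, G_swap23])
          (by simpa only [wordCode, hammingDist_comm] using hlt) <;> assumption

end Quadruples

section TriplesAndPairs

/-- The bound for triples as a function of two words. -/
def H (x y : Word) : ℤ := (getL 0 hneg (hammingDist x y) : ℕ)

lemma H_comm (x y : Word) : H x y = H y x := by rw [H, hammingDist_comm, H]

lemma hneg_le (n : ℕ) : getL 0 hneg n ≤ 2 ^ 80 := by
  rw [getL_eq]
  rcases lt_or_ge n 25 with h | h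
  · interval_cases n <;> decide +kernel
  · rw [List.getD_eq_default _ _ (h.trans' (by decide))]; positivity

lemma H_nonneg (x y : Word) : 0 ≤ H x y := Int.natCast_nonneg _

lemma H_le (x y : Word) : H x y ≤ 2 ^ 80 := by
  have := hneg_le (hammingDist x y)
  rw [H]; exact_mod_cast this

/-- The sum of the kernel over the ways to double one of three words. -/
def T (a b c : Word) : ℤ := G a a b c + (G b b a c + G c c a b)

lemma T_swap01 (a b c : Word) : T b a c = T a b c := by
  rw [T, T, G_swap23 c c a b]; ring

lemma T_swap12 (a b c : Word) : T a c b = T a b c := by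
  rw [T, T, G_swap23 a a b c]; ring

lemma cnt_eq_zero {a b c d : Word} {p q r : Bool}
    (h : ∀ i, ¬(xr a b i = p ∧ xr a c i = q ∧ xr a d i = r)) : cnt a b c d p q r = 0 := by
  rw [cnt, cell3, card_eq_zero, filter_eq_empty_iff]; exact fun i _ => h i

lemma cnt_eq_cnt {a b c d a' b' c' d' : Word} {p q r p' q' r' : Bool}
    (h : ∀ i, (xr a b i = p ∧ xr a c i = q ∧ xr a d i = r) ↔
      (xr a' b' i = p' ∧ xr a' c' i = q' ∧ xr a' d' i = r')) :
    cnt a b c d p q r = cnt a' b' c' d' p' q' r' := by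
  simp only [cnt, cell3, h]

lemma cnt_self (a c d : Word) (q r : Bool) : cnt a a c d true q r = 0 :=
  cnt_eq_zero fun i => by simp [xr]

lemma valG_self (a b c : Word) : valG a a b c = evalG TE0 TD0 TK0 (TA0 1) (TA0 neg1) 0 0 0 0
    (cnt a a b c false true true) (cnt a a b c false true false) (cnt a a b c false false true)
    (cnt a a b c false false false) := by
  rw [valG, cnt_self, cnt_self, cnt_self, cnt_self]

lemma cnt_swap01 (a b c : Word) (q r : Bool) :
    cnt b b a c false q r = cnt a a b c false q (xor q r) := cnt_eq_cnt fun i => by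
  simp only [xr]; revert q r; generalize a i = a, b i = b, c i = c; revert a b c; decide

lemma cnt_swap02 (a b c : Word) (q r : Bool) :
    cnt c c a b false q r = cnt a a b c false (xor q r) q := cnt_eq_cnt fun i => by
  simp only [xr]; revert q r; generalize a i = a, b i = b, c i = c; revert a b c; decide

lemma T_le_of_le {a b c : Word} (hab : Ok a b) (hac : Ok a c) (hbc : Ok b c)
    (h1 : hammingDist a b ≤ hammingDist a c) (h2 : hammingDist a c ≤ hammingDist b c) :
    T a b c ≤ H a b + (H a c + H b c) := by
  have h := quads_ge_14
  rw [all5_eq] at h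
  simp only [andB_eq_true] at h
  have h := h.2.2.1
  have e1 := hammingDist_02 a a b c
  have e2 := hammingDist_03 a a b c
  have e3 := hammingDist_23 a a b c
  have e4 := sum_cnt a a b c
  simp only [cnt_self, zero_add] at e1 e2 e3 e4
  have v1 := valG_self a b c
  have v2 := valG_self b a c
  have v3 := valG_self c a b
  simp only [cnt_swap01 a b c, cnt_swap02 a b c, Bool.xor_false, Bool.xor_true, Bool.not_true,
    Bool.not_false] at v2 v3
  have hab := hab.okd
  have hac := hac.okd
  have hbc := hbc.okd
  rw [← sub_nonpos]
  have hT : |T a b c - (H a b + (H a c + H b c))| ≤ 2 ^ 500 := by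
    have a1 := abs_add_le_of_le (abs_G_le a a b c)
      (abs_add_le_of_le (abs_G_le b b a c) (abs_G_le c c a b))
    have a2 := H_nonneg a b
    have a3 := H_nonneg a c
    have a4 := H_nonneg b c
    have a5 := H_le a b
    have a6 := H_le a c
    have a7 := H_le b c
    have a8 : |H a b + (H a c + H b c)| ≤ 2 ^ 80 + (2 ^ 80 + 2 ^ 80) := by
      rw [abs_of_nonneg (by positivity)]; linarith
    exact (abs_sub _ _).trans ((add_le_add a1 a8).trans (by norm_num))
  refine nonpos_of_cast (v := Nat.mod (Nat.add (Nat.add (valG a a b c) (Nat.add (valG b b a c) (valG c c a b)))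
      (Nat.mul neg1 (Nat.add (getL 0 hneg (hammingDist a b)) (Nat.add
        (getL 0 hneg (hammingDist a c)) (getL 0 hneg (hammingDist b c)))))) modulus) ?_ ?_ hT
  · rw [v1, v2, v3]
    generalize cnt a a b c false true true = c11 at *
    generalize cnt a a b c false true false = c10 at *
    generalize cnt a a b c false false true = c01 at *
    generalize cnt a a b c false false false = c00 at *
    rw [e1, e2] at h1
    rw [e3, e2] at h2
    rw [e1] at hab ⊢
    rw [e2] at hac ⊢
    rw [e3] at hbc ⊢
    obtain rfl : c00 = 24 - (c11 + (c10 + c01)) := by omega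
    unfold triples at h
    simp only [force_eq, Nat.sub_eq] at h
    have h' := allB_elim (allB_elim (allB_elim h (i := c11) (by omega)) (i := c10) (by omega))
      (i := c01) (by simp only [Nat.add_eq]; omega)
    exact impB_elim (impB_elim (impB_elim (impB_elim (impB_elim h' hab) hac) hbc)
      (Nat.ble_eq_true_of_le h1)) (Nat.ble_eq_true_of_le h2)
  · simp only [cast_mod, Nat.add_eq, Nat.mul_eq, Nat.cast_add, Nat.cast_mul, cast_neg1, valG_cast, T, H]
    push_cast
    ring

lemma T_le {a b c : Word} (hab : Ok a b) (hac : Ok a c) (hbc : Ok b c) :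
    T a b c ≤ H a b + (H a c + H b c) := by
  rcases le_total (hammingDist a b) (hammingDist a c) with h1 | h1 <;>
  rcases le_total (hammingDist a c) (hammingDist b c) with h2 | h2 <;>
  rcases le_total (hammingDist a b) (hammingDist b c) with h3 | h3
  · exact T_le_of_le hab hac hbc h1 h2
  · exact T_le_of_le hab hac hbc h1 h2
  · have := T_le_of_le hab.symm hbc hac (by rwa [hammingDist_comm b a]) h2
    rw [T_swap01, H_comm b a] at this; linarith
  · have := T_le_of_le hbc hab.symm hac.symm (by rwa [hammingDist_comm b a])
      (by rwa [hammingDist_comm b a, hammingDist_comm c a])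
    rw [T_swap12, T_swap01, H_comm b a, H_comm c a] at this; linarith
  · have := T_le_of_le hac hab hbc.symm h1 (by rwa [hammingDist_comm c b])
    rw [T_swap12, H_comm c b] at this; linarith
  · have := T_le_of_le hac.symm hbc.symm hab (by rwa [hammingDist_comm c a, hammingDist_comm c b])
      (by rwa [hammingDist_comm c b])
    rw [T_swap01, T_swap12, H_comm c a, H_comm c b] at this; linarith
  · have := T_le_of_le hbc.symm hac.symm hab.symm
      (by rwa [hammingDist_comm c a, hammingDist_comm c b])
      (by rwa [hammingDist_comm b a, hammingDist_comm c a])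
    rw [T_swap01, T_swap12, T_swap01, H_comm b a, H_comm c a, H_comm c b] at this; linarith
  · have := T_le_of_le hbc.symm hac.symm hab.symm
      (by rwa [hammingDist_comm c a, hammingDist_comm c b])
      (by rwa [hammingDist_comm b a, hammingDist_comm c a])
    rw [T_swap01, T_swap12, T_swap01, H_comm b a, H_comm c a, H_comm c b] at this; linarith

/-- The bound for pairs as a function of the difference. -/
def W (x y : Word) : ℤ := ∑ S : Finset (Fin 24), chi S (xr x y) * (delta.getD #S 0 : ℕ)

lemma rs_comm (l l' : List ℕ) :
    rs l (fun t => (l'.getD t 0 : R)) = rs l' fun t => (l.getD t 0 : R) := by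
  rw [rs_eq_sum l _ (le_max_left l.length l'.length), rs_eq_sum l' _ (le_max_right l.length l'.length)]
  exact sum_congr rfl fun t _ => mul_comm _ _

lemma cell_false_false (S : Finset (Fin 24)) :
    cell S (fun _ => false) (fun _ => false) false false = #S := by
  simp [cell]

lemma W_cast (x y : Word) : ((dotN delta (getL [] (getL [] TK0 (24 - hammingDist x y))
    (hammingDist x y)) : ℕ) : R) = (W x y : ℤ) := by
  have hd := hammingDist_le x y
  rw [dotN_cast, rs_comm, rs_TK0 (by omega), W, Int.cast_sum]
  have h := signedSum (fun _ => false) (fun _ => false) (xr x y) univ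
    fun _ _ _ d => (delta.getD d 0 : R)
  have h1 (p q r : Bool) (hpq : (p || q) = true) :
      cell3 univ (fun _ => false) (fun _ => false) (xr x y) p q r = 0 := by
    rw [cell3, card_eq_zero, filter_eq_empty_iff]
    revert hpq
    cases p <;> cases q <;> simp
  have h2 : cell3 univ (fun _ => false) (fun _ => false) (xr x y) false false true =
      hammingDist x y := by
    simp [cell3, hammingDist_eq_wt, wt]
  have h3 : cell3 univ (fun _ => false) (fun _ => false) (xr x y) false false false =
      24 - hammingDist x y := by
    rw [← h2, cell3, cell3, eq_tsub_iff_add_eq_of_le]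
    · simpa using card_filter_add_card_filter_not (s := univ) (fun i => xr x y i = false)
    · exact (card_le_univ _).trans (by simp)
  rw [h1 true true false rfl, h1 true true true rfl, h1 true false false rfl,
    h1 true false true rfl, h1 false true false rfl, h1 false true true rfl, h2, h3] at h
  rw [powerset_univ] at h
  simp only [cell_false_false] at h
  refine Eq.trans ?_ (h.symm.trans (sum_congr rfl fun S _ => ?_))
  · simp [cs]
  · rw [Int.cast_mul, Int.cast_natCast]; rfl

lemma abs_W_le (x y : Word) : |W x y| ≤ 2 ^ 24 * (1 * 2 ^ 90) := by
  refine abs_sum_le univ _ (2 ^ 24) ?_ (by positivity) fun S _ => abs_mul_le ?_ ?_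
  · rw [card_univ, Fintype.card_finset, Fintype.card_fin]
  · rw [chi_eq_pow, abs_pow, abs_neg, abs_one, one_pow]
  · have h : delta.getD #S 0 ≤ 2 ^ 90 := by
      generalize #S = n
      rcases lt_or_ge n 25 with h | h
      · interval_cases n <;> decide +kernel
      · rw [List.getD_eq_default _ _ (h.trans' (by decide))]; positivity
    rw [Nat.abs_cast]; exact_mod_cast h

lemma pair_le {a b : Word} (hab : Ok a b) :
    4 * G a a a b + 3 * G a a b b + (W a b + (1602 * H a b + kap)) ≤ 0 := by
  have h := quads_ge_14
  rw [all5_eq] at h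
  simp only [andB_eq_true] at h
  have h := h.2.2.2.1
  have hd := hammingDist_le a b
  unfold pairs at h
  have h := impB_elim (allB_elim h (i := hammingDist a b) (by omega)) hab.okd
  have c1 : cnt a a a b false true true = 0 := cnt_eq_zero fun i => by simp [xr]
  have c2 : cnt a a a b false true false = 0 := cnt_eq_zero fun i => by simp [xr]
  have c3 : cnt a a b b false true false = 0 := cnt_eq_zero fun i => by simp
  have c4 : cnt a a b b false false true = 0 := cnt_eq_zero fun i => by simp
  have e1 := hammingDist_03 a a a b
  have e2 := hammingDist_03 a a b b
  have s1 := sum_cnt a a a b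
  have s2 := sum_cnt a a b b
  simp only [cnt_self, c1, c2, c3, c4, zero_add, add_zero] at e1 e2 s1 s2
  have v1 := valG_self a a b
  have v2 := valG_self a b b
  have f1 : cnt a a a b false false false = Nat.sub 24 (hammingDist a b) := by
    rw [Nat.sub_eq]; omega
  have f2 : cnt a a b b false false false = Nat.sub 24 (hammingDist a b) := by
    rw [Nat.sub_eq]; omega
  rw [c1, c2, f1, ← e1] at v1
  rw [c3, c4, f2, ← e2] at v2
  rw [← v1, ← v2] at h
  refine nonpos_of_cast h ?_ ?_
  · simp only [cast_mod, Nat.add_eq, Nat.mul_eq, Nat.sub_eq, Nat.cast_add, Nat.cast_mul, valG_cast,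
      W_cast, H]
    push_cast
    ring
  · have h4 : |(4 : ℤ)| ≤ 4 := by norm_num
    have h3 : |(3 : ℤ)| ≤ 3 := by norm_num
    have h1602 : |(1602 : ℤ)| ≤ 1602 := by norm_num
    have hH : |H a b| ≤ 2 ^ 80 := by rw [abs_of_nonneg (H_nonneg a b)]; exact H_le a b
    have hk : |(kap : ℤ)| ≤ kap := by rw [Nat.abs_cast]
    refine (abs_add_le_of_le (abs_add_le_of_le (abs_mul_le h4 (abs_G_le a a a b))
      (abs_mul_le h3 (abs_G_le a a b b))) (abs_add_le_of_le (abs_W_le a b)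
      (abs_add_le_of_le (abs_mul_le h1602 hH) hk))).trans ?_
    unfold kap
    norm_num

lemma G_self_le (a : Word) : G a a a a ≤ 55695727428406170122230000000 := by
  have h := quads_ge_14
  rw [all5_eq] at h
  simp only [andB_eq_true] at h
  have h := h.2.2.2.2
  unfold const at h
  have c1 (q r : Bool) (hqr : (q || r) = true) : cnt a a a a false q r = 0 :=
    cnt_eq_zero fun i => by simp [xr]; revert hqr; cases q <;> simp
  have s := sum_cnt a a a a
  have v := valG_self a a a
  simp only [cnt_self, c1 true true rfl, c1 true false rfl, c1 false true rfl, zero_add] at s v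
  rw [s] at v
  rw [← v] at h
  rw [← sub_nonpos]
  refine nonpos_of_cast h ?_ ?_
  · simp only [cast_mod, Nat.add_eq, Nat.mul_eq, Nat.cast_add, Nat.cast_mul, cast_neg1, valG_cast]
    push_cast
    ring
  · exact (abs_sub _ _).trans ((add_le_add_left (abs_G_le a a a a) _).trans (by norm_num))

end TriplesAndPairs

section Summation

variable {α : Type*} [DecidableEq α] {C : Finset α}

/-- The sum over ordered pairs of distinct elements. -/
def sumTwo (C : Finset α) (F : α → α → ℤ) : ℤ := ∑ a ∈ C, ∑ b ∈ C, if a ≠ b then F a b else 0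

/-- The sum over ordered triples of distinct elements. -/
def sumThree (C : Finset α) (F : α → α → α → ℤ) : ℤ :=
  ∑ a ∈ C, ∑ b ∈ C, ∑ c ∈ C, if a ≠ b ∧ a ≠ c ∧ b ≠ c then F a b c else 0

lemma sum_eq_add_one (f : α → ℤ) {a : α} (ha : a ∈ C) :
    ∑ b ∈ C, f b = f a + ∑ b ∈ C, if a ≠ b then f b else 0 := by
  rw [← sum_filter, filter_ne, add_sum_erase _ _ ha]

lemma sum_eq_add_two (f : α → ℤ) {a b : α} (ha : a ∈ C) (hb : b ∈ C) (hab : a ≠ b) :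
    ∑ c ∈ C, f c = f a + f b + ∑ c ∈ C, if a ≠ c ∧ b ≠ c then f c else 0 := by
  rw [sum_eq_add_one f ha, sum_eq_add_one _ hb, if_pos hab, add_assoc]
  simp only [← ite_and, and_comm]

lemma sum_eq_add_three (f : α → ℤ) {a b c : α} (ha : a ∈ C) (hb : b ∈ C) (hc : c ∈ C)
    (hab : a ≠ b) (hac : a ≠ c) (hbc : b ≠ c) :
    ∑ d ∈ C, f d = f a + f b + f c + ∑ d ∈ C, if a ≠ d ∧ b ≠ d ∧ c ≠ d then f d else 0 := by
  rw [sum_eq_add_two f ha hb hab, sum_eq_add_one _ hc, if_pos ⟨hac, hbc⟩, ← add_assoc]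
  simp only [← ite_and]
  congr 1
  exact sum_congr rfl fun d _ => if_congr (by tauto) rfl rfl

lemma sumTwo_mono {F F' : α → α → ℤ} (h : ∀ a ∈ C, ∀ b ∈ C, a ≠ b → F a b ≤ F' a b) :
    sumTwo C F ≤ sumTwo C F' :=
  sum_le_sum fun a ha => sum_le_sum fun b hb => by
    split_ifs with h1
    exacts [h a ha b hb h1, le_rfl]

lemma sumThree_mono {F F' : α → α → α → ℤ}
    (h : ∀ a ∈ C, ∀ b ∈ C, ∀ c ∈ C, a ≠ b → a ≠ c → b ≠ c → F a b c ≤ F' a b c) :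
    sumThree C F ≤ sumThree C F' :=
  sum_le_sum fun a ha => sum_le_sum fun b hb => sum_le_sum fun c hc => by
    split_ifs with h1
    exacts [h a ha b hb c hc h1.1 h1.2.1 h1.2.2, le_rfl]

lemma sumTwo_add (F F' : α → α → ℤ) :
    sumTwo C (fun a b => F a b + F' a b) = sumTwo C F + sumTwo C F' := by
  simp only [sumTwo, ← sum_add_distrib]
  refine sum_congr rfl fun a _ => sum_congr rfl fun b _ => ?_
  split_ifs <;> simp

lemma sumTwo_mul (k : ℤ) (F : α → α → ℤ) : sumTwo C (fun a b => k * F a b) = k * sumTwo C F := by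
  simp only [sumTwo, mul_sum, mul_ite, mul_zero]

lemma sumThree_add (F F' : α → α → α → ℤ) :
    sumThree C (fun a b c => F a b c + F' a b c) = sumThree C F + sumThree C F' := by
  simp only [sumThree, ← sum_add_distrib]
  refine sum_congr rfl fun a _ => sum_congr rfl fun b _ => sum_congr rfl fun c _ => ?_
  split_ifs <;> simp

lemma sumTwo_swap (F : α → α → ℤ) : sumTwo C (fun a b => F b a) = sumTwo C F := by
  rw [sumTwo, sumTwo, sum_comm]
  simp only [ne_comm]

lemma sumThree_swap01 (F : α → α → α → ℤ) :
    sumThree C (fun a b c => F b a c) = sumThree C F := by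
  rw [sumThree, sumThree, sum_comm]
  refine sum_congr rfl fun a _ => sum_congr rfl fun b _ => sum_congr rfl fun c _ => ?_
  exact if_congr (by tauto) rfl rfl

lemma sumThree_swap12 (F : α → α → α → ℤ) :
    sumThree C (fun a b c => F a c b) = sumThree C F := by
  rw [sumThree, sumThree]
  refine sum_congr rfl fun a _ => ?_
  rw [sum_comm]
  refine sum_congr rfl fun b _ => sum_congr rfl fun c _ => ?_
  exact if_congr (by tauto) rfl rfl

lemma sumTwo_eq (F : α → α → ℤ) : sumTwo C F = ∑ a ∈ C, ∑ b ∈ C, F a b - ∑ a ∈ C, F a a := by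
  rw [eq_sub_iff_add_eq', sumTwo, ← sum_add_distrib]
  exact sum_congr rfl fun a ha => (sum_eq_add_one _ ha).symm

lemma sumTwo_const (k : ℤ) : sumTwo C (fun _ _ => k) = #C * (#C - 1) * k := by
  rw [sumTwo_eq]
  simp only [sum_const, nsmul_eq_mul]
  ring

lemma sum_ite_eq_sumThree (F : α → α → α → ℤ) : ∑ a ∈ C, ∑ b ∈ C, (if a ≠ b then
    ∑ c ∈ C, (if a ≠ c ∧ b ≠ c then F a b c else 0) else 0) = sumThree C F := by
  refine sum_congr rfl fun a _ => sum_congr rfl fun b _ => ?_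
  split_ifs with h
  · simp only [h, true_and, ne_eq, not_false_eq_true]
  · simp only [h, false_and, if_false, sum_const_zero]

lemma sumTwo_sum (F : α → α → α → ℤ) : sumTwo C (fun a b => ∑ c ∈ C, F a b c) =
    sumTwo C (fun a b => F a b a) + sumTwo C (fun a b => F a b b) + sumThree C F := by
  rw [← sum_ite_eq_sumThree]
  simp only [sumTwo, ← sum_add_distrib]
  refine sum_congr rfl fun a ha => sum_congr rfl fun b hb => ?_
  split_ifs with h
  · exact sum_eq_add_two _ ha hb h
  · simp

lemma sum_sum_eq (F : α → α → ℤ) :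
    ∑ a ∈ C, ∑ b ∈ C, F a b = ∑ a ∈ C, F a a + sumTwo C F := by
  rw [sumTwo_eq]; ring

lemma sumThree_fst_snd (F : α → α → ℤ) :
    sumThree C (fun a b _ => F a b) = (#C - 2) * sumTwo C F := by
  have := sumTwo_sum (C := C) fun a b _ => F a b
  simp only [sum_const, nsmul_eq_mul, sumTwo_mul] at this
  linarith

lemma sum_sum_sum_eq {U : α → α → α → ℤ} (h01 : ∀ a b c, U b a c = U a b c)
    (h12 : ∀ a b c, U a c b = U a b c) : ∑ a ∈ C, ∑ b ∈ C, ∑ c ∈ C, U a b c =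
    sumThree C U + 3 * sumTwo C (fun a b => U a a b) + ∑ a ∈ C, U a a a := by
  rw [sum_sum_eq, sum_sum_eq, sumTwo_sum]
  have h1 : sumTwo C (fun a b => U a b b) = sumTwo C fun a b => U a a b := by
    rw [← sumTwo_swap]
    refine sum_congr rfl fun a _ => sum_congr rfl fun b _ => ?_
    beta_reduce
    rw [h01, h12]
  have h2 : sumTwo C (fun a b => U a b a) = sumTwo C fun a b => U a a b := by
    simp only [h12]
  rw [h1, h2]
  ring

end Summation

section Final

variable {C : Finset Word}

lemma quadSum_G_le (hC : ∀ u ∈ C, ∀ v ∈ C, u ≠ v → Ok u v) : quadSum C G ≤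
    2 * sumThree C T + sumTwo C (fun a b => 4 * G a a a b + 3 * G a a b b) +
      ∑ a ∈ C, G a a a a := by
  have h0 : quadSum C G = sumThree C (fun a b c => ∑ d ∈ C, G a b c d) +
      3 * sumTwo C (fun a b => ∑ d ∈ C, G a a b d) + ∑ a ∈ C, ∑ b ∈ C, G a a a b :=
    sum_sum_sum_eq (U := fun a b c => ∑ d ∈ C, G a b c d)
      (fun a b c => sum_congr rfl fun d _ => G_swap01 a b c d)
      fun a b c => sum_congr rfl fun d _ => G_swap12 a b c d
  have h1 : sumThree C (fun a b c => ∑ d ∈ C, G a b c d) ≤ sumThree C T := by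
    refine sumThree_mono fun a ha b hb c hc hab hac hbc => ?_
    rw [sum_eq_add_three _ ha hb hc hab hac hbc]
    have : ∑ d ∈ C, (if a ≠ d ∧ b ≠ d ∧ c ≠ d then G a b c d else 0) ≤ 0 :=
      sum_nonpos fun d hd => by
        split_ifs with h
        exacts [G_nonpos (hC a ha b hb hab) (hC a ha c hc hac) (hC b hb c hc hbc)
          (hC a ha d hd h.1) (hC b hb d hd h.2.1) (hC c hc d hd h.2.2), le_rfl]
    have e1 : G a b c a = G a a b c := by rw [← G_swap23, ← G_swap12]
    have e2 : G a b c b = G b b a c := by rw [← G_swap23, ← G_swap12, ← G_swap01, ← G_swap12, G_swap01]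
    have e3 : G a b c c = G c c a b := by
      simp only [G_swap01, G_swap12, G_swap23]
    rw [e1, e2, e3, T]
    linarith
  have h2 : sumTwo C (fun a b => ∑ d ∈ C, G a a b d) = sumTwo C (fun a b => G a a a b) +
      sumTwo C (fun a b => G a a b b) + sumThree C (fun a b c => G a a b c) := by
    rw [sumTwo_sum]
    simp only [fun a b => (G_swap23 a a b a).symm]
  have h3 : sumThree C T = 3 * sumThree C (fun a b c => G a a b c) := by
    have e1 := sumThree_swap01 (C := C) fun a b c => G a a b c
    have e2 := sumThree_swap12 (C := C) fun a b c => G b b a c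
    have e3 : sumThree C T = _ := sumThree_add (fun a b c => G a a b c) fun a b c => G b b a c + G c c a b
    rw [e3, sumThree_add, e2, e1]
    ring
  rw [h0, sum_sum_eq, sumTwo_add, sumTwo_mul, sumTwo_mul, h2]
  linarith

lemma chi_sq (S : Finset (Fin 24)) (x : Word) : chi S x * chi S x = 1 := by
  rw [chi_eq_pow, ← mul_pow]; simp

lemma one_le_sum_chi_sq (hodd : #C % 2 = 1) (S : Finset (Fin 24)) :
    1 ≤ (∑ a ∈ C, chi S a) * ∑ a ∈ C, chi S a := by
  have h : (2 : ℤ) ∣ #C - ∑ a ∈ C, chi S a := by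
    have : (#C : ℤ) - ∑ a ∈ C, chi S a = ∑ a ∈ C, (1 - chi S a) := by
      rw [sum_sub_distrib]; simp
    rw [this]
    refine dvd_sum fun a _ => ?_
    rcases mul_self_eq_one_iff.1 (chi_sq S a) with h | h <;> rw [h] <;> norm_num
  have h1 : ∑ a ∈ C, chi S a ≠ 0 := by omega
  have := mul_self_pos.2 h1
  omega

/-- The value of `W` on the diagonal. -/
def Delta : ℤ := ∑ S : Finset (Fin 24), (delta.getD #S 0 : ℕ)

lemma W_self (a : Word) : W a a = Delta := by
  simp only [W, chi_xr, chi_sq, one_mul, Delta]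

lemma Delta_le_sum (hodd : #C % 2 = 1) : Delta ≤ ∑ a ∈ C, ∑ b ∈ C, W a b := by
  have h : ∑ a ∈ C, ∑ b ∈ C, W a b = ∑ S : Finset (Fin 24),
      (delta.getD #S 0 : ℕ) * ((∑ a ∈ C, chi S a) * ∑ b ∈ C, chi S b) := by
    simp only [sum_mul_sum]
    simp only [mul_sum, W, chi_xr]
    symm
    rw [sum_comm]
    refine sum_congr rfl fun a _ => ?_
    rw [sum_comm]
    exact sum_congr rfl fun b _ => sum_congr rfl fun S _ => by ring
  rw [h]
  refine sum_le_sum fun S _ => ?_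
  exact le_mul_of_one_le_right (Int.natCast_nonneg _) (one_le_sum_chi_sq hodd S)

lemma Delta_eq : Delta = 9419262058120780905654166588 := by
  rw [Delta, ← powerset_univ]
  rw [← Nat.cast_sum, sum_powerset_apply_card fun k => delta.getD k 0]
  simp [sum_range_succ, delta, Nat.choose]

lemma card_ne (hC : ∀ u ∈ C, ∀ v ∈ C, u ≠ v → Ok u v) : #C ≠ 269 := by
  intro hN
  have h1 := (quadSum_G_nonneg C).trans (quadSum_G_le hC)
  have h2 : sumThree C T ≤ 3 * (267 * sumTwo C H) := by
    refine (sumThree_mono (F' := fun a b c => H a b + (H a c + H b c))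
      fun a ha b hb c hc hab hac hbc => T_le (hC a ha b hb hab) (hC a ha c hc hac)
        (hC b hb c hc hbc)).trans_eq ?_
    have e1 := sumThree_swap12 (C := C) fun a b _ => H a b
    have e2 := sumThree_swap01 (C := C) fun a _ c => H a c
    have e3 := sumThree_fst_snd (C := C) H
    rw [sumThree_add, sumThree_add, e2, e1, e3, hN]
    push_cast
    ring
  have h3 : sumTwo C (fun a b => 4 * G a a a b + 3 * G a a b b) + (sumTwo C W +
      (1602 * sumTwo C H + sumTwo C fun _ _ => (kap : ℤ))) ≤ 0 := by
    rw [← sumTwo_mul, ← sumTwo_add, ← sumTwo_add, ← sumTwo_add]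
    refine (sumTwo_mono (F' := fun _ _ => 0) fun a ha b hb hab =>
      pair_le (hC a ha b hb hab)).trans_eq ?_
    rw [sumTwo_const, mul_zero]
  have h4 := sum_le_sum (s := C) fun a _ => G_self_le a
  have h5 := Delta_le_sum (C := C) (by rw [hN])
  rw [sum_sum_eq] at h5
  simp only [W_self, sum_const, nsmul_eq_mul, hN] at h4 h5
  rw [sumTwo_const, hN] at h3
  rw [Delta_eq] at h5
  simp only [kap] at h3
  push_cast at *
  linarith

/-- The word obtained by replacing the first letter by a parity check. -/
def evenWord (x : Word) : Word := Function.update x 0 (decide (chi (univ.erase 0) x = -1))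

lemma chi_evenWord (x : Word) : chi univ (evenWord x) = 1 := by
  have h : chi (univ.erase 0) (evenWord x) = chi (univ.erase 0) x :=
    prod_congr rfl fun i hi => by rw [evenWord, Function.update_of_ne (ne_of_mem_erase hi)]
  rw [chi, ← mul_prod_erase _ _ (mem_univ 0), ← chi, h, evenWord, Function.update_self]
  rcases mul_self_eq_one_iff.1 (chi_sq (univ.erase 0) x) with h | h <;> rw [h] <;> rfl

lemma hammingDist_evenWord_mod (x y : Word) : hammingDist (evenWord x) (evenWord y) % 2 = 0 := by
  have h := chi_xr univ (evenWord x) (evenWord y)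
  rw [chi_evenWord, chi_evenWord, chi_eq_pow, ← hammingDist_eq_wt, mul_one,
    neg_one_pow_eq_one_iff_even (by norm_num)] at h
  exact Nat.even_iff.1 h

lemma hammingDist_le_evenWord (x y : Word) :
    hammingDist x y ≤ hammingDist (evenWord x) (evenWord y) + 1 := by
  refine (card_le_card fun i hi => ?_).trans (card_insert_le 0 _)
  rw [mem_insert]
  rcases eq_or_ne i 0 with h | h
  · exact Or.inl h
  · right
    rw [mem_filter] at hi ⊢
    rwa [evenWord, evenWord, Function.update_of_ne h, Function.update_of_ne h]

end Final

/-- A binary code of length 24 and minimum distance at least 10 has at most 268 words. -/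
theorem card_le_of_ten_le_hammingDist (C : Finset (Fin 24 → Bool))
    (hC : ∀ u ∈ C, ∀ v ∈ C, u ≠ v → 10 ≤ hammingDist u v) : C.card ≤ 268 := by
  by_contra! hlt
  have hOk : ∀ u ∈ C, ∀ v ∈ C, u ≠ v → Ok (evenWord u) (evenWord v) := fun u hu v hv huv => by
    have h1 := hC u hu v hv huv
    have h2 := hammingDist_le_evenWord u v
    have h3 := hammingDist_evenWord_mod u v
    exact ⟨by omega, h3⟩
  have hinj : Set.InjOn evenWord C := fun u hu v hv h => by
    by_contra huv
    have := (hOk u hu v hv huv).1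
    rw [h, hammingDist_self] at this
    omega
  obtain ⟨D, hD, hcard⟩ := exists_subset_card_eq (s := C.image evenWord) (n := 269)
    (by rw [card_image_of_injOn hinj]; omega)
  refine card_ne (C := D) (fun u hu v hv huv => ?_) hcard
  obtain ⟨x, hx, rfl⟩ := mem_image.1 (hD hu)
  obtain ⟨y, hy, rfl⟩ := mem_image.1 (hD hv)
  exact hOk x hx y hy fun h => huv (h ▸ rfl)

end CodeBound

/-- `A(24,10) ≤ 268`: every binary code of length 24 in which any two distinct
codewords have Hamming distance at least 10 has at most 268 codewords. -/
theorem A_24_10_le_268 (C : Finset (Fin 24 → Bool))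
    (hC : ∀ u ∈ C, ∀ v ∈ C, u ≠ v → 10 ≤ hammingDist u v) :
    C.card ≤ 268 :=
  CodeBound.card_le_of_ten_le_hammingDist C hC
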